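/- For every A > 0 and every ε > 0 there exist δ > 0 and x₀ such that for all real x > x₀ and all real Q with x (log x)^{−A} ≤ Q ≤ δ x, one has | Σ_{q ≤ Q} Σ_{a=1}^{q} ( Σ_{n ≤ x, n ≡ a (mod q)} μ(n) )² − Q Σ_{n ≤ x} μ(n)² | ≤ ε Q Σ_{n ≤ x} μ(n)²; that is, the variance Σ_{q ≤ Q} Σ_{a=1}^{q} |Σ_{n ≤ x, n ≡ a (mod q)} μ(n)|² is asymptotic to Q Σ_{n ≤ x} μ(n)² in the range x (log x)^{−A} ≤ Q = o(x). -/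

import Mathlib

namespace MoebiusVariance

open Complex Filter Topology MeasureTheory

/-- The mean value of a Dirichlet character. -/
noncomputable def charMean {q : ℕ} [NeZero q] (χ : DirichletCharacter ℂ q) : ℂ :=
  (∑ a : ZMod q, χ a) / q

section
variable {q : ℕ} [NeZero q] (χ : DirichletCharacter ℂ q)

lemma charMean_of_ne_one (h : χ ≠ 1) : charMean χ = 0 := by
  simp [charMean, MulChar.sum_eq_zero_of_ne_one h]

lemma norm_charMean_le : ‖charMean χ‖ ≤ 1 := by
  have hq : (0 : ℝ) < q := by exact_mod_cast NeZero.pos q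
  rw [charMean, norm_div, Complex.norm_natCast, div_le_one hq]
  refine (norm_sum_le _ _).trans ?_
  refine (Finset.sum_le_sum fun a _ => DirichletCharacter.norm_le_one χ a).trans ?_
  simp [ZMod.card]

lemma sum_range_period : ∑ n ∈ Finset.range q, χ (n : ZMod q) = ∑ a : ZMod q, χ a := by
  refine Finset.sum_bij' (fun n _ => (n : ZMod q)) (fun a _ => a.val) ?_ ?_ ?_ ?_ ?_
  · simp
  · intro a _; simpa using ZMod.val_lt a
  · intro n hn; simpa using ZMod.val_cast_of_lt (by simpa using hn)
  · intro a _; simp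
  · simp

lemma sum_range_sub_charMean (N : ℕ) :
    ‖∑ n ∈ Finset.range N, (χ (n : ZMod q) - charMean χ)‖ ≤ 2 * q := by
  have hq := NeZero.pos q
  induction N using Nat.strong_induction_on with
  | _ N ih =>
    rcases lt_or_ge N q with h | h
    · refine (norm_sum_le _ _).trans ?_
      have : ∀ n ∈ Finset.range N, ‖χ (n : ZMod q) - charMean χ‖ ≤ 2 := fun n _ =>
        (norm_sub_le _ _).trans (by
          linarith [DirichletCharacter.norm_le_one χ (n : ZMod q), norm_charMean_le χ])
      refine (Finset.sum_le_sum this).trans ?_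
      have : (N : ℝ) ≤ q := by exact_mod_cast h.le
      simp; linarith
    · obtain ⟨M, rfl⟩ := Nat.exists_eq_add_of_le h
      rw [Finset.sum_range_add]
      have : ∑ n ∈ Finset.range q, (χ (n : ZMod q) - charMean χ) = 0 := by
        rw [Finset.sum_sub_distrib, sum_range_period]
        have : (q : ℂ) ≠ 0 := by exact_mod_cast hq.ne'
        simp [charMean]; field_simp; simp
      rw [this, zero_add]
      simpa using ih M (by omega)

/-- The discrepancy of the character sum over `(N, u]`, zero for `u ≤ N`. -/
noncomputable def charDisc (N : ℕ) (u : ℝ) : ℂ :=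
  if (N : ℝ) < u then ∑ n ∈ Finset.Ioc N ⌊u⌋₊, χ (n : ZMod q) - charMean χ * (u - N) else 0

lemma norm_charDisc_le (N : ℕ) (u : ℝ) : ‖charDisc χ N u‖ ≤ 5 * q := by
  have hq : (1 : ℝ) ≤ q := by exact_mod_cast NeZero.pos q
  rw [charDisc]
  split_ifs with h
  · have hu0 : 0 ≤ u := (Nat.cast_nonneg N).trans h.le
    have hN : N ≤ ⌊u⌋₊ := Nat.le_floor h.le
    have h1 : ∑ n ∈ Finset.Ioc N ⌊u⌋₊, χ (n : ZMod q) - charMean χ * (u - N) =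
        ∑ n ∈ Finset.range (⌊u⌋₊ + 1), (χ (n : ZMod q) - charMean χ) -
        ∑ n ∈ Finset.range (N + 1), (χ (n : ZMod q) - charMean χ)
        - charMean χ * ((u - ⌊u⌋₊ : ℝ) : ℂ) := by
      have : Finset.Ioc N ⌊u⌋₊ = Finset.Ico (N + 1) (⌊u⌋₊ + 1) := by ext; simp
      rw [this, Finset.sum_Ico_eq_sub _ (by omega)]
      simp only [Finset.sum_sub_distrib]
      simp
      ring
    rw [h1]
    have h2 := sum_range_sub_charMean χ (⌊u⌋₊ + 1)
    have h3 := sum_range_sub_charMean χ (N + 1)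
    have h4 : ‖charMean χ * ((u - ⌊u⌋₊ : ℝ) : ℂ)‖ ≤ 1 := by
      rw [norm_mul, Complex.norm_real]
      have : ‖u - ⌊u⌋₊‖ ≤ 1 := by
        rw [Real.norm_eq_abs, abs_le]
        constructor <;> linarith [Nat.floor_le hu0, Nat.lt_floor_add_one u]
      nlinarith [norm_nonneg (charMean χ), norm_charMean_le χ, norm_nonneg (u - ⌊u⌋₊)]
    refine (norm_sub_le _ _).trans ?_
    linarith [norm_sub_le (∑ n ∈ Finset.range (⌊u⌋₊ + 1), (χ (n : ZMod q) - charMean χ))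
      (∑ n ∈ Finset.range (N + 1), (χ (n : ZMod q) - charMean χ))]
  · simp

lemma measurable_charDisc (N : ℕ) : Measurable (charDisc χ N) := by
  unfold charDisc
  refine Measurable.ite measurableSet_Ioi ?_ measurable_const
  refine Measurable.sub ?_ (by fun_prop)
  exact (measurable_from_nat (f := fun m => ∑ n ∈ Finset.Ioc N m, χ (n : ZMod q))).comp
    Nat.measurable_floor

/-- Mellin-type transform of the discrepancy. -/
noncomputable def discInt (N : ℕ) (s : ℂ) : ℂ := mellin (charDisc χ N) (-s)

lemma differentiableAt_discInt {N : ℕ} (hN : 0 < N) {s : ℂ} (hs : 0 < s.re) :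
    DifferentiableAt ℂ (discInt χ N) s := by
  have : DifferentiableAt ℂ (mellin (charDisc χ N)) (-s) := by
    refine mellin_differentiableAt_of_isBigO_rpow (a := 0) (b := -s.re - 1) ?_ ?_ ?_ ?_ ?_
    · apply LocallyIntegrable.locallyIntegrableOn
      refine MeasureTheory.LocallyIntegrable.mono (g := charDisc χ N)
        (f := fun _ => (5 * q : ℝ)) (locallyIntegrable_const _)
        (measurable_charDisc χ N).aestronglyMeasurable (ae_of_all _ fun u => ?_)
      rw [Real.norm_of_nonneg (by positivity)]
      exact norm_charDisc_le χ N u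
    · refine Asymptotics.IsBigO.of_bound (5 * q) (Eventually.of_forall fun u => ?_)
      simpa using norm_charDisc_le χ N u
    · simpa using hs
    · refine Asymptotics.IsBigO.of_bound 1 ?_
      have : ∀ᶠ u : ℝ in 𝓝[>] 0, u < 1 := eventually_nhdsWithin_of_eventually_nhds
        (eventually_lt_nhds one_pos)
      filter_upwards [this] with u hu
      have : ¬ ((N : ℝ) < u) := by
        have : (1 : ℝ) ≤ N := by exact_mod_cast hN
        linarith
      simp [charDisc, this]
    · simp
  exact this.comp s differentiableAt_id.neg

lemma norm_discInt_le {N : ℕ} (hN : 0 < N) {s : ℂ} (hs : 0 < s.re) :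
    ‖discInt χ N s‖ ≤ 5 * q * ((N : ℝ) ^ (-s.re) / s.re) := by
  have hN' : (0 : ℝ) < N := by exact_mod_cast hN
  have h1 : discInt χ N s = ∫ u in Set.Ioi (N : ℝ), (u : ℂ) ^ (-s - 1) • charDisc χ N u := by
    rw [discInt, mellin]
    refine (setIntegral_eq_of_subset_of_forall_sdiff_eq_zero measurableSet_Ioi
      (Set.Ioi_subset_Ioi hN'.le) ?_)
    rintro u ⟨_, hu⟩
    rw [Set.mem_Ioi] at hu
    simp [charDisc, hu]
  rw [h1]
  have h2 : ∀ u ∈ Set.Ioi (N : ℝ), ‖(u : ℂ) ^ (-s - 1) • charDisc χ N u‖ ≤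
      5 * q * u ^ (-s.re - 1) := by
    intro u hu
    have hu0 : 0 < u := hN'.trans hu
    rw [norm_smul, norm_cpow_eq_rpow_re_of_pos hu0]
    have := norm_charDisc_le χ N u
    simp only [sub_re, neg_re, one_re]
    rw [mul_comm]
    gcongr
  have h3 : IntegrableOn (fun u : ℝ => u ^ (-s.re - 1)) (Set.Ioi (N : ℝ)) :=
    integrableOn_Ioi_rpow_of_lt (by linarith) hN'
  refine (norm_integral_le_of_norm_le (h3.const_mul (5 * (q : ℝ)))
    ((ae_restrict_iff' measurableSet_Ioi).mpr (ae_of_all _ h2))).trans ?_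
  rw [integral_const_mul, integral_Ioi_rpow_of_lt (by linarith) hN']
  apply le_of_eq
  congr 1
  rw [show -s.re - 1 + 1 = -s.re by ring, neg_div, div_neg, neg_neg]

/-- `(s - 1) L(s, χ)` as an entire function. -/
noncomputable def polarL : ℂ → ℂ :=
  open Classical in
  if χ = 1 then DirichletCharacter.LFunctionTrivChar₁ q
  else fun s => (s - 1) * DirichletCharacter.LFunction χ s

lemma polarL_eq {s : ℂ} (hs : s ≠ 1) : polarL χ s = (s - 1) * DirichletCharacter.LFunction χ s := by
  unfold polarL
  split_ifs with h
  · subst h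
    simp [DirichletCharacter.LFunctionTrivChar₁, Function.update_of_ne hs]
  · rfl

lemma differentiable_polarL : Differentiable ℂ (polarL χ) := by
  unfold polarL
  split_ifs with h
  · exact DirichletCharacter.differentiable_LFunctionTrivChar₁ q
  · exact (differentiable_id.sub_const 1).mul (DirichletCharacter.differentiable_LFunction h)

lemma LSeries_tail {N : ℕ} (hN : 0 < N) {s : ℂ} (hs : 1 < s.re) :
    DirichletCharacter.LFunction χ s = ∑ n ∈ Finset.Icc 1 N, χ (n : ZMod q) * (n : ℂ) ^ (-s)
      + charMean χ * (N : ℂ) ^ (1 - s) / (s - 1) + s * discInt χ N s := by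
  have hN' : (0 : ℝ) < N := by exact_mod_cast hN
  have hNc : (N : ℂ) ≠ 0 := by exact_mod_cast hN.ne'
  have hs0 : s ≠ 0 := fun h => by simp [h] at hs; linarith
  have hs1 : s - 1 ≠ 0 := fun h => by
    have : s = 1 := sub_eq_zero.mp h
    simp [this] at hs
  set f : ℕ → ℂ := fun n => if N < n then χ (n : ZMod q) else 0 with hf
  set g : ℕ → ℂ := fun n => if N < n then 0 else χ (n : ZMod q) with hg
  have hχs : LSeriesSummable (fun n => χ (n : ZMod q)) s :=
    DirichletCharacter.LSeriesSummable_of_one_lt_re χ hs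
  have hgs : HasSum (LSeries.term g s)
      (∑ n ∈ Finset.Icc 1 N, χ (n : ZMod q) * (n : ℂ) ^ (-s)) := by
    have : ∑ n ∈ Finset.Icc 1 N, χ (n : ZMod q) * (n : ℂ) ^ (-s) =
        ∑ n ∈ Finset.Icc 1 N, LSeries.term g s n := by
      refine Finset.sum_congr rfl fun n hn => ?_
      rw [Finset.mem_Icc] at hn
      rw [LSeries.term_of_ne_zero (by omega), hg]
      simp only [not_lt.mpr hn.2, if_false]
      rw [cpow_neg, div_eq_mul_inv]
    rw [this]
    refine hasSum_sum_of_ne_finset_zero fun n hn => ?_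
    rcases Nat.eq_zero_or_pos n with rfl | h0
    · simp
    · have : N < n := by
        by_contra h
        exact hn (Finset.mem_Icc.mpr ⟨h0, not_lt.mp h⟩)
      rw [LSeries.term_of_ne_zero h0.ne']
      simp [hg, this]
  have hgsum : LSeriesSummable g s := hgs.summable
  have hfg : f = (fun n : ℕ => χ (n : ZMod q)) - g := by
    ext n
    by_cases h : N < n <;> simp [hf, hg, h]
  have h1 : LSeries f s = DirichletCharacter.LFunction χ s -
      ∑ n ∈ Finset.Icc 1 N, χ (n : ZMod q) * (n : ℂ) ^ (-s) := by
    rw [hfg, LSeries_sub hχs hgsum, DirichletCharacter.LFunction_eq_LSeries χ hs]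
    congr 1
    exact hgs.tsum_eq
  have hO : (fun n : ℕ ↦ ∑ k ∈ Finset.Icc 1 n, ‖f k‖) =O[atTop] fun n ↦ (n : ℝ) ^ (1 : ℝ) := by
    refine Asymptotics.IsBigO.of_bound 1 (Eventually.of_forall fun n => ?_)
    rw [Real.norm_of_nonneg (Finset.sum_nonneg fun _ _ => norm_nonneg _), Real.rpow_one, one_mul,
      Real.norm_of_nonneg (Nat.cast_nonneg n)]
    refine (Finset.sum_le_card_nsmul _ _ 1 fun k _ => ?_).trans (by simp)
    by_cases h : N < k
    · simpa [hf, h] using DirichletCharacter.norm_le_one χ (k : ZMod q)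
    · simp [hf, h]
  have h2 := LSeries_eq_mul_integral' f zero_le_one hs hO
  have hsum : ∀ u : ℝ, ∑ k ∈ Finset.Icc 1 ⌊u⌋₊, f k = ∑ n ∈ Finset.Ioc N ⌊u⌋₊, χ (n : ZMod q) := by
    intro u
    rw [hf, ← Finset.sum_filter]
    congr 1
    ext n
    simp
    omega
  have h3 : ∫ t in Set.Ioi (1 : ℝ), (∑ k ∈ Finset.Icc 1 ⌊t⌋₊, f k) * (t : ℂ) ^ (-(s + 1)) =
      ∫ t in Set.Ioi (N : ℝ), (∑ k ∈ Finset.Icc 1 ⌊t⌋₊, f k) * (t : ℂ) ^ (-(s + 1)) := by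
    refine setIntegral_eq_of_subset_of_forall_sdiff_eq_zero measurableSet_Ioi
      (Set.Ioi_subset_Ioi (by exact_mod_cast hN)) ?_
    rintro u ⟨_, hu⟩
    rw [Set.mem_Ioi, not_lt] at hu
    rw [hsum, Finset.Ioc_eq_empty, Finset.sum_empty, zero_mul]
    exact not_lt.mpr (Nat.floor_le_of_le hu)
  have hd : discInt χ N s = ∫ u in Set.Ioi (N : ℝ), (u : ℂ) ^ (-s - 1) • charDisc χ N u := by
    rw [discInt, mellin]
    refine (setIntegral_eq_of_subset_of_forall_sdiff_eq_zero measurableSet_Ioi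
      (Set.Ioi_subset_Ioi hN'.le) ?_)
    rintro u ⟨_, hu⟩
    rw [Set.mem_Ioi] at hu
    simp [charDisc, hu]
  have hi1 : IntegrableOn (fun u : ℝ => (u : ℂ) ^ (-s)) (Set.Ioi (N : ℝ)) :=
    integrableOn_Ioi_cpow_of_lt (by simpa using hs) hN'
  have hi2 : IntegrableOn (fun u : ℝ => (u : ℂ) ^ (-s - 1)) (Set.Ioi (N : ℝ)) :=
    integrableOn_Ioi_cpow_of_lt (by simp; linarith) hN'
  have hi3 : IntegrableOn (fun u : ℝ => (u : ℂ) ^ (-s - 1) • charDisc χ N u) (Set.Ioi (N : ℝ)) := by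
    simp_rw [smul_eq_mul]
    exact hi2.mul_bdd (c := 5 * q)
      (measurable_charDisc χ N).aestronglyMeasurable (ae_of_all _ fun u => norm_charDisc_le χ N u)
  have h4 : ∫ t in Set.Ioi (N : ℝ), (∑ k ∈ Finset.Icc 1 ⌊t⌋₊, f k) * (t : ℂ) ^ (-(s + 1)) =
      ∫ u in Set.Ioi (N : ℝ), ((u : ℂ) ^ (-s - 1) • charDisc χ N u +
        (charMean χ * (u : ℂ) ^ (-s) - charMean χ * N * (u : ℂ) ^ (-s - 1))) := by
    refine setIntegral_congr_fun measurableSet_Ioi fun u hu => ?_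
    have hu' : (N : ℝ) < u := hu
    have hu0 : (u : ℂ) ≠ 0 := by exact_mod_cast (hN'.trans hu').ne'
    have : (u : ℂ) ^ (-s) = (u : ℂ) ^ (-s - 1) * u := by
      rw [cpow_sub _ _ hu0, cpow_one]; field_simp
    simp only [hsum, charDisc, hu', if_true, smul_eq_mul, this]
    rw [show -(s + 1) = -s - 1 by ring]
    ring
  have hi4 : IntegrableOn (fun u : ℝ => charMean χ * (u : ℂ) ^ (-s) -
      charMean χ * N * (u : ℂ) ^ (-s - 1)) (Set.Ioi (N : ℝ)) :=
    (hi1.const_mul _).sub (hi2.const_mul _)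
  rw [integral_add hi3 hi4, integral_sub (hi1.const_mul _)
    (hi2.const_mul _), integral_const_mul, integral_const_mul, ← hd,
    integral_Ioi_cpow_of_lt (by simpa using hs) hN',
    integral_Ioi_cpow_of_lt (by simp; linarith) hN'] at h4
  have h5 := h1.symm.trans (h2.trans (by rw [h3, h4]))
  rw [sub_eq_iff_eq_add] at h5
  rw [h5, show -s - 1 + 1 = -s by ring, show -s + 1 = 1 - s by ring]
  have e1 : ((N : ℝ) : ℂ) ^ (1 - s) = N * (N : ℂ) ^ (-s) := by
    rw [sub_eq_add_neg, cpow_add _ _ (by exact_mod_cast hNc)]; simp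
  have e2 : (N : ℂ) ^ (1 - s) = N * (N : ℂ) ^ (-s) := by simpa using e1
  have hs2 : 1 - s ≠ 0 := fun h => hs1 (by linear_combination -h)
  rw [e1, e2]
  push_cast
  field_simp
  ring

/-- Analytic continuation of the truncated series formula to `0 < re s`. -/
lemma polarL_formula {N : ℕ} (hN : 0 < N) {s : ℂ} (hs : 0 < s.re) :
    polarL χ s = (s - 1) * ∑ n ∈ Finset.Icc 1 N, χ (n : ZMod q) * (n : ℂ) ^ (-s)
      + charMean χ * (N : ℂ) ^ (1 - s) + (s - 1) * s * discInt χ N s := by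
  set U : Set ℂ := {z | 0 < z.re} with hU
  have hUo : IsOpen U := isOpen_lt continuous_const continuous_re
  have hNc : (N : ℂ) ≠ 0 := by exact_mod_cast hN.ne'
  have hUc : IsPreconnected U := (convex_halfSpace_re_gt 0).isPreconnected
  have hF : AnalyticOnNhd ℂ (polarL χ) U :=
    (differentiable_polarL χ).differentiableOn.analyticOnNhd hUo
  set G : ℂ → ℂ := fun s => (s - 1) * ∑ n ∈ Finset.Icc 1 N, χ (n : ZMod q) * (n : ℂ) ^ (-s)
      + charMean χ * (N : ℂ) ^ (1 - s) + (s - 1) * s * discInt χ N s with hG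
  have hGd : AnalyticOnNhd ℂ G U := by
    refine DifferentiableOn.analyticOnNhd (fun z hz => DifferentiableAt.differentiableWithinAt ?_)
      hUo
    have h1 : DifferentiableAt ℂ (discInt χ N) z := differentiableAt_discInt χ hN hz
    have h2 : ∀ n ∈ Finset.Icc 1 N,
        DifferentiableAt ℂ (fun s : ℂ => χ (n : ZMod q) * (n : ℂ) ^ (-s)) z := by
      intro n hn
      have : (n : ℂ) ≠ 0 := by
        have := (Finset.mem_Icc.mp hn).1
        exact_mod_cast (by omega : n ≠ 0)
      exact (differentiableAt_id.neg.const_cpow (Or.inl this)).const_mul _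
    have h3 : DifferentiableAt ℂ (fun s : ℂ => (N : ℂ) ^ (1 - s)) z :=
      ((differentiableAt_const _).sub differentiableAt_id).const_cpow (Or.inl hNc)
    have h4 := DifferentiableAt.fun_sum h2
    exact (((differentiableAt_id.sub_const 1).mul h4).add (h3.const_mul _)).add
      (((differentiableAt_id.sub_const 1).mul differentiableAt_id).mul h1)
  have h2U : (2 : ℂ) ∈ U := by simp [hU]
  have key : polarL χ =ᶠ[𝓝 2] G := by
    have : {z : ℂ | 1 < z.re} ∈ 𝓝 (2 : ℂ) :=
      (isOpen_lt continuous_const continuous_re).mem_nhds (by simp)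
    filter_upwards [this] with z hz
    have hz1 : z ≠ 1 := fun h => by simp [h] at hz
    have := sub_ne_zero.mpr hz1
    rw [polarL_eq χ hz1, LSeries_tail χ hN hz, hG]
    field_simp
  exact hF.eqOn_of_preconnected_of_eventuallyEq hGd hUc h2U key hs

end

/-- `q (|im s| + 2)`. -/
noncomputable def height (q : ℕ) (s : ℂ) : ℝ := q * (|s.im| + 2)

lemma norm_truncated_le {q : ℕ} (χ : DirichletCharacter ℂ q) {ε : ℝ} (hε : 0 < ε)
    {N : ℕ} (hN : 0 < N) {s : ℂ} (hs : 1 - ε ≤ s.re) :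
    ‖∑ n ∈ Finset.Icc 1 N, χ (n : ZMod q) * (n : ℂ) ^ (-s)‖ ≤ (1 + 1 / ε) * (N : ℝ) ^ (2 * ε) := by
  have hN' : (1 : ℝ) ≤ N := by exact_mod_cast hN
  have h1 : ∀ n ∈ Finset.Icc 1 N, ‖χ (n : ZMod q) * (n : ℂ) ^ (-s)‖ ≤
      (N : ℝ) ^ ε * (n : ℝ)⁻¹ := by
    intro n hn
    rw [Finset.mem_Icc] at hn
    have hn1 : (1 : ℝ) ≤ n := by exact_mod_cast hn.1
    have hn2 : (n : ℝ) ≤ N := by exact_mod_cast hn.2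
    rw [norm_mul, norm_natCast_cpow_of_pos hn.1]
    calc _ ≤ 1 * (n : ℝ) ^ (-s).re := by
          gcongr; exact DirichletCharacter.norm_le_one χ _
      _ ≤ (n : ℝ) ^ (ε - 1) := by
          rw [one_mul]
          exact Real.rpow_le_rpow_of_exponent_le hn1 (by simp; linarith)
      _ = (n : ℝ) ^ ε * (n : ℝ)⁻¹ := by
          rw [Real.rpow_sub (by linarith), Real.rpow_one, div_eq_mul_inv]
      _ ≤ _ := by gcongr
  refine (norm_sum_le _ _).trans ((Finset.sum_le_sum h1).trans ?_)
  rw [← Finset.mul_sum]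
  have h2 : ∑ n ∈ Finset.Icc 1 N, (n : ℝ)⁻¹ ≤ 1 + Real.log N := by
    have := harmonic_le_one_add_log N
    rw [harmonic_eq_sum_Icc] at this
    push_cast at this
    exact this
  have h3 : Real.log N ≤ (N : ℝ) ^ ε / ε := Real.log_le_rpow_div (by linarith) hε
  have h4 : 1 ≤ (N : ℝ) ^ ε := Real.one_le_rpow hN' hε.le
  have h5 : (N : ℝ) ^ (2 * ε) = (N : ℝ) ^ ε * (N : ℝ) ^ ε := by
    rw [two_mul, Real.rpow_add (by linarith)]
  rw [h5]
  calc _ ≤ (N : ℝ) ^ ε * ((N : ℝ) ^ ε + (N : ℝ) ^ ε / ε) := by gcongr; linarith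
    _ = _ := by ring

section
variable {q : ℕ} [NeZero q] (χ : DirichletCharacter ℂ q)

lemma two_le_height (s : ℂ) : 2 ≤ height q s := by
  have hq : (1 : ℝ) ≤ q := by exact_mod_cast NeZero.pos q
  have := abs_nonneg s.im
  unfold height
  nlinarith

/-- `L(s, χ)`, multiplied by `(s - 1) / (s + 1)` when `χ` is principal. -/
noncomputable def normL (s : ℂ) : ℂ :=
  open Classical in
  if χ = 1 then polarL χ s / (s + 1) else DirichletCharacter.LFunction χ s

open Classical in
/-- The factor removing the pole. -/
noncomputable def poleFactor (s : ℂ) : ℂ := if χ = 1 then (s - 1) / (s + 1) else 1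

lemma normL_eq {s : ℂ} (hs : s ≠ 1) :
    normL χ s = DirichletCharacter.LFunction χ s * poleFactor χ s := by
  unfold normL poleFactor
  split_ifs
  · rw [polarL_eq χ hs]; ring
  · simp

lemma differentiableAt_normL {s : ℂ} (hs : 0 < s.re) : DifferentiableAt ℂ (normL χ) s := by
  unfold normL
  split_ifs with h
  · refine (differentiable_polarL χ s).div (differentiableAt_id.add_const 1) fun h => ?_
    have := congrArg Complex.re h
    simp at this
    linarith
  · exact DirichletCharacter.differentiable_LFunction h s

lemma norm_sub_one_le {s : ℂ} (hs : 0 ≤ s.re) : ‖s - 1‖ ≤ ‖s + 1‖ := by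
  rw [← sq_le_sq₀ (norm_nonneg _) (norm_nonneg _), Complex.sq_norm, Complex.sq_norm,
    normSq_apply, normSq_apply]
  simp
  nlinarith

lemma one_le_norm_add_one {s : ℂ} (hs : 0 ≤ s.re) : 1 ≤ ‖s + 1‖ := by
  refine le_trans ?_ (Complex.re_le_norm _)
  simpa using hs

lemma normL_bound_aux {ε : ℝ} (hε : 0 < ε) (hε2 : ε ≤ 1 / 2) {s : ℂ} (hs : 1 - ε ≤ s.re)
    (hs1 : s ≠ 1) :
    ‖normL χ s‖ ≤ 2 * (12 + 1 / ε) * height q s ^ (2 * ε) := by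
  have hq : 0 < q := NeZero.pos q
  set N : ℕ := q * (⌈|s.im|⌉₊ + 2) with hN
  have hNpos : 0 < N := by positivity
  have hq' : (1 : ℝ) ≤ q := by exact_mod_cast hq
  have hc1 := Nat.le_ceil |s.im|
  have hc2 := (Nat.ceil_lt_add_one (abs_nonneg s.im)).le
  have ht := abs_nonneg s.im
  have hNr : (N : ℝ) = q * (⌈|s.im|⌉₊ + 2) := by rw [hN]; push_cast; ring
  have hN2 : (N : ℝ) ≤ 2 * height q s := by
    rw [hNr, height]; nlinarith
  have hN1 : (1 : ℝ) ≤ N := by exact_mod_cast hNpos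
  have hσ : 1 / 2 ≤ s.re := by linarith
  have hσ0 : 0 < s.re := by linarith
  have hT1 := norm_truncated_le χ hε hNpos hs
  have hNε : (N : ℝ) ^ ε ≤ (N : ℝ) ^ (2 * ε) := Real.rpow_le_rpow_of_exponent_le hN1 (by linarith)
  have hT3 : ‖s * discInt χ N s‖ ≤ 10 * (N : ℝ) ^ (2 * ε) := by
    rw [norm_mul]
    have h1 := norm_discInt_le χ hNpos hσ0
    have h2 : ‖s‖ ≤ s.re + |s.im| := by
      have := Complex.norm_le_abs_re_add_abs_im s
      rwa [abs_of_pos hσ0] at this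
    have h3 : ‖s‖ / s.re ≤ 1 + 2 * |s.im| := by
      rw [div_le_iff₀ hσ0]; nlinarith
    calc ‖s‖ * ‖discInt χ N s‖ ≤ ‖s‖ * (5 * q * ((N : ℝ) ^ (-s.re) / s.re)) := by gcongr
      _ = ‖s‖ / s.re * (5 * q) * (N : ℝ) ^ (-s.re) := by ring
      _ ≤ (1 + 2 * |s.im|) * (5 * q) * (N : ℝ) ^ (ε - 1) := by
          gcongr
          · linarith
      _ ≤ 10 * N * (N : ℝ) ^ (ε - 1) := by
          refine mul_le_mul_of_nonneg_right ?_ (by positivity)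
          rw [hNr]; nlinarith
      _ = 10 * (N : ℝ) ^ ε := by
          rw [Real.rpow_sub (by linarith), Real.rpow_one]; field_simp
      _ ≤ _ := by gcongr
  have hT2 : ‖charMean χ * (N : ℂ) ^ (1 - s)‖ ≤ (N : ℝ) ^ (2 * ε) := by
    rw [norm_mul, norm_natCast_cpow_of_pos hNpos]
    calc _ ≤ 1 * (N : ℝ) ^ (1 - s).re := by gcongr; exact norm_charMean_le χ
      _ ≤ (N : ℝ) ^ (2 * ε) := by
        rw [one_mul]; exact Real.rpow_le_rpow_of_exponent_le hN1 (by simp; linarith)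
  have hfin : (12 + 1 / ε) * (N : ℝ) ^ (2 * ε) ≤ 2 * (12 + 1 / ε) * height q s ^ (2 * ε) := by
    have h1 : (N : ℝ) ^ (2 * ε) ≤ (2 * height q s) ^ (2 * ε) := by gcongr
    have hh : 0 ≤ height q s := by linarith [two_le_height (q := q) s]
    rw [Real.mul_rpow (by norm_num) hh] at h1
    have h2 : (2 : ℝ) ^ (2 * ε) ≤ 2 := by
      calc (2 : ℝ) ^ (2 * ε) ≤ 2 ^ (1 : ℝ) :=
            Real.rpow_le_rpow_of_exponent_le (by norm_num) (by linarith)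
        _ = 2 := by simp
    have h3 : 0 < 1 / ε := by positivity
    calc _ ≤ (12 + 1 / ε) * (2 * height q s ^ (2 * ε)) := by
          gcongr; exact h1.trans (by gcongr)
      _ = _ := by ring
  refine le_trans ?_ hfin
  have hform := polarL_formula χ hNpos hσ0
  have hNp : 0 ≤ (N : ℝ) ^ (2 * ε) := by positivity
  have hs1' : s - 1 ≠ 0 := sub_ne_zero.mpr hs1
  unfold normL
  split_ifs with h
  · rw [norm_div, div_le_iff₀ (by linarith [one_le_norm_add_one hσ0.le])]
    rw [hform, mul_assoc (s - 1), add_right_comm, ← mul_add]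
    refine (norm_add_le _ _).trans ?_
    rw [norm_mul]
    have h1 := norm_sub_one_le hσ0.le
    have h2 := one_le_norm_add_one hσ0.le
    have h3 := norm_add_le (∑ n ∈ Finset.Icc 1 N, χ (n : ZMod q) * (n : ℂ) ^ (-s))
      (s * discInt χ N s)
    calc _ ≤ ‖s + 1‖ * ((1 + 1 / ε) * (N : ℝ) ^ (2 * ε) + 10 * (N : ℝ) ^ (2 * ε)) +
          (N : ℝ) ^ (2 * ε) * ‖s + 1‖ := by
          gcongr
          · exact h3.trans (add_le_add hT1 hT3)
          · nlinarith
      _ = _ := by ring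
  · rw [charMean_of_ne_one χ h, polarL_eq χ hs1, zero_mul, add_zero, mul_assoc, ← mul_add] at hform
    have := mul_left_cancel₀ hs1' hform
    rw [this]
    refine (norm_add_le _ _).trans ?_
    calc _ ≤ (1 + 1 / ε) * (N : ℝ) ^ (2 * ε) + 10 * (N : ℝ) ^ (2 * ε) := add_le_add hT1 hT3
      _ ≤ _ := by nlinarith

lemma normL_bound {ε : ℝ} (hε : 0 < ε) (hε2 : ε ≤ 1 / 2) {s : ℂ} (hs : 1 - ε ≤ s.re) :
    ‖normL χ s‖ ≤ 2 * (12 + 1 / ε) * height q s ^ (2 * ε) := by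
  rcases ne_or_eq s 1 with h | rfl
  · exact normL_bound_aux χ hε hε2 hs h
  · have hc : Tendsto (fun x : ℝ => ‖normL χ (1 + x : ℂ)‖) (𝓝[>] 0) (𝓝 ‖normL χ 1‖) := by
      have h1 : ContinuousAt (fun x : ℝ => ‖normL χ (1 + x : ℂ)‖) 0 := by
        have : ContinuousAt (normL χ) (1 + (0 : ℝ) : ℂ) :=
          (differentiableAt_normL χ (by simp)).continuousAt
        exact (ContinuousAt.comp (f := fun x : ℝ => (1 + x : ℂ)) this (by fun_prop)).norm
      simpa using h1.tendsto.mono_left nhdsWithin_le_nhds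
    refine le_of_tendsto hc ?_
    filter_upwards [self_mem_nhdsWithin] with x hx
    have hx' : (0 : ℝ) < x := hx
    have := normL_bound_aux χ hε hε2 (s := 1 + x) (by simp; linarith) (by simp [hx'.ne'])
    simpa [height] using this

lemma deriv_normL_bound {ε : ℝ} (hε : 0 < ε) (hε2 : ε ≤ 1 / 2) {s : ℂ} (hs : 1 - ε / 2 ≤ s.re) :
    ‖deriv (normL χ) s‖ ≤ 8 / ε * (12 + 1 / ε) * height q s ^ (2 * ε) := by
  have hR : 0 < ε / 2 := by positivity
  have hd : DiffContOnCl ℂ (normL χ) (Metric.ball s (ε / 2)) := by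
    refine DifferentiableOn.diffContOnCl fun z hz => ?_
    rw [closure_ball _ hR.ne', Metric.mem_closedBall, dist_eq_norm] at hz
    have h1 := (abs_le.mp ((Complex.abs_re_le_norm (z - s)).trans hz)).1
    rw [sub_re] at h1
    exact (differentiableAt_normL χ (by linarith)).differentiableWithinAt
  have h := Complex.norm_deriv_le_of_forall_mem_sphere_norm_le hR hd
    (C := 2 * (12 + 1 / ε) * (2 * height q s ^ (2 * ε))) ?_
  · refine h.trans (le_of_eq ?_)
    field_simp
    ring
  · intro z hz
    rw [mem_sphere_iff_norm] at hz
    have h1 := (abs_le.mp ((Complex.abs_re_le_norm (z - s)).trans hz.le)).1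
    have h2 := abs_le.mp ((Complex.abs_im_le_norm (z - s)).trans hz.le)
    rw [sub_re] at h1
    rw [sub_im] at h2
    refine (normL_bound χ hε hε2 (by linarith)).trans ?_
    have hh : height q z ≤ 2 * height q s := by
      unfold height
      have hq : (0 : ℝ) ≤ q := Nat.cast_nonneg q
      have h3 : |z.im| ≤ |s.im| + 1 := by
        rcases abs_cases z.im with h | h <;> rcases abs_cases s.im with h' | h' <;> linarith
      nlinarith [abs_nonneg s.im, mul_nonneg hq (abs_nonneg s.im)]
    have hz0 : 0 ≤ height q z := by linarith [two_le_height (q := q) z]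
    have hs0 : 0 ≤ height q s := by linarith [two_le_height (q := q) s]
    gcongr
    calc height q z ^ (2 * ε) ≤ (2 * height q s) ^ (2 * ε) := by gcongr
      _ = 2 ^ (2 * ε) * height q s ^ (2 * ε) := Real.mul_rpow (by norm_num) hs0
      _ ≤ 2 ^ (1 : ℝ) * height q s ^ (2 * ε) := by
          gcongr
          · norm_num
          · linarith
      _ = _ := by simp

lemma normL_sub_le {ε : ℝ} (hε : 0 < ε) (hε2 : ε ≤ 1 / 2) {z w : ℂ} {T : ℝ}
    (hz : 1 - ε / 2 ≤ z.re) (hw : 1 - ε / 2 ≤ w.re) (hzT : |z.im| ≤ T) (hwT : |w.im| ≤ T) :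
    ‖normL χ z - normL χ w‖ ≤ 8 / ε * (12 + 1 / ε) * (q * (T + 2)) ^ (2 * ε) * ‖z - w‖ := by
  set S : Set ℂ := {u | 1 - ε / 2 ≤ u.re} ∩ {u | |u.im| ≤ T} with hS
  have hconv : Convex ℝ S := by
    refine (convex_halfSpace_re_ge _).inter ?_
    have : {u : ℂ | |u.im| ≤ T} = {u | -T ≤ u.im} ∩ {u | u.im ≤ T} := by
      ext u; simp [abs_le]
    rw [this]
    exact (convex_halfSpace_im_ge _).inter (convex_halfSpace_im_le _)
  refine hconv.norm_image_sub_le_of_norm_deriv_le (𝕜 := ℂ) (f := normL χ) ?_ ?_ ⟨hw, hwT⟩ ⟨hz, hzT⟩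
  · rintro u ⟨hu, _⟩
    rw [Set.mem_ofPred_eq] at hu
    exact differentiableAt_normL χ (by linarith)
  · rintro u ⟨hu, huT⟩
    refine (deriv_normL_bound χ hε hε2 hu).trans ?_
    have : 0 ≤ height q u := by linarith [two_le_height (q := q) u]
    have : height q u ≤ q * (T + 2) := by
      unfold height
      have : |u.im| ≤ T := huT
      gcongr
    gcongr

end

section Estermann
open scoped ComplexOrder

variable {f : ℕ → ℂ} {H : ℂ → ℂ}

lemma residue_nonneg (hf : 0 ≤ f) (hH : Differentiable ℂ H)
    (h : ∀ s : ℂ, 1 < s.re → H s = (s - 1) * LSeries f s) : 0 ≤ H 1 := by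
  have hlim : Tendsto (fun x : ℝ ↦ H (x : ℂ)) (𝓝[>] 1) (𝓝 (H 1)) := by
    have : Tendsto (fun x : ℝ ↦ H (x : ℂ)) (𝓝 1) (𝓝 (H ((1 : ℝ) : ℂ))) :=
      (hH.continuous.comp continuous_ofReal).tendsto 1
    simpa using this.mono_left nhdsWithin_le_nhds
  refine ge_of_tendsto hlim ?_
  filter_upwards [self_mem_nhdsWithin] with x hx
  have hx : 1 < x := hx
  rw [h _ (by simpa using hx)]
  refine mul_nonneg ?_ (tsum_nonneg fun n ↦ LSeries.term_nonneg (hf n) x)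
  have : (0 : ℝ) ≤ x - 1 := by linarith
  exact_mod_cast (zero_le_real.2 this)

lemma taylor_coeff_dslope (hab : LSeries.abscissaOfAbsConv f ≤ 1)
    (h : ∀ s : ℂ, 1 < s.re → H s = (s - 1) * LSeries f s) (m : ℕ) :
    iteratedDeriv m (dslope H 1) 2 =
      iteratedDeriv m (LSeries f) 2 - H 1 * ((-1) ^ m * m.factorial) := by
  have hU : IsOpen {s : ℂ | 1 < s.re} := continuous_re.isOpen_preimage _ isOpen_Ioi
  have h2 : (2 : ℂ) ∈ {s : ℂ | 1 < s.re} := by simp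
  have hEq : Set.EqOn (dslope H 1) (fun s ↦ LSeries f s - H 1 * (1 * s - 1)⁻¹)
      {s : ℂ | 1 < s.re} := by
    intro s hs
    have hs1 : s ≠ 1 := by rintro rfl; simp at hs
    have hs0 : s - 1 ≠ 0 := sub_ne_zero.2 hs1
    simp only
    rw [dslope_of_ne _ hs1, slope_def_field, h s hs]
    field_simp
  rw [hEq.iteratedDeriv_of_isOpen hU m h2]
  have hinv : AnalyticAt ℂ (fun s : ℂ ↦ (1 * s - 1)⁻¹) 2 := by
    apply AnalyticAt.inv
    · fun_prop
    · norm_num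
  have hcm : AnalyticAt ℂ (fun s : ℂ ↦ H 1 * (1 * s - 1)⁻¹) 2 := analyticAt_const.mul hinv
  have hL : AnalyticAt ℂ (LSeries f) 2 := by
    refine (LSeries_analyticOnNhd f) 2 ?_
    refine lt_of_le_of_lt hab ?_
    have : ((1 : ℝ) : EReal) < ((2 : ℝ) : EReal) := by exact_mod_cast one_lt_two
    simpa using this
  rw [iteratedDeriv_fun_sub hL.contDiffAt hcm.contDiffAt]
  congr 1
  rw [iteratedDeriv_const_mul_field]
  congr 1
  rw [iteratedDeriv_eq_iterate, iter_deriv_inv_linear_sub]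
  norm_num

theorem estermann (hf : 0 ≤ f) (hf1 : 1 ≤ f 1) (hab : LSeries.abscissaOfAbsConv f ≤ 1)
    (hH : Differentiable ℂ H) (h : ∀ s : ℂ, 1 < s.re → H s = (s - 1) * LSeries f s)
    {B : ℝ} (hB1 : 1 ≤ B) (hB : ∀ s ∈ Metric.sphere (2 : ℂ) (3 / 2), ‖H s‖ ≤ B) {β : ℝ}
    (hβ : 7 / 8 ≤ β) (hβ1 : β < 1) :
    (H β).im = 0 ∧ 0 ≤ H 1 ∧
      (0 ≤ (H β).re → (1 - β) / 6 * (32 * B) ^ (-(4 * (1 - β))) ≤ (H 1).re) := by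
  set lam : ℂ := H 1 with hlam
  have hlam0 : 0 ≤ lam := residue_nonneg hf hH h
  obtain ⟨l, hl⟩ : ∃ l : ℝ, lam = l := ⟨lam.re, by
    apply Complex.ext <;> simp [(Complex.nonneg_iff.1 hlam0).2.symm]⟩
  have hl0 : 0 ≤ l := by rw [hl] at hlam0; exact_mod_cast hlam0
  -- the Taylor coefficients are real
  have hb : ∀ m : ℕ, ∃ b : ℝ, 0 ≤ b ∧ (m = 0 → 1 ≤ b) ∧
      (-1) ^ m * iteratedDeriv m (LSeries f) 2 = (m.factorial : ℂ) * b := by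
    intro m
    have h12 : LSeries.abscissaOfAbsConv f < (2 : ℝ) :=
      lt_of_le_of_lt hab (by exact_mod_cast (one_lt_two : (1 : ℝ) < 2))
    have h1 := LSeries.iteratedDeriv_alternating hf h12 m
    obtain ⟨b, hb⟩ : ∃ b : ℝ, (-1) ^ m * iteratedDeriv m (LSeries f) ((2 : ℝ) : ℂ) = b :=
      ⟨_, by
        apply Complex.ext
        · rfl
        · rw [← (Complex.nonneg_iff.1 h1).2, Complex.ofReal_im]⟩
    have hb0 : 0 ≤ b := by rw [hb] at h1; exact_mod_cast h1
    refine ⟨b / m.factorial, by positivity, ?_, ?_⟩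
    · rintro rfl
      have hbe : LSeries f ((2 : ℝ) : ℂ) = b := by simpa using hb
      have hsum : LSeriesSummable f ((2 : ℝ) : ℂ) :=
        LSeriesSummable_of_abscissaOfAbsConv_lt_re (by simpa using h12)
      have h3 : LSeries.term f ((2 : ℝ) : ℂ) 1 ≤ LSeries f ((2 : ℝ) : ℂ) :=
        hsum.le_tsum 1 (fun n _ ↦ LSeries.term_nonneg (hf n) 2)
      rw [hbe, LSeries.term_of_ne_zero one_ne_zero] at h3
      have h4 : (1 : ℂ) ≤ b := hf1.trans (by simpa using h3)
      simpa using (show (1 : ℝ) ≤ b by exact_mod_cast h4)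
    · have : (m.factorial : ℂ) ≠ 0 := by exact_mod_cast m.factorial_ne_zero
      push_cast
      rw [mul_div_cancel₀ _ this, ← hb]
      norm_num
  choose b hb0 hb1 hbe using hb
  have hE : Differentiable ℂ (dslope H 1) := by
    rw [← differentiableOn_univ] at hH ⊢
    exact (Complex.differentiableOn_dslope Filter.univ_mem).2 hH
  have hsph : ∀ z ∈ Metric.sphere (2 : ℂ) (3 / 2), ‖dslope H 1 z‖ ≤ 4 * B := by
    have hl1 : ‖H 1‖ ≤ B := by
      refine Complex.norm_le_of_forall_mem_frontier_norm_le (U := Metric.ball (2 : ℂ) (3 / 2))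
        Metric.isBounded_ball hH.diffContOnCl (fun z hz ↦ hB z ?_) (subset_closure ?_)
      · rwa [frontier_ball _ (by norm_num)] at hz
      · rw [Metric.mem_ball, dist_eq_norm]; norm_num
    intro z hz
    have hz2 : 1 / 2 ≤ ‖z - 1‖ := by
      have h1 : ‖z - 2‖ = 3 / 2 := by rwa [mem_sphere_iff_norm] at hz
      have h2 : ‖z - 2‖ ≤ ‖z - 1‖ + ‖(1 : ℂ)‖ := by
        rw [show z - 2 = (z - 1) - 1 by ring]; exact norm_sub_le _ _
      rw [norm_one] at h2; linarith
    have hz1 : z ≠ 1 := by rintro rfl; norm_num at hz2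
    rw [dslope_of_ne _ hz1, slope_def_field, norm_div, div_le_iff₀ (by linarith)]
    calc ‖H z - H 1‖ ≤ ‖H z‖ + ‖H 1‖ := norm_sub_le _ _
      _ ≤ B + B := add_le_add (hB z hz) hl1
      _ ≤ 4 * B * ‖z - 1‖ := by nlinarith
  have hcoef : ∀ m, iteratedDeriv m (dslope H 1) 2 =
      (-1) ^ m * m.factorial * ((b m - l : ℝ) : ℂ) := by
    intro m
    rw [taylor_coeff_dslope hab h]
    have h1 : iteratedDeriv m (LSeries f) 2 = (-1) ^ m * ((m.factorial : ℂ) * b m) := by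
      rw [← hbe m, ← mul_assoc, ← mul_pow]; simp
    rw [h1, ← hlam, hl]; push_cast; ring
  have hcb : ∀ m, |b m - l| ≤ 4 * B / (3 / 2) ^ m := by
    intro m
    have h1 := Complex.norm_iteratedDeriv_le_of_forall_mem_sphere_norm_le m
      (by norm_num : (0 : ℝ) < 3 / 2) hE.diffContOnCl hsph
    rw [hcoef m] at h1
    simp only [norm_mul, norm_pow, norm_neg, norm_one, one_pow, one_mul, Complex.norm_natCast,
      Complex.norm_real, Real.norm_eq_abs] at h1
    have : (0 : ℝ) < m.factorial := by exact_mod_cast m.factorial_pos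
    rw [mul_div_assoc] at h1
    exact le_of_mul_le_mul_left h1 this
  have hβs : HasSum (fun m : ℕ ↦ (b m - l) * (2 - β) ^ m) (dslope H 1 β).re ∧
      (dslope H 1 β).im = 0 := by
    have h1 : HasSum (fun n : ℕ ↦ (n.factorial : ℂ)⁻¹ • ((β : ℂ) - 2) ^ n •
        iteratedDeriv n (dslope H 1) 2) (dslope H 1 β) := by
      refine Complex.hasSum_taylorSeries_on_ball (r := 3 / 2) hE.differentiableOn ?_
      rw [Metric.mem_ball, dist_eq_norm, show (β : ℂ) - 2 = ((β - 2 : ℝ) : ℂ) by push_cast; rfl,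
        Complex.norm_real, Real.norm_eq_abs, abs_lt]
      constructor <;> linarith
    have h2 : ∀ n : ℕ, (n.factorial : ℂ)⁻¹ • ((β : ℂ) - 2) ^ n •
        iteratedDeriv n (dslope H 1) 2 = (((b n - l) * (2 - β) ^ n : ℝ) : ℂ) := by
      intro n
      have : (n.factorial : ℂ) ≠ 0 := by exact_mod_cast n.factorial_ne_zero
      rw [hcoef, smul_eq_mul, smul_eq_mul,
        show (β : ℂ) - 2 = (-1) * ((2 - β : ℝ) : ℂ) by push_cast; ring, mul_pow]
      push_cast
      have h3 : ((-1 : ℂ) ^ n) * (-1) ^ n = 1 := by rw [← mul_pow]; simp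
      field_simp
      linear_combination ((2 : ℂ) - β) ^ n * (b n - l) * h3
    simp only [h2] at h1
    have h3 := Complex.hasSum_re h1
    have h4 := Complex.hasSum_im h1
    simp only [Complex.ofReal_re, Complex.ofReal_im] at h3 h4
    exact ⟨h3, h4.unique hasSum_zero⟩
  obtain ⟨hsum, him⟩ := hβs
  have hHβ : H β = lam - ((1 - β : ℝ) : ℂ) * dslope H 1 β := by
    have hβ2 : (β : ℂ) - 1 ≠ 0 := by
      rw [sub_ne_zero]; exact_mod_cast hβ1.ne
    rw [dslope_of_ne _ (sub_ne_zero.1 hβ2), slope_def_field]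
    push_cast
    field_simp
    ring
  refine ⟨by rw [hHβ, hl]; simp [him], hlam0, fun hre ↦ ?_⟩
  have hre' : (1 - β) * (dslope H 1 β).re ≤ l := by
    have : (H β).re = l - (1 - β) * (dslope H 1 β).re := by rw [hHβ, hl]; simp
    linarith
  rw [hl, Complex.ofReal_re]
  set u : ℝ := 2 - β with hu
  have hu1 : 1 < u := by simp only [hu]; linarith
  have hu2 : u ≤ 9 / 8 := by simp only [hu]; linarith
  -- choose the truncation point
  set M : ℕ := ⌈4 * Real.log (32 * B)⌉₊ with hM
  have hlog0 : 0 ≤ Real.log (32 * B) := Real.log_nonneg (by linarith)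
  have hMl : 4 * Real.log (32 * B) ≤ M := Nat.le_ceil _
  have hMu : (M : ℝ) ≤ 4 * Real.log (32 * B) + 1 := (Nat.ceil_lt_add_one (by positivity)).le
  have htail : 16 * B * (3 / 4 : ℝ) ^ M ≤ 1 / 2 := by
    have h1 : Real.log (3 / 4 : ℝ) ≤ -(1 / 4) := by
      have := Real.log_le_sub_one_of_pos (show (0 : ℝ) < 3 / 4 by norm_num); linarith
    have h2 : (3 / 4 : ℝ) ^ M ≤ (32 * B)⁻¹ := by
      rw [← Real.exp_log (show (0 : ℝ) < (3 / 4) ^ M by positivity),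
        ← Real.exp_log (show (0 : ℝ) < (32 * B)⁻¹ by positivity)]
      apply Real.exp_le_exp.2
      rw [Real.log_pow, Real.log_inv]
      nlinarith
    calc 16 * B * (3 / 4 : ℝ) ^ M ≤ 16 * B * (32 * B)⁻¹ := by gcongr
      _ = 1 / 2 := by field_simp; norm_num
  have hlow : 1 - l * (∑ m ∈ Finset.range M, u ^ m) - 16 * B * (3 / 4) ^ M
      ≤ (dslope H 1 β).re := by
    have hs := hsum.summable
    rw [← hsum.tsum_eq, ← hs.sum_add_tsum_nat_add M]
    have hM0 : 0 < M := Nat.ceil_pos.2 (mul_pos (by norm_num) (Real.log_pos (by linarith)))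
    have h1 : 1 - l * (∑ m ∈ Finset.range M, u ^ m) ≤
        ∑ m ∈ Finset.range M, (b m - l) * u ^ m := by
      have : 1 ≤ ∑ m ∈ Finset.range M, b m * u ^ m := by
        calc (1 : ℝ) ≤ b 0 * u ^ 0 := by simpa using hb1 0 rfl
          _ ≤ _ := Finset.single_le_sum (f := fun m ↦ b m * u ^ m)
            (fun i _ ↦ mul_nonneg (hb0 i) (by positivity)) (Finset.mem_range.2 hM0)
      simp only [sub_mul, Finset.sum_sub_distrib, ← Finset.mul_sum]
      linarith
    have hg : HasSum (fun m : ℕ ↦ 4 * B * (3 / 4 : ℝ) ^ M * (3 / 4) ^ m)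
        (4 * B * (3 / 4) ^ M * (1 - 3 / 4)⁻¹) :=
      (hasSum_geometric_of_lt_one (by norm_num) (by norm_num)).mul_left _
    have h2 : |∑' m, (b (m + M) - l) * u ^ (m + M)| ≤ 4 * B * (3 / 4) ^ M * (1 - 3 / 4)⁻¹ := by
      rw [← Real.norm_eq_abs]
      refine tsum_of_norm_bounded hg fun m ↦ ?_
      rw [Real.norm_eq_abs, abs_mul, abs_of_nonneg (show 0 ≤ u ^ (m + M) by positivity)]
      calc |b (m + M) - l| * u ^ (m + M)
          ≤ (4 * B / (3 / 2) ^ (m + M)) * (9 / 8) ^ (m + M) := by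
            gcongr
            exact hcb _
        _ = 4 * B * (3 / 4 : ℝ) ^ M * (3 / 4) ^ m := by
            have h34 : ((9 : ℝ) / 8) ^ (m + M) = (3 / 4) ^ (m + M) * (3 / 2) ^ (m + M) := by
              rw [← mul_pow]; norm_num
            rw [h34, pow_add (3 / 4 : ℝ)]
            field_simp
    have h3 := neg_abs_le (∑' m, (b (m + M) - l) * u ^ (m + M))
    norm_num at h2
    linarith
  have hgeom : (1 - β) * ∑ m ∈ Finset.range M, u ^ m = u ^ M - 1 := by
    have := mul_geom_sum u M
    rw [← this, hu]; ring
  have hmain : (1 - β) / 2 ≤ l * u ^ M := by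
    have h1 := mul_le_mul_of_nonneg_left hlow (show 0 ≤ 1 - β by linarith)
    have h2 : (1 - β) * (1 - l * (∑ m ∈ Finset.range M, u ^ m) - 16 * B * (3 / 4) ^ M) =
      (1 - β) - l * (u ^ M - 1) - (1 - β) * (16 * B * (3 / 4) ^ M) := by
      rw [← hgeom]; ring
    have h3 := mul_le_mul_of_nonneg_left htail (show 0 ≤ 1 - β by linarith)
    linarith
  have huM : u ^ M ≤ 3 * (32 * B) ^ (4 * (1 - β)) := by
    have h1 : u ≤ Real.exp (1 - β) := by
      have := Real.add_one_le_exp (1 - β); simp only [hu]; linarith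
    calc u ^ M ≤ Real.exp (1 - β) ^ M := by gcongr
      _ = Real.exp (M * (1 - β)) := by rw [← Real.exp_nat_mul]
      _ ≤ Real.exp (1 + Real.log (32 * B) * (4 * (1 - β))) := by
        apply Real.exp_le_exp.2
        have := mul_le_mul_of_nonneg_right hMu (show 0 ≤ 1 - β by linarith)
        nlinarith
      _ = Real.exp 1 * (32 * B) ^ (4 * (1 - β)) := by
        rw [Real.exp_add, Real.rpow_def_of_pos (by linarith)]
      _ ≤ _ := by
        gcongr
        exact Real.exp_one_lt_three.le
  have hp : 0 < (32 * B) ^ (4 * (1 - β)) := by positivity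
  rw [Real.rpow_neg (by positivity)]
  have h5 : (1 - β) / 2 ≤ l * (3 * (32 * B) ^ (4 * (1 - β))) :=
    hmain.trans (mul_le_mul_of_nonneg_left huM hl0)
  calc (1 - β) / 6 * ((32 * B) ^ (4 * (1 - β)))⁻¹
      = ((1 - β) / 2) * (3 * (32 * B) ^ (4 * (1 - β)))⁻¹ := by rw [mul_inv]; ring
    _ ≤ l * (3 * (32 * B) ^ (4 * (1 - β))) * (3 * (32 * B) ^ (4 * (1 - β)))⁻¹ := by gcongr
    _ = l := by field_simp

end Estermann

section LogDerivation
open scoped ComplexOrder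
open ArithmeticFunction

/-- `h` is the Dirichlet-series coefficient function of minus the logarithmic derivative of `F`. -/
def IsLogDeriv (h F : ArithmeticFunction ℂ) : Prop := ∀ n, F n * (Real.log n : ℂ) = (h * F) n

lemma IsLogDeriv.mul {h k F G : ArithmeticFunction ℂ} (hF : IsLogDeriv h F)
    (hG : IsLogDeriv k G) : IsLogDeriv (h + k) (F * G) := by
  intro n
  have h1 : (h + k) * (F * G) = (h * F) * G + F * (k * G) := by ring
  rw [h1, ArithmeticFunction.add_apply, ArithmeticFunction.mul_apply, ArithmeticFunction.mul_apply,
    ArithmeticFunction.mul_apply, Finset.sum_mul, ← Finset.sum_add_distrib]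
  refine Finset.sum_congr rfl fun p hp ↦ ?_
  rw [← hF p.1, ← hG p.2]
  have hp' := Nat.ne_zero_of_mem_divisorsAntidiagonal hp
  rw [← (Nat.mem_divisorsAntidiagonal.1 hp).1, Nat.cast_mul,
    Real.log_mul (by exact_mod_cast hp'.1) (by exact_mod_cast hp'.2)]
  push_cast
  ring

lemma IsLogDeriv.nonneg {h F : ArithmeticFunction ℂ} (hF : IsLogDeriv h F) (h0 : ∀ n, 0 ≤ h n)
    (h1 : h 1 = 0) (hF1 : 0 ≤ F 1) (n : ℕ) : 0 ≤ F n := by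
  induction n using Nat.strong_induction_on with
  | _ n ih =>
    rcases Nat.lt_or_ge n 2 with hn | hn
    · interval_cases n
      · simp
      · exact hF1
    · have hlog : 0 < Real.log n := Real.log_pos (by exact_mod_cast hn)
      have h2 : 0 ≤ (h * F) n := by
        rw [ArithmeticFunction.mul_apply]
        refine Finset.sum_nonneg fun p hp ↦ ?_
        have hp' := Nat.ne_zero_of_mem_divisorsAntidiagonal hp
        have hpn := (Nat.mem_divisorsAntidiagonal.1 hp).1
        rcases eq_or_ne p.1 1 with h3 | h3
        · rw [h3, h1, zero_mul]
        · refine mul_nonneg (h0 _) (ih _ ?_)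
          have : 2 ≤ p.1 := by have := hp'.1; omega
          have : 0 < p.2 := Nat.pos_of_ne_zero hp'.2
          nlinarith
      rw [← hF n] at h2
      have h3 : (0 : ℂ) ≤ ((Real.log n)⁻¹ : ℝ) := by
        exact zero_le_real.2 (inv_nonneg.2 hlog.le)
      have h4 := mul_nonneg h2 h3
      have h5 : (Real.log n : ℂ) ≠ 0 := by exact_mod_cast hlog.ne'
      rwa [ofReal_inv, mul_assoc, mul_inv_cancel₀ h5, mul_one] at h4

/-- A Dirichlet character as an arithmetic function. -/
noncomputable def charArith {q : ℕ} (χ : DirichletCharacter ℂ q) : ArithmeticFunction ℂ :=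
  toArithmeticFunction (fun n ↦ χ (n : ZMod q))

/-- A Dirichlet character times the von Mangoldt function as an arithmetic function. -/
noncomputable def charMangoldt {q : ℕ} (χ : DirichletCharacter ℂ q) : ArithmeticFunction ℂ :=
  toArithmeticFunction (fun n ↦ χ (n : ZMod q) * (ArithmeticFunction.vonMangoldt n : ℂ))

lemma charArith_apply {q : ℕ} (χ : DirichletCharacter ℂ q) {n : ℕ} (hn : n ≠ 0) :
    charArith χ n = χ (n : ZMod q) := by
  simp [charArith, toArithmeticFunction, hn]

lemma charMangoldt_apply {q : ℕ} (χ : DirichletCharacter ℂ q) (n : ℕ) :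
    charMangoldt χ n = χ (n : ZMod q) * (ArithmeticFunction.vonMangoldt n : ℂ) := by
  rcases eq_or_ne n 0 with rfl | hn <;> simp [charMangoldt, toArithmeticFunction, *]

lemma isLogDeriv_char {q : ℕ} (χ : DirichletCharacter ℂ q) :
    IsLogDeriv (charMangoldt χ) (charArith χ) := by
  intro n
  rcases eq_or_ne n 0 with rfl | hn
  · simp
  have h := congrFun (DirichletCharacter.convolution_twist_vonMangoldt χ) n
  simp only [LSeries.convolution, Pi.mul_apply] at h
  rw [charArith_apply χ hn, Complex.ofReal_log (Nat.cast_nonneg n)]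
  exact h.symm

lemma LSeriesSummable_charArith {q : ℕ} (χ : DirichletCharacter ℂ q) {s : ℂ} (hs : 1 < s.re) :
    LSeriesSummable (charArith χ) s :=
  (LSeriesSummable_congr s fun hn ↦ charArith_apply χ hn).2
    (DirichletCharacter.LSeriesSummable_of_one_lt_re χ hs)

lemma LSeries_charArith {q : ℕ} [NeZero q] (χ : DirichletCharacter ℂ q) {s : ℂ} (hs : 1 < s.re) :
    LSeries (charArith χ) s = DirichletCharacter.LFunction χ s := by
  rw [DirichletCharacter.LFunction_eq_LSeries χ hs]
  exact LSeries_congr (fun hn ↦ charArith_apply χ hn) s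

lemma quadratic_values {q : ℕ} {χ : DirichletCharacter ℂ q} (h : χ ^ 2 = 1) (a : ZMod q) :
    ∃ r : ℝ, χ a = r ∧ -1 ≤ r := by
  rcases MulChar.isQuadratic_iff_sq_eq_one.mpr h a with h | h | h
  · exact ⟨0, by simp [h]⟩
  · exact ⟨1, by simp [h]⟩
  · exact ⟨-1, by simp [h]⟩

/-- The product of two Dirichlet characters, at the product modulus. -/
noncomputable def prodChar {q r : ℕ} (χ : DirichletCharacter ℂ q) (ψ : DirichletCharacter ℂ r) :
    DirichletCharacter ℂ (q * r) :=
  DirichletCharacter.changeLevel (Dvd.intro r rfl) χ *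
    DirichletCharacter.changeLevel (Dvd.intro_left q rfl) ψ

lemma prodChar_apply {q r : ℕ} (χ : DirichletCharacter ℂ q) (ψ : DirichletCharacter ℂ r) (n : ℕ) :
    prodChar χ ψ (n : ZMod (q * r)) = χ (n : ZMod q) * ψ (n : ZMod r) := by
  by_cases hn : n.Coprime (q * r)
  · have h : IsCoprime ((n : ℤ)) ((q * r : ℕ) : ℤ) := Nat.isCoprime_iff_coprime.2 hn
    have h1 := DirichletCharacter.changeLevel_eq_cast_of_dvd' χ (Dvd.intro r rfl) h
    have h2 := DirichletCharacter.changeLevel_eq_cast_of_dvd' ψ (Dvd.intro_left q rfl) h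
    simp only [Int.cast_natCast] at h1 h2
    rw [prodChar, MulChar.mul_apply, h1, h2]
  · rw [MulChar.map_nonunit _ (by rwa [ZMod.isUnit_iff_coprime])]
    by_cases h1 : n.Coprime q
    · have h2 : ¬ n.Coprime r := fun h ↦ hn (h1.mul_right h)
      rw [MulChar.map_nonunit ψ (by rwa [ZMod.isUnit_iff_coprime]), mul_zero]
    · rw [MulChar.map_nonunit χ (by rwa [ZMod.isUnit_iff_coprime]), zero_mul]

lemma abscissa_le_one {F : ArithmeticFunction ℂ} (h : ∀ s : ℂ, 1 < s.re → LSeriesSummable F s) :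
    LSeries.abscissaOfAbsConv F ≤ 1 := by
  have := LSeries.abscissaOfAbsConv_le_of_forall_lt_LSeriesSummable (f := F) (x := 1)
    fun y hy ↦ h y (by simpa using hy)
  simpa using this

lemma sphere_bounds {s : ℂ} (hs : s ∈ Metric.sphere (2 : ℂ) (3 / 2)) :
    1 / 2 ≤ s.re ∧ |s.im| ≤ 3 / 2 ∧ ‖s + 1‖ ≤ 9 / 2 := by
  rw [mem_sphere_iff_norm] at hs
  have h1 := (abs_re_le_norm (s - 2)).trans_eq hs
  have h2 := (abs_im_le_norm (s - 2)).trans_eq hs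
  simp only [sub_re, sub_im, re_ofNat, im_ofNat, sub_zero] at h1 h2
  refine ⟨by have := (abs_le.1 h1).1; linarith, h2, ?_⟩
  calc ‖s + 1‖ = ‖(s - 2) + 3‖ := by ring_nf
    _ ≤ ‖s - 2‖ + ‖(3 : ℂ)‖ := norm_add_le _ _
    _ = 9 / 2 := by rw [hs]; norm_num

lemma normL_sphere {q : ℕ} [NeZero q] (χ : DirichletCharacter ℂ q) {s : ℂ}
    (hs : s ∈ Metric.sphere (2 : ℂ) (3 / 2)) : ‖normL χ s‖ ≤ 98 * q := by
  obtain ⟨h1, h2, -⟩ := sphere_bounds hs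
  have h3 := normL_bound χ (ε := 1 / 2) (by norm_num) le_rfl (s := s) (by linarith)
  norm_num at h3
  have h4 : height q s ≤ q * (3 / 2 + 2) := by unfold height; gcongr
  linarith

lemma polarL_eq_normL {q : ℕ} [NeZero q] {s : ℂ} (hs : 0 ≤ s.re) :
    polarL (1 : DirichletCharacter ℂ q) s = normL (1 : DirichletCharacter ℂ q) s * (s + 1) := by
  have h : s + 1 ≠ 0 := norm_pos_iff.1 (lt_of_lt_of_le one_pos (one_le_norm_add_one hs))
  rw [normL, if_pos rfl, div_mul_cancel₀ _ h]

lemma normL_of_ne_one {q : ℕ} [NeZero q] {χ : DirichletCharacter ℂ q} (h : χ ≠ 1) (s : ℂ) :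
    normL χ s = DirichletCharacter.LFunction χ s := by
  rw [normL, if_neg h]

lemma zeta_sphere {s : ℂ} (hs : s ∈ Metric.sphere (2 : ℂ) (3 / 2)) :
    ‖polarL (1 : DirichletCharacter ℂ 1) s‖ ≤ 450 := by
  obtain ⟨h1, h2, h3⟩ := sphere_bounds hs
  rw [polarL_eq_normL (by linarith), norm_mul]
  have := normL_sphere (1 : DirichletCharacter ℂ 1) hs
  norm_num at this
  nlinarith [norm_nonneg (s + 1)]

lemma charArith_one {q : ℕ} (χ : DirichletCharacter ℂ q) : charArith χ 1 = 1 := by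
  simp [charArith_apply]

lemma LSeries_mul_of_summable {F G : ArithmeticFunction ℂ} {s : ℂ} (hF : LSeriesSummable F s)
    (hG : LSeriesSummable G s) :
    LSeriesSummable (F * G : ArithmeticFunction ℂ) s ∧
      LSeries (F * G : ArithmeticFunction ℂ) s = LSeries F s * LSeries G s :=
  ⟨ArithmeticFunction.LSeriesSummable_mul hF hG, ArithmeticFunction.LSeries_mul' hF hG⟩

lemma mul_apply_one' (F G : ArithmeticFunction ℂ) : (F * G) 1 = F 1 * G 1 := by
  simp [ArithmeticFunction.mul_apply]

/-- Estermann's lemma for `ζ(s) L(s, χ)`. -/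
lemma estermann_pair {q : ℕ} [NeZero q] {χ : DirichletCharacter ℂ q}
    (h2 : χ ^ 2 = 1) (h1 : χ ≠ 1) {β : ℝ} (hβ : 7 / 8 ≤ β) (hβ1 : β < 1) :
    (polarL (1 : DirichletCharacter ℂ 1) β * DirichletCharacter.LFunction χ β).im = 0 ∧
    0 ≤ polarL (1 : DirichletCharacter ℂ 1) 1 * DirichletCharacter.LFunction χ 1 ∧
    (0 ≤ (polarL (1 : DirichletCharacter ℂ 1) β * DirichletCharacter.LFunction χ β).re →
      (1 - β) / 6 * (32 * (450 * (98 * q))) ^ (-(4 * (1 - β))) ≤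
      (polarL (1 : DirichletCharacter ℂ 1) 1 * DirichletCharacter.LFunction χ 1).re) := by
  set F : ArithmeticFunction ℂ := charArith (1 : DirichletCharacter ℂ 1) * charArith χ with hF
  have hq : (1 : ℝ) ≤ q := by exact_mod_cast NeZero.pos q
  have hF1 : F 1 = 1 := by rw [hF, mul_apply_one', charArith_one, charArith_one, mul_one]
  have hnn : ∀ n, 0 ≤ F n := by
    refine ((isLogDeriv_char _).mul (isLogDeriv_char χ)).nonneg (fun n ↦ ?_) ?_ ?_
    · obtain ⟨r, hr, hr1⟩ := quadratic_values h2 (n : ZMod q)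
      rw [ArithmeticFunction.add_apply, charMangoldt_apply, charMangoldt_apply, hr]
      rw [MulChar.one_apply <| isUnit_of_subsingleton _, ← add_mul]
      have h3 : (0 : ℝ) ≤ (1 + r) * ArithmeticFunction.vonMangoldt n :=
        mul_nonneg (by linarith) ArithmeticFunction.vonMangoldt_nonneg
      exact_mod_cast zero_le_real.2 h3
    · rw [ArithmeticFunction.add_apply, charMangoldt_apply, charMangoldt_apply]; simp
    · rw [← hF, hF1]; exact zero_le_one
  have hsum : ∀ s : ℂ, 1 < s.re → LSeriesSummable F s ∧ LSeries F s =
      DirichletCharacter.LFunction (1 : DirichletCharacter ℂ 1) s *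
        DirichletCharacter.LFunction χ s := by
    intro s hs
    have := LSeries_mul_of_summable (LSeriesSummable_charArith (1 : DirichletCharacter ℂ 1) hs)
      (LSeriesSummable_charArith χ hs)
    rwa [LSeries_charArith _ hs, LSeries_charArith _ hs] at this
  refine estermann (f := F)
    (H := fun s ↦ polarL (1 : DirichletCharacter ℂ 1) s * DirichletCharacter.LFunction χ s)
    (fun n ↦ hnn n) hF1.ge (abscissa_le_one fun s hs ↦ (hsum s hs).1)
    ((differentiable_polarL _).mul (DirichletCharacter.differentiable_LFunction h1))
    (fun s hs ↦ ?_) (by linarith) (fun s hs ↦ ?_) hβ hβ1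
  · have hs1 : s ≠ 1 := by rintro rfl; simp at hs
    rw [(hsum s hs).2, polarL_eq _ hs1, mul_assoc]
  · rw [norm_mul, ← normL_of_ne_one h1]
    exact mul_le_mul (zeta_sphere hs) (normL_sphere χ hs) (norm_nonneg _) (by norm_num)

/-- Estermann's lemma for `ζ(s) L(s, χ) L(s, ψ) L(s, χψ)`. -/
lemma estermann_quad {q r : ℕ} [NeZero q] [NeZero r] {χ : DirichletCharacter ℂ q}
    {ψ : DirichletCharacter ℂ r} (hχ2 : χ ^ 2 = 1) (hχ : χ ≠ 1) (hψ2 : ψ ^ 2 = 1) (hψ : ψ ≠ 1)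
    (hχψ : prodChar χ ψ ≠ 1) {β : ℝ} (hβ : 7 / 8 ≤ β) (hβ1 : β < 1)
    (hzero : DirichletCharacter.LFunction χ β = 0) :
    (1 - β) / 6 * (32 * (450 * (98 * q) * ((98 * r) * (98 * (q * r))))) ^ (-(4 * (1 - β))) ≤
      ‖polarL (1 : DirichletCharacter ℂ 1) 1 * DirichletCharacter.LFunction χ 1 *
      (DirichletCharacter.LFunction ψ 1 * DirichletCharacter.LFunction (prodChar χ ψ) 1)‖ := by
  set F : ArithmeticFunction ℂ := charArith (1 : DirichletCharacter ℂ 1) * charArith χ *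
    (charArith ψ * charArith (prodChar χ ψ)) with hF
  have hq : (1 : ℝ) ≤ q := by exact_mod_cast NeZero.pos q
  have hr : (1 : ℝ) ≤ r := by exact_mod_cast NeZero.pos r
  have hF1 : F 1 = 1 := by simp only [hF, mul_apply_one', charArith_one, mul_one]
  have hnn : ∀ n, 0 ≤ F n := by
    refine (((isLogDeriv_char _).mul (isLogDeriv_char χ)).mul
      ((isLogDeriv_char ψ).mul (isLogDeriv_char _))).nonneg (fun n ↦ ?_) ?_ ?_
    · obtain ⟨a, ha, ha1⟩ := quadratic_values hχ2 (n : ZMod q)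
      obtain ⟨b, hb, hb1⟩ := quadratic_values hψ2 (n : ZMod r)
      simp only [ArithmeticFunction.add_apply, charMangoldt_apply, prodChar_apply, ha, hb]
      rw [MulChar.one_apply <| isUnit_of_subsingleton _]
      have h3 : (0 : ℝ) ≤ (1 + a) * (1 + b) * ArithmeticFunction.vonMangoldt n :=
        mul_nonneg (mul_nonneg (by linarith) (by linarith)) ArithmeticFunction.vonMangoldt_nonneg
      have h4 := zero_le_real.2 h3
      push_cast at h4
      convert h4 using 1
      ring
    · simp only [ArithmeticFunction.add_apply, charMangoldt_apply]; simp
    · rw [← hF, hF1]; exact zero_le_one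
  have hsum : ∀ s : ℂ, 1 < s.re → LSeriesSummable F s ∧ LSeries F s =
      DirichletCharacter.LFunction (1 : DirichletCharacter ℂ 1) s *
        DirichletCharacter.LFunction χ s * (DirichletCharacter.LFunction ψ s *
        DirichletCharacter.LFunction (prodChar χ ψ) s) := by
    intro s hs
    have h1 := LSeries_mul_of_summable (LSeriesSummable_charArith (1 : DirichletCharacter ℂ 1) hs)
      (LSeriesSummable_charArith χ hs)
    have h2 := LSeries_mul_of_summable (LSeriesSummable_charArith ψ hs)
      (LSeriesSummable_charArith (prodChar χ ψ) hs)
    have h3 := LSeries_mul_of_summable h1.1 h2.1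
    rwa [h1.2, h2.2, LSeries_charArith _ hs, LSeries_charArith _ hs, LSeries_charArith _ hs,
      LSeries_charArith _ hs] at h3
  have key := estermann (f := F) (B := 450 * (98 * q) * ((98 * r) * (98 * (q * r))))
    (H := fun s ↦ polarL (1 : DirichletCharacter ℂ 1) s * DirichletCharacter.LFunction χ s *
      (DirichletCharacter.LFunction ψ s * DirichletCharacter.LFunction (prodChar χ ψ) s))
    (fun n ↦ hnn n) hF1.ge (abscissa_le_one fun s hs ↦ (hsum s hs).1)
    (((differentiable_polarL _).mul (DirichletCharacter.differentiable_LFunction hχ)).mul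
      ((DirichletCharacter.differentiable_LFunction hψ).mul
      (DirichletCharacter.differentiable_LFunction hχψ)))
    (fun s hs ↦ ?_) ?_ (fun s hs ↦ ?_) hβ hβ1
  · refine (key.2.2 ?_).trans (Complex.re_le_norm _)
    simp [hzero]
  · have hs1 : s ≠ 1 := by rintro rfl; simp at hs
    rw [(hsum s hs).2, polarL_eq _ hs1]; ring
  · have h1 : (1 : ℝ) ≤ 450 * (98 * q) := by linarith
    have h2 : (1 : ℝ) ≤ (98 * r) := by linarith
    have h3 : (1 : ℝ) ≤ (98 * (q * r)) := by nlinarith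
    exact one_le_mul_of_one_le_of_one_le h1 (one_le_mul_of_one_le_of_one_le h2 h3)
  · rw [norm_mul, norm_mul, norm_mul, ← normL_of_ne_one hχ, ← normL_of_ne_one hψ,
      ← normL_of_ne_one hχψ]
    have h4 := normL_sphere (prodChar χ ψ) hs
    push_cast at h4
    gcongr
    · exact zeta_sphere hs
    · exact normL_sphere χ hs
    · exact normL_sphere ψ hs

end LogDerivation

section Siegel

lemma pow_card_primeFactors {ε : ℝ} (hε : 0 < ε) :
    ∃ c : ℝ, 0 < c ∧ ∀ N : ℕ, N ≠ 0 → c * (N : ℝ) ^ (-ε) ≤ (1 / 4) ^ N.primeFactors.card := by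
  obtain ⟨P, hP⟩ : ∃ P : ℕ, ∀ p : ℕ, P ≤ p → (4 : ℝ) ≤ (p : ℝ) ^ ε := by
    have h := ((tendsto_rpow_atTop hε).comp tendsto_natCast_atTop_atTop).eventually_ge_atTop 4
    exact eventually_atTop.1 h
  refine ⟨(1 / 4) ^ P, by positivity, fun N hN ↦ ?_⟩
  have h1 : ∏ p ∈ N.primeFactors, (p : ℝ) ^ (-ε) ≥ (N : ℝ) ^ (-ε) := by
    rw [Real.finsetProd_rpow _ _ (fun i _ ↦ Nat.cast_nonneg i)]
    refine Real.rpow_le_rpow_of_nonpos ?_ ?_ (by linarith)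
    · exact Finset.prod_pos fun p hp ↦ by exact_mod_cast (Nat.prime_of_mem_primeFactors hp).pos
    · rw [← Nat.cast_prod]
      exact_mod_cast Nat.le_of_dvd (Nat.pos_of_ne_zero hN) (Nat.prod_primeFactors_dvd N)
  have h2 : ∏ p ∈ N.primeFactors, (if p < P then (1 / 4 : ℝ) else 1) ≥ (1 / 4) ^ P := by
    rw [Finset.prod_ite, Finset.prod_const, Finset.prod_const, one_pow, mul_one]
    refine pow_le_pow_of_le_one (by norm_num) (by norm_num) ?_
    calc _ ≤ (Finset.range P).card := Finset.card_le_card fun p hp ↦ by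
            simpa using (Finset.mem_filter.1 hp).2
      _ = P := Finset.card_range P
  calc (1 / 4) ^ P * (N : ℝ) ^ (-ε)
      ≤ (∏ p ∈ N.primeFactors, (if p < P then (1 / 4 : ℝ) else 1)) *
        ∏ p ∈ N.primeFactors, (p : ℝ) ^ (-ε) := by
        refine mul_le_mul h2 h1 (by positivity) ((by positivity : (0:ℝ) ≤ (1 / 4) ^ P).trans h2)
    _ = ∏ p ∈ N.primeFactors, (if p < P then (1 / 4 : ℝ) else 1) * (p : ℝ) ^ (-ε) :=
        Finset.prod_mul_distrib.symm
    _ ≤ ∏ p ∈ N.primeFactors, (1 / 4 : ℝ) := by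
        refine Finset.prod_le_prod (fun p _ ↦ by split_ifs <;> positivity) fun p hp ↦ ?_
        have hp1 : (1 : ℝ) ≤ p := by exact_mod_cast (Nat.prime_of_mem_primeFactors hp).one_le
        split_ifs with h
        · have : (p : ℝ) ^ (-ε) ≤ 1 := Real.rpow_le_one_of_one_le_of_nonpos hp1 (by linarith)
          linarith
        · rw [one_mul, Real.rpow_neg (by linarith), one_div]
          exact inv_anti₀ (by norm_num) (hP p (not_lt.1 h))
    _ = _ := by rw [Finset.prod_const]

lemma euler_factor_bounds {q : ℕ} (χ : DirichletCharacter ℂ q) {p : ℕ} (hp : p.Prime) :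
    1 / 2 ≤ ‖1 - χ p * (p : ℂ) ^ (-(1 : ℂ))‖ ∧ ‖1 - χ p * (p : ℂ) ^ (-(1 : ℂ))‖ ≤ 2 := by
  have h : ‖χ p * (p : ℂ) ^ (-(1 : ℂ))‖ ≤ 1 / 2 := by
    rw [norm_mul, Complex.cpow_neg_one, norm_inv, Complex.norm_natCast]
    have h1 := χ.norm_le_one p
    have h2 : (p : ℝ)⁻¹ ≤ 1 / 2 := by
      rw [one_div]; exact inv_anti₀ (by norm_num) (by exact_mod_cast hp.two_le)
    calc _ ≤ 1 * (1 / 2 : ℝ) := mul_le_mul h1 h2 (by positivity) zero_le_one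
      _ = _ := one_mul _
  have h1 := norm_sub_norm_le (1 : ℂ) (χ p * (p : ℂ) ^ (-(1 : ℂ)))
  have h2 := norm_sub_le (1 : ℂ) (χ p * (p : ℂ) ^ (-(1 : ℂ)))
  rw [norm_one] at h1 h2
  constructor <;> linarith

/-- Characters inducing the same character have comparable values at `1`. -/
lemma compare_of_prodChar_eq_one {q r : ℕ} [NeZero q] [NeZero r] {χ : DirichletCharacter ℂ q}
    {ψ : DirichletCharacter ℂ r} (hχ2 : χ ^ 2 = 1) (hχ : χ ≠ 1) (hψ : ψ ≠ 1)
    (h : prodChar χ ψ = 1) :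
    ‖DirichletCharacter.LFunction χ 1‖ * (1 / 4) ^ (q * r).primeFactors.card ≤
      ‖DirichletCharacter.LFunction ψ 1‖ := by
  have h1 : DirichletCharacter.changeLevel (Dvd.intro_left q rfl : r ∣ q * r) ψ =
      DirichletCharacter.changeLevel (Dvd.intro r rfl : q ∣ q * r) χ := by
    have h2 : DirichletCharacter.changeLevel (Dvd.intro r rfl : q ∣ q * r) χ *
        DirichletCharacter.changeLevel (Dvd.intro r rfl : q ∣ q * r) χ = 1 := by
      rw [← map_mul, ← sq, hχ2, map_one]
    exact mul_left_cancel (h.trans h2.symm)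
  have h2 := DirichletCharacter.LFunction_changeLevel (Dvd.intro r rfl : q ∣ q * r) χ
    (s := 1) (.inl hχ)
  have h3 := DirichletCharacter.LFunction_changeLevel (Dvd.intro_left q rfl : r ∣ q * r) ψ
    (s := 1) (.inl hψ)
  rw [h1, h2] at h3
  have h4 := congrArg norm h3
  rw [norm_mul, norm_mul, norm_prod, norm_prod] at h4
  set n := (q * r).primeFactors.card
  have h5 : (1 / 2 : ℝ) ^ n ≤ ∏ p ∈ (q * r).primeFactors, ‖1 - χ p * (p : ℂ) ^ (-(1 : ℂ))‖ := by
    rw [← Finset.prod_const]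
    exact Finset.prod_le_prod (fun _ _ ↦ by norm_num) fun p hp ↦
      (euler_factor_bounds χ (Nat.prime_of_mem_primeFactors hp)).1
  have h6 : ∏ p ∈ (q * r).primeFactors, ‖1 - ψ p * (p : ℂ) ^ (-(1 : ℂ))‖ ≤ (2 : ℝ) ^ n := by
    rw [← Finset.prod_const]
    exact Finset.prod_le_prod (fun _ _ ↦ norm_nonneg _) fun p hp ↦
      (euler_factor_bounds ψ (Nat.prime_of_mem_primeFactors hp)).2
  have h7 : ‖DirichletCharacter.LFunction χ 1‖ * (1 / 2) ^ n ≤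
      ‖DirichletCharacter.LFunction ψ 1‖ * 2 ^ n :=
    (mul_le_mul_of_nonneg_left h5 (norm_nonneg _)).trans
      (h4.trans_le (mul_le_mul_of_nonneg_left h6 (norm_nonneg _)))
  have h8 : (1 / 4 : ℝ) ^ n = (1 / 2) ^ n * (1 / 2) ^ n := by rw [← mul_pow]; norm_num
  have h9 : (2 : ℝ) ^ n * (1 / 2) ^ n = 1 := by rw [← mul_pow]; norm_num
  calc _ = (‖DirichletCharacter.LFunction χ 1‖ * (1 / 2) ^ n) * (1 / 2) ^ n := by rw [h8]; ring
    _ ≤ (‖DirichletCharacter.LFunction ψ 1‖ * 2 ^ n) * (1 / 2) ^ n := by gcongr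
    _ = _ := by rw [mul_assoc, h9, mul_one]

lemma rpow_conductor_ge {K n δ e : ℝ} (hK : 1 ≤ K) (hn : 1 ≤ n) (hδ : δ ≤ e) :
    K ^ (-(4 * e)) * n ^ (-(4 * e)) ≤ (K * n) ^ (-(4 * δ)) := by
  rw [← Real.mul_rpow (by linarith) (by linarith)]
  exact Real.rpow_le_rpow_of_exponent_le (by nlinarith) (by linarith)

lemma siegel_of_no_zero {e : ℝ} (he : 0 < e) (he8 : e ≤ 1 / 8)
    (hz : ∀ t : ℝ, 1 - e ≤ t → t ≤ 1 → polarL (1 : DirichletCharacter ℂ 1) t ≠ 0)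
    {q : ℕ} [NeZero q] {χ : DirichletCharacter ℂ q} (h2 : χ ^ 2 = 1) (h1 : χ ≠ 1)
    (hL : ∀ t : ℝ, 1 - e ≤ t → t < 1 → DirichletCharacter.LFunction χ t ≠ 0) :
    e / 6 * (32 * (450 * 98)) ^ (-(4 * e)) * (q : ℝ) ^ (-(4 * e)) ≤
      ‖polarL (1 : DirichletCharacter ℂ 1) 1‖ * ‖DirichletCharacter.LFunction χ 1‖ := by
  have hq : (1 : ℝ) ≤ q := by exact_mod_cast NeZero.pos q
  set H : ℂ → ℂ := fun s ↦ polarL (1 : DirichletCharacter ℂ 1) s *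
    DirichletCharacter.LFunction χ s with hH
  have hHc : Continuous H := ((differentiable_polarL _).mul
    (DirichletCharacter.differentiable_LFunction h1)).continuous
  have hne : ∀ t : ℝ, 1 - e ≤ t → t < 1 → H t ≠ 0 := fun t h3 h4 ↦
    mul_ne_zero (hz t h3 h4.le) (hL t h3 h4)
  have hre : ∀ t : ℝ, 1 - e ≤ t → t < 1 → (H t).re ≠ 0 := fun t h3 h4 h5 ↦
    hne t h3 h4 (Complex.ext h5 (estermann_pair h2 h1 (by linarith) h4).1)
  have key := (estermann_pair h2 h1 (show 7 / 8 ≤ 1 - e by linarith) (by linarith)).2.2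
  have hpos : 0 ≤ (H ((1 - e : ℝ) : ℂ)).re := by
    by_contra hneg
    push Not at hneg
    have h1' : 0 < (H 1).re := by
      have h5 := (estermann_pair h2 h1 (show 7 / 8 ≤ 1 - e by linarith) (by linarith)).2.1
      obtain ⟨h6, h7⟩ := Complex.nonneg_iff.1 h5
      refine lt_of_le_of_ne h6 fun h8 ↦ ?_
      have h9 : H 1 = 0 := Complex.ext h8.symm h7.symm
      exact mul_ne_zero (by simpa using hz 1 (by linarith) le_rfl)
        (DirichletCharacter.LFunction_apply_one_ne_zero h1) h9
    have hcont : ContinuousOn (fun t : ℝ ↦ (H t).re) (Set.Icc (1 - e) 1) :=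
      (Complex.continuous_re.comp (hHc.comp continuous_ofReal)).continuousOn
    obtain ⟨t, ht, ht0⟩ := intermediate_value_Icc (by linarith) hcont
      (show (0 : ℝ) ∈ Set.Icc _ _ from ⟨hneg.le, by simpa using h1'.le⟩)
    rcases eq_or_lt_of_le ht.2 with h | h
    · subst h; simp only [ofReal_one] at ht0; exact h1'.ne' ht0
    · exact hre t ht.1 h ht0
  have h3 := (key hpos).trans (Complex.re_le_norm _)
  rw [norm_mul] at h3
  refine le_trans ?_ h3
  rw [show 1 - (1 - e) = e by ring, mul_assoc]
  refine mul_le_mul_of_nonneg_left ?_ (by linarith)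
  rw [show (32 : ℝ) * (450 * (98 * q)) = (32 * (450 * 98)) * q by ring]
  exact rpow_conductor_ge (by norm_num) hq le_rfl

lemma siegel_of_zero {e : ℝ} (he8 : e ≤ 1 / 8) {q r : ℕ} [NeZero q] [NeZero r]
    {χ : DirichletCharacter ℂ q} {ψ : DirichletCharacter ℂ r} (hχ2 : χ ^ 2 = 1) (hχ : χ ≠ 1)
    (hψ2 : ψ ^ 2 = 1) (hψ : ψ ≠ 1) (hχψ : prodChar χ ψ ≠ 1) {β : ℝ} (hβ : 1 - e ≤ β)
    (hβ1 : β < 1) (hzero : DirichletCharacter.LFunction χ β = 0) (he : 0 < e) :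
    (1 - β) / 6 * (32 * 450 * 98 ^ 3 * q ^ 2) ^ (-(4 * e)) * (r : ℝ) ^ (-(8 * e)) ≤
      ‖polarL (1 : DirichletCharacter ℂ 1) 1‖ * ‖DirichletCharacter.LFunction χ 1‖ *
      (‖DirichletCharacter.LFunction ψ 1‖ * (2 * (12 + 1 / e) * (q * r * 2) ^ (2 * e))) := by
  have hq : (1 : ℝ) ≤ q := by exact_mod_cast NeZero.pos q
  have hr : (1 : ℝ) ≤ r := by exact_mod_cast NeZero.pos r
  have key := estermann_quad hχ2 hχ hψ2 hψ hχψ (by linarith) hβ1 hzero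
  rw [norm_mul, norm_mul, norm_mul] at key
  have h1 : ‖DirichletCharacter.LFunction (prodChar χ ψ) 1‖ ≤
      2 * (12 + 1 / e) * (q * r * 2) ^ (2 * e) := by
    have := normL_bound (prodChar χ ψ) he (by linarith) (s := 1) (by simp [he.le])
    rwa [normL_of_ne_one hχψ, height, one_im, abs_zero, zero_add, Nat.cast_mul] at this
  refine le_trans ?_ (key.trans ?_)
  · rw [mul_assoc]
    refine mul_le_mul_of_nonneg_left ?_ (by linarith)
    rw [show (32 : ℝ) * (450 * (98 * q) * ((98 * r) * (98 * (q * r)))) =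
      (32 * 450 * 98 ^ 3 * q ^ 2) * (r ^ 2) by ring]
    have h3 : ((r : ℝ) ^ 2) ^ (-(4 * e)) = (r : ℝ) ^ (-(8 * e)) := by
      rw [← Real.rpow_natCast, ← Real.rpow_mul (by linarith)]; congr 1; push_cast; ring
    rw [← h3]
    refine rpow_conductor_ge ?_ (one_le_pow₀ hr) (by linarith)
    have := one_le_pow₀ (n := 2) hq
    nlinarith
  · gcongr

/-- **Siegel's theorem**. -/
theorem siegel {ε : ℝ} (hε : 0 < ε) : ∃ c : ℝ, 0 < c ∧ ∀ (q : ℕ) [NeZero q]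
    (χ : DirichletCharacter ℂ q), χ ^ 2 = 1 → χ ≠ 1 →
    c * (q : ℝ) ^ (-ε) ≤ ‖DirichletCharacter.LFunction χ 1‖ := by
  set Z := polarL (1 : DirichletCharacter ℂ 1) with hZ
  have hZ1 : Z 1 = 1 := by simp [hZ, polarL]
  have hZc : Continuous Z := (differentiable_polarL _).continuous
  obtain ⟨e0, he0, hz0⟩ : ∃ e0 : ℝ, 0 < e0 ∧ ∀ t : ℝ, |t - 1| < e0 → Z t ≠ 0 := by
    have h1 : ∀ᶠ t : ℝ in 𝓝 1, Z t ≠ 0 := by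
      refine (hZc.comp continuous_ofReal).continuousAt.eventually_ne ?_
      simp [hZ1]
    obtain ⟨d, hd, h⟩ := Metric.eventually_nhds_iff.1 h1
    exact ⟨d, hd, fun t ht ↦ h (by rwa [Real.dist_eq])⟩
  set e : ℝ := min (e0 / 2) (min (1 / 8) (ε / 16)) with he
  have hepos : 0 < e := by positivity
  have hee0 : e < e0 := (min_le_left _ _).trans_lt (by linarith)
  have he8 : e ≤ 1 / 8 := (min_le_right _ _).trans (min_le_left _ _)
  have heε : e ≤ ε / 16 := (min_le_right _ _).trans (min_le_right _ _)
  have hz : ∀ t : ℝ, 1 - e ≤ t → t ≤ 1 → Z t ≠ 0 := fun t h1 h2 ↦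
    hz0 t (by rw [abs_lt]; constructor <;> linarith)
  by_cases hex : ∃ (q : ℕ) (_ : NeZero q) (χ : DirichletCharacter ℂ q) (β : ℝ), χ ^ 2 = 1 ∧
      χ ≠ 1 ∧ 1 - e ≤ β ∧ β < 1 ∧ DirichletCharacter.LFunction χ β = 0
  · obtain ⟨q, _, χ, β, hχ2, hχ, hβ, hβ1, hzero⟩ := hex
    have hq : (1 : ℝ) ≤ q := by exact_mod_cast NeZero.pos q
    obtain ⟨c0, hc0, hω⟩ := pow_card_primeFactors hε
    set L : ℝ := ‖DirichletCharacter.LFunction χ 1‖ with hL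
    have hLpos : 0 < L := norm_pos_iff.2 (DirichletCharacter.LFunction_apply_one_ne_zero hχ)
    set K : ℝ := 2 * (12 + 1 / e) * (q * 2) ^ (2 * e) with hK
    have hKpos : 0 < K := by positivity
    set c1 : ℝ := (1 - β) / 6 * (32 * 450 * 98 ^ 3 * q ^ 2) ^ (-(4 * e)) with hc1
    have hc1pos : 0 < c1 := mul_pos (by linarith) (by positivity)
    refine ⟨min (c1 / (L * K)) (L * (c0 * (q : ℝ) ^ (-ε))), by positivity, fun r _ ψ hψ2 hψ ↦ ?_⟩
    have hr : (1 : ℝ) ≤ r := by exact_mod_cast NeZero.pos r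
    by_cases hχψ : prodChar χ ψ = 1
    · have h1 := compare_of_prodChar_eq_one hχ2 hχ hψ hχψ
      refine le_trans ?_ h1
      have h2 := hω (q * r) (mul_ne_zero (NeZero.ne q) (NeZero.ne r))
      rw [Nat.cast_mul, Real.mul_rpow (by linarith) (by linarith)] at h2
      calc _ ≤ L * (c0 * (q : ℝ) ^ (-ε)) * (r : ℝ) ^ (-ε) := by gcongr; exact min_le_right _ _
        _ = L * (c0 * ((q : ℝ) ^ (-ε) * (r : ℝ) ^ (-ε))) := by ring
        _ ≤ _ := by gcongr
    · have h1 := siegel_of_zero he8 hχ2 hχ hψ2 hψ hχψ hβ hβ1 hzero hepos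
      rw [← hZ, hZ1, norm_one, one_mul, ← hc1, ← hL] at h1
      have h2 : 2 * (12 + 1 / e) * ((q : ℝ) * r * 2) ^ (2 * e) = K * (r : ℝ) ^ (2 * e) := by
        rw [hK, show (q : ℝ) * r * 2 = (q * 2) * r by ring,
          Real.mul_rpow (by positivity) (by positivity)]; ring
      rw [h2] at h1
      have h3 : (r : ℝ) ^ (-ε) ≤ (r : ℝ) ^ (-(8 * e)) * (r : ℝ) ^ (-(2 * e)) := by
        rw [← Real.rpow_add (by linarith)]
        exact Real.rpow_le_rpow_of_exponent_le hr (by linarith)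
      have h4 : (r : ℝ) ^ (2 * e) * (r : ℝ) ^ (-(2 * e)) = 1 := by
        rw [← Real.rpow_add (by linarith)]; simp
      calc _ ≤ c1 / (L * K) * (r : ℝ) ^ (-ε) := by gcongr; exact min_le_left _ _
        _ ≤ c1 / (L * K) * ((r : ℝ) ^ (-(8 * e)) * (r : ℝ) ^ (-(2 * e))) := by gcongr
        _ = c1 * (r : ℝ) ^ (-(8 * e)) * ((r : ℝ) ^ (-(2 * e)) / (L * K)) := by ring
        _ ≤ L * (‖DirichletCharacter.LFunction ψ 1‖ * (K * (r : ℝ) ^ (2 * e))) *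
            ((r : ℝ) ^ (-(2 * e)) / (L * K)) := by gcongr
        _ = ‖DirichletCharacter.LFunction ψ 1‖ * ((r : ℝ) ^ (2 * e) * (r : ℝ) ^ (-(2 * e))) := by
            field_simp
        _ = _ := by rw [h4, mul_one]
  · push Not at hex
    refine ⟨e / 6 * (32 * (450 * 98)) ^ (-(4 * e)), by positivity, fun q _ χ h2 h1 ↦ ?_⟩
    have hq : (1 : ℝ) ≤ q := by exact_mod_cast NeZero.pos q
    have h3 := siegel_of_no_zero hepos he8 hz h2 h1 fun t h3 h4 ↦ hex q _ χ t h2 h1 h3 h4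
    rw [← hZ, hZ1, norm_one, one_mul] at h3
    refine le_trans ?_ h3
    gcongr
    linarith

end Siegel

section LowerBound

lemma norm_LFunction_le_normL {q : ℕ} [NeZero q] (χ : DirichletCharacter ℂ q) {s : ℂ} {d : ℝ}
    (hd : 0 < d) (hd1 : d ≤ 1) (hs : 0 ≤ s.re) (hs1 : s ≠ 1) (hsd : χ = 1 → d ≤ ‖s - 1‖) :
    ‖DirichletCharacter.LFunction χ s‖ ≤ ‖normL χ s‖ * (3 / d) := by
  by_cases h : χ = 1
  · have hs' := hsd h
    have h1 : ‖s + 1‖ ≤ ‖s - 1‖ * (3 / d) := by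
      have h2 : ‖s + 1‖ ≤ ‖s - 1‖ + ‖(2 : ℂ)‖ := by
        rw [show s + 1 = (s - 1) + 2 by ring]; exact norm_add_le _ _
      rw [Complex.norm_ofNat] at h2
      have h3 : 1 ≤ ‖s - 1‖ / d := (one_le_div hd).2 hs'
      have h4 : ‖s - 1‖ ≤ ‖s - 1‖ / d := le_div_self (norm_nonneg _) hd hd1
      calc _ ≤ ‖s - 1‖ / d + 2 * (‖s - 1‖ / d) := by linarith
        _ = _ := by ring
    have hs0 : 0 < ‖s - 1‖ := hd.trans_le hs'
    rw [normL, if_pos h, polarL_eq χ hs1, norm_div, norm_mul]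
    have h0' : 0 < ‖s + 1‖ := one_pos.trans_le (one_le_norm_add_one hs)
    rw [mul_comm ‖s - 1‖, mul_div_assoc, mul_assoc]
    refine le_mul_of_one_le_right (norm_nonneg _) ?_
    rw [div_mul_eq_mul_div, one_le_div h0']
    exact h1
  · rw [normL_of_ne_one h]
    refine le_mul_of_one_le_right (norm_nonneg _) ?_
    rw [one_le_div hd]; linarith

/-- The constant in `normL_bound`. -/
noncomputable def boundConst (a : ℝ) : ℝ := 2 * (12 + 1 / a)

lemma normL_le_height {q : ℕ} [NeZero q] (χ : DirichletCharacter ℂ q) {a : ℝ} (ha : 0 < a)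
    (ha2 : a ≤ 1 / 2) {s : ℂ} (hs : 1 ≤ s.re) {N : ℝ} (hN : height q s ≤ N) :
    ‖normL χ s‖ ≤ boundConst a * (N ^ a) ^ 2 := by
  have h0 : 0 ≤ height q s := by linarith [two_le_height (q := q) s]
  refine (normL_bound χ ha ha2 (by linarith)).trans ?_
  rw [← Real.rpow_natCast, ← Real.rpow_mul (h0.trans hN), Nat.cast_ofNat, mul_comm a 2]
  unfold boundConst
  gcongr

lemma three_four_one {q : ℕ} [NeZero q] (χ : DirichletCharacter ℂ q) {a : ℝ} (ha : 0 < a)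
    (ha2 : a ≤ 1 / 2) {x t d : ℝ} (hx : 0 < x) (hx1 : x ≤ 1) (hd : 0 < d) (hd1 : d ≤ 1)
    (hsd : χ ^ 2 = 1 → d ≤ ‖(x : ℂ) + I * t‖) {Y : ℝ}
    (hY : Y = (q * (|t| + 2) : ℝ) ^ a) :
    x ^ 3 * d ^ 5 ≤ 13122 * boundConst a ^ 4 * Y ^ 8 * ‖normL χ (1 + x + I * t)‖ ^ 4 := by
  have hq : (1 : ℝ) ≤ q := by exact_mod_cast NeZero.pos q
  have hK : 0 < boundConst a := by unfold boundConst; positivity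
  have hY0 : 0 < Y := by rw [hY]; positivity
  have key := DirichletCharacter.norm_LFunction_product_ge_one χ hx t
  rw [norm_mul, norm_mul, norm_pow, norm_pow] at key
  have hxt : ∀ u : ℝ, (x : ℂ) + I * u ≠ 0 := fun u h ↦ by
    have := congrArg Complex.re h
    simp at this; linarith
  have b1 : ‖DirichletCharacter.LFunctionTrivChar q (1 + x)‖ ≤ boundConst a * Y ^ 2 * (3 / x) := by
    refine (norm_LFunction_le_normL (1 : DirichletCharacter ℂ q) hx hx1 ?_ ?_ ?_).trans ?_
    · simp; linarith
    · simpa using hx.ne'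
    · intro _; simp [abs_of_pos hx]
    · gcongr
      rw [hY]
      refine normL_le_height _ ha ha2 (by simp [hx.le]) ?_
      have := abs_nonneg t
      simp [height]
      nlinarith
  have b2 : ‖DirichletCharacter.LFunction χ (1 + x + I * t)‖ ≤
      ‖normL χ (1 + x + I * t)‖ * (3 / d) := by
    refine norm_LFunction_le_normL χ hd hd1 ?_ ?_ ?_
    · simp; linarith
    · intro h; exact hxt t (by linear_combination h)
    · rintro rfl
      refine (hsd (one_pow 2)).trans_eq ?_
      congr 1; ring
  have b3 : ‖DirichletCharacter.LFunction (χ ^ 2) (1 + x + 2 * I * t)‖ ≤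
      2 * boundConst a * Y ^ 2 * (3 / d) := by
    refine (norm_LFunction_le_normL (χ ^ 2) hd hd1 ?_ ?_ ?_).trans ?_
    · simp; linarith
    · intro h; exact hxt (2 * t) (by push_cast; linear_combination h)
    · intro h
      refine (hsd h).trans ?_
      rw [← sq_le_sq₀ (norm_nonneg _) (norm_nonneg _), Complex.sq_norm, Complex.sq_norm,
        normSq_apply, normSq_apply]
      simp
      nlinarith [sq_nonneg t]
    · gcongr
      have h1 := normL_le_height (χ ^ 2) ha ha2 (s := 1 + x + 2 * I * t)
        (N := 2 * (q * (|t| + 2))) (by simp [hx.le]) (by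
          have := abs_nonneg t
          simp [height, abs_mul]
          nlinarith)
      refine h1.trans ?_
      rw [Real.mul_rpow (by norm_num) (by positivity), ← hY]
      have h2 : ((2 : ℝ) ^ a) ^ 2 ≤ 2 := by
        rw [← Real.rpow_natCast, ← Real.rpow_mul (by norm_num)]
        calc (2 : ℝ) ^ (a * (2 : ℕ)) ≤ 2 ^ (1 : ℝ) :=
              Real.rpow_le_rpow_of_exponent_le (by norm_num) (by push_cast; linarith)
          _ = 2 := Real.rpow_one 2
      calc _ = ((2 : ℝ) ^ a) ^ 2 * (boundConst a * Y ^ 2) := by ring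
        _ ≤ 2 * (boundConst a * Y ^ 2) := by gcongr
        _ = _ := by ring
  set w := ‖normL χ (1 + x + I * t)‖ with hw
  have hprod : 1 ≤ (boundConst a * Y ^ 2 * (3 / x)) ^ 3 * (w * (3 / d)) ^ 4 *
      (2 * boundConst a * Y ^ 2 * (3 / d)) := by
    refine le_trans key ?_
    gcongr
  calc x ^ 3 * d ^ 5 = x ^ 3 * d ^ 5 * 1 := (mul_one _).symm
    _ ≤ x ^ 3 * d ^ 5 * ((boundConst a * Y ^ 2 * (3 / x)) ^ 3 * (w * (3 / d)) ^ 4 *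
      (2 * boundConst a * Y ^ 2 * (3 / d))) := by gcongr
    _ = _ := by field_simp; ring

/-- The constant in `normL_sub_le`. -/
noncomputable def lipConst (a : ℝ) : ℝ := 8 / a * (12 + 1 / a)

lemma normL_sub_le_height {q : ℕ} [NeZero q] (χ : DirichletCharacter ℂ q) {a : ℝ} (ha : 0 < a)
    (ha2 : a ≤ 1 / 2) {z w : ℂ} (hz : 1 ≤ z.re) (hw : 1 ≤ w.re) (him : |w.im| ≤ |z.im|) :
    ‖normL χ z - normL χ w‖ ≤ lipConst a * (height q z ^ a) ^ 2 * ‖z - w‖ := by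
  have h := normL_sub_le χ ha ha2 (z := z) (w := w) (T := |z.im|) (by linarith) (by linarith)
    le_rfl him
  have h0 : 0 ≤ height q z := by linarith [two_le_height (q := q) z]
  rwa [← Real.rpow_natCast, ← Real.rpow_mul h0, Nat.cast_ofNat, mul_comm a 2]

lemma normL_lower_away {a c : ℝ} (ha : 0 < a) (ha2 : a ≤ 1 / 2) (hc : 0 < c) (hc1 : c ≤ 1) :
    ∃ C : ℝ, 0 < C ∧ ∀ (q : ℕ) [NeZero q] (χ : DirichletCharacter ℂ q) (s : ℂ), 1 < s.re →
      s.re ≤ 2 → (χ ^ 2 = 1 → c / (height q s ^ a) ^ 3 ≤ ‖s - 1‖) →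
      C / (height q s ^ a) ^ 29 ≤ ‖normL χ s‖ := by
  set K := boundConst a with hK
  set K2 := lipConst a with hK2
  have hKpos : 0 < K := by rw [hK]; unfold boundConst; positivity
  have hK2pos : 0 < K2 := by rw [hK2]; unfold lipConst; positivity
  set κ : ℝ := min 1 (c ^ 5 / (16 * K2 ^ 4 * (13122 * K ^ 4))) with hκ
  have hκpos : 0 < κ := by positivity
  refine ⟨K2 * κ, by positivity, fun q _ χ s hs1 hs2 hsd ↦ ?_⟩
  set Y := height q s ^ a with hY
  have hY1 : 1 ≤ Y := Real.one_le_rpow (by linarith [two_le_height (q := q) s]) ha.le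
  set η : ℝ := κ / Y ^ 31 with hη
  have hηpos : 0 < η := by positivity
  have hη1 : η ≤ 1 := by
    rw [hη, div_le_one (by positivity)]
    exact (min_le_left _ _).trans (one_le_pow₀ hY1)
  set x : ℝ := max (s.re - 1) η with hx
  have hxpos : 0 < x := hηpos.trans_le (le_max_right _ _)
  have hx1 : x ≤ 1 := max_le (by linarith) hη1
  set d : ℝ := c / Y ^ 3 with hd
  have hdpos : 0 < d := by positivity
  have hd1 : d ≤ 1 := by
    rw [hd, div_le_one (by positivity)]
    exact hc1.trans (one_le_pow₀ hY1)
  have key := three_four_one χ ha ha2 (t := s.im) hxpos hx1 hdpos hd1 (fun h ↦ by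
    refine (hsd h).trans ?_
    rw [← sq_le_sq₀ (norm_nonneg _) (norm_nonneg _), Complex.sq_norm, Complex.sq_norm,
        normSq_apply, normSq_apply]
    have : s.re - 1 ≤ x := le_max_left _ _
    simp
    nlinarith) hY
  rw [← hK] at key
  set s' : ℂ := 1 + x + I * s.im with hs'
  set w := ‖normL χ s'‖ with hw
  have hre : s'.re = 1 + x := by simp [hs']
  have him : s'.im = s.im := by simp [hs']
  have hdist : ‖s - s'‖ ≤ η := by
    have h1 : s - s' = ((s.re - 1 - x : ℝ) : ℂ) := by
      apply Complex.ext
      · rw [sub_re, hre, ofReal_re]; ring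
      · rw [sub_im, him, ofReal_im]; ring
    rw [h1, Complex.norm_real, Real.norm_eq_abs, abs_le]
    have h2 : s.re - 1 ≤ x := le_max_left _ _
    refine ⟨?_, by linarith⟩
    have h3 : x ≤ s.re - 1 + η := max_le (by linarith) (by linarith)
    linarith
  have hwlow : 2 * K2 * Y ^ 2 * η ≤ w := by
    refine le_of_pow_le_pow_left₀ (n := 4) (by norm_num) (norm_nonneg _) ?_
    have h1 : κ * (16 * K2 ^ 4 * (13122 * K ^ 4)) ≤ c ^ 5 := by
      rw [← le_div_iff₀ (by positivity)]
      exact min_le_right _ _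
    have h2 : η ^ 3 ≤ x ^ 3 := by gcongr; exact le_max_right _ _
    have h3 : (2 * K2 * Y ^ 2 * η) ^ 4 * (13122 * K ^ 4 * Y ^ 8) ≤
        w ^ 4 * (13122 * K ^ 4 * Y ^ 8) := by
      calc _ = η ^ 3 * (κ * (16 * K2 ^ 4 * (13122 * K ^ 4))) / Y ^ 15 := by
            rw [hη]; field_simp; ring
        _ ≤ x ^ 3 * c ^ 5 / Y ^ 15 := by gcongr
        _ = x ^ 3 * d ^ 5 := by rw [hd]; field_simp
        _ ≤ _ := key
        _ = _ := by ring
    exact le_of_mul_le_mul_right h3 (by positivity)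
  have hsub := normL_sub_le_height χ ha ha2 (z := s) (w := s') hs1.le (by rw [hre]; linarith)
    (by rw [him])
  rw [← hK2, ← hY] at hsub
  have h4 : ‖normL χ s - normL χ s'‖ ≤ K2 * Y ^ 2 * η := hsub.trans (by gcongr)
  have h5 := norm_sub_norm_le (normL χ s') (normL χ s)
  rw [norm_sub_rev] at h5
  have h6 : K2 * κ / Y ^ 29 = K2 * Y ^ 2 * η := by rw [hη]; field_simp
  rw [h6]
  linarith

lemma norm_one_sub_inv_ge {p : ℕ} (hp : p.Prime) : 1 / 4 ≤ ‖1 - (p : ℂ)⁻¹‖ := by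
  have h2 : (p : ℝ)⁻¹ ≤ 1 / 2 := by
    rw [one_div]; exact inv_anti₀ (by norm_num) (by exact_mod_cast hp.two_le)
  have h1 := norm_sub_norm_le (1 : ℂ) (p : ℂ)⁻¹
  rw [norm_one, norm_inv, Complex.norm_natCast] at h1
  linarith

lemma normL_one_lower {a : ℝ} (ha : 0 < a) : ∃ c : ℝ, 0 < c ∧ ∀ (q : ℕ) [NeZero q]
    (χ : DirichletCharacter ℂ q), χ ^ 2 = 1 → c / (q : ℝ) ^ a ≤ ‖normL χ 1‖ := by
  obtain ⟨c1, hc1, h1⟩ := siegel ha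
  obtain ⟨c2, hc2, h2⟩ := pow_card_primeFactors ha
  refine ⟨min c1 (c2 / 2), by positivity, fun q _ χ hχ2 ↦ ?_⟩
  have hq : (0 : ℝ) < q := by exact_mod_cast NeZero.pos q
  by_cases hχ : χ = 1
  · rw [normL, if_pos hχ, polarL, if_pos hχ, DirichletCharacter.LFunctionTrivChar₁,
      Function.update_self, norm_div, norm_prod]
    have h3 : (1 / 4 : ℝ) ^ q.primeFactors.card ≤ ∏ p ∈ q.primeFactors, ‖1 - (p : ℂ)⁻¹‖ := by
      rw [← Finset.prod_const]
      exact Finset.prod_le_prod (fun _ _ ↦ by norm_num) fun p hp ↦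
        norm_one_sub_inv_ge (Nat.prime_of_mem_primeFactors hp)
    have h4 := (h2 q (NeZero.ne q)).trans h3
    have h5 : ‖(1 : ℂ) + 1‖ = 2 := by norm_num
    rw [h5]
    calc _ ≤ c2 / 2 / (q : ℝ) ^ a := by gcongr; exact min_le_right _ _
      _ = c2 * (q : ℝ) ^ (-a) / 2 := by rw [Real.rpow_neg hq.le]; field_simp
      _ ≤ _ := by gcongr
  · rw [normL_of_ne_one hχ]
    refine le_trans ?_ (h1 q χ hχ2 hχ)
    rw [Real.rpow_neg hq.le, ← div_eq_mul_inv]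
    gcongr
    exact min_le_left _ _

theorem normL_lower {ε : ℝ} (hε : 0 < ε) : ∃ c : ℝ, 0 < c ∧ ∀ (q : ℕ) [NeZero q]
    (χ : DirichletCharacter ℂ q) (s : ℂ), 1 < s.re → s.re ≤ 2 →
    c * height q s ^ (-ε) ≤ ‖normL χ s‖ := by
  set a : ℝ := min (1 / 2) (ε / 29) with ha
  have hapos : 0 < a := by positivity
  have ha2 : a ≤ 1 / 2 := min_le_left _ _
  have haε : a * 29 ≤ ε := by
    have : a ≤ ε / 29 := min_le_right _ _
    linarith
  obtain ⟨c4, hc4, h4⟩ := normL_one_lower hapos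
  set K2 := lipConst a with hK2
  have hK2pos : 0 < K2 := by rw [hK2]; unfold lipConst; positivity
  set c2 : ℝ := min 1 (c4 / (2 * K2)) with hc2
  have hc2pos : 0 < c2 := by positivity
  obtain ⟨C, hC, hfar⟩ := normL_lower_away hapos ha2 hc2pos (min_le_left _ _)
  refine ⟨min C (c4 / 2), by positivity, fun q _ χ s hs1 hs2 ↦ ?_⟩
  have hN2 := two_le_height (q := q) s
  set Y := height q s ^ a with hY
  have hY1 : 1 ≤ Y := Real.one_le_rpow (by linarith) hapos.le
  have hpow : height q s ^ (-ε) ≤ (Y ^ 29)⁻¹ := by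
    rw [Real.rpow_neg (by linarith), hY, ← Real.rpow_natCast, ← Real.rpow_mul (by linarith)]
    refine inv_anti₀ (by positivity) (Real.rpow_le_rpow_of_exponent_le (by linarith) ?_)
    push_cast; exact haε
  have hmain : min C (c4 / 2) * height q s ^ (-ε) ≤ min C (c4 / 2) / Y ^ 29 := by
    rw [div_eq_mul_inv]
    exact mul_le_mul_of_nonneg_left hpow (by positivity)
  refine hmain.trans ?_
  by_cases h : χ ^ 2 = 1 → c2 / Y ^ 3 ≤ ‖s - 1‖
  · refine le_trans ?_ (hfar q χ s hs1 hs2 h)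
    gcongr
    exact min_le_left _ _
  · push Not at h
    obtain ⟨hχ2, hs⟩ := h
    have h5 := h4 q χ hχ2
    have hq : (1 : ℝ) ≤ q := by exact_mod_cast NeZero.pos q
    have hqY : (q : ℝ) ^ a ≤ Y := by
      rw [hY]
      refine Real.rpow_le_rpow (by linarith) ?_ hapos.le
      have := abs_nonneg s.im
      unfold height; nlinarith
    have h6 : c4 / Y ≤ ‖normL χ 1‖ := le_trans (by gcongr) h5
    have hsub := normL_sub_le_height χ hapos ha2 (z := s) (w := 1) hs1.le (by simp) (by simp)
    rw [← hK2, ← hY] at hsub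
    have h7 : ‖normL χ s - normL χ 1‖ ≤ c4 / 2 / Y := by
      calc _ ≤ K2 * Y ^ 2 * (c2 / Y ^ 3) := hsub.trans (by gcongr)
        _ ≤ K2 * Y ^ 2 * (c4 / (2 * K2) / Y ^ 3) := by gcongr; exact min_le_right _ _
        _ = c4 / 2 / Y := by field_simp
    have h8 := norm_sub_norm_le (normL χ 1) (normL χ s)
    rw [norm_sub_rev] at h8
    have h9 : min C (c4 / 2) / Y ^ 29 ≤ c4 / 2 / Y := by
      gcongr
      · exact min_le_right _ _
      · exact le_self_pow₀ hY1 (by norm_num)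
    have h10 : c4 / Y = c4 / 2 / Y + c4 / 2 / Y := by ring
    linarith

end LowerBound

section SmoothedSum

lemma normL_ball_lower {ε : ℝ} (hε : 0 < ε) : ∃ κ c : ℝ, 0 < κ ∧ κ ≤ 1 / 4 ∧ 0 < c ∧
    ∀ (q : ℕ) [NeZero q] (χ : DirichletCharacter ℂ q) (s z : ℂ), 1 < s.re → s.re ≤ 2 →
    ‖z - s‖ ≤ κ * height q s ^ (-ε) → c * height q s ^ (-ε) ≤ ‖normL χ z‖ := by
  obtain ⟨c0, hc0, hlow⟩ := normL_lower (half_pos hε)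
  set a : ℝ := min (1 / 2) (ε / 4) with ha
  have hapos : 0 < a := by positivity
  have ha2 : a ≤ 1 / 2 := min_le_left _ _
  have haε : 2 * a ≤ ε / 2 := by
    have : a ≤ ε / 4 := min_le_right _ _
    linarith
  set K : ℝ := 8 / a * (12 + 1 / a) with hK
  have hKpos : 0 < K := by positivity
  refine ⟨min (a / 2) (c0 / (4 * K)), c0 / 2, by positivity,
    (min_le_left _ _).trans (by linarith), by positivity, fun q _ χ s z hs1 hs2 hz ↦ ?_⟩
  set κ := min (a / 2) (c0 / (4 * K)) with hκ
  have hκ1 : κ ≤ a / 2 := min_le_left _ _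
  have hκ2 : κ ≤ c0 / (4 * K) := min_le_right _ _
  have hκ0 : 0 < κ := by positivity
  have hN := two_le_height (q := q) s
  have hq : (1 : ℝ) ≤ q := by exact_mod_cast NeZero.pos q
  have hNle : height q s ^ (-ε) ≤ 1 :=
    Real.rpow_le_one_of_one_le_of_nonpos (by linarith) (by linarith)
  have hzs : ‖z - s‖ ≤ a / 2 := hz.trans (by nlinarith)
  have hre := abs_le.1 ((abs_re_le_norm (z - s)).trans hzs)
  have him := abs_le.1 ((abs_im_le_norm (z - s)).trans hzs)
  rw [sub_re] at hre
  rw [sub_im] at him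
  have hzT : |z.im| ≤ |s.im| + 1 := by
    have h1 : z.im = s.im + (z.im - s.im) := by ring
    rw [h1]
    refine (abs_add_le _ _).trans (add_le_add_right ?_ _)
    rw [abs_le]; constructor <;> linarith
  have hsub := normL_sub_le χ hapos ha2 (z := z) (w := s) (T := |s.im| + 1)
    (by linarith) (by linarith) hzT (by linarith)
  rw [← hK] at hsub
  have hN0 : 0 < height q s := by linarith
  have h2 : (q * (|s.im| + 1 + 2) : ℝ) ^ (2 * a) ≤ 2 * height q s ^ (ε / 2) := by
    have h3 : (q * (|s.im| + 1 + 2) : ℝ) ≤ 2 * height q s := by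
      have := abs_nonneg s.im
      unfold height; nlinarith
    calc _ ≤ (2 * height q s) ^ (2 * a) := by gcongr
      _ = 2 ^ (2 * a) * height q s ^ (2 * a) := Real.mul_rpow (by norm_num) hN0.le
      _ ≤ 2 ^ (1 : ℝ) * height q s ^ (ε / 2) := by gcongr <;> linarith
      _ = _ := by norm_num
  have hsplit : height q s ^ (ε / 2) * height q s ^ (-ε) = height q s ^ (-(ε / 2)) := by
    rw [← Real.rpow_add hN0]; congr 1; ring
  have h4 : ‖normL χ z - normL χ s‖ ≤ c0 / 2 * height q s ^ (-(ε / 2)) := by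
    calc _ ≤ K * (2 * height q s ^ (ε / 2)) * (c0 / (4 * K) * height q s ^ (-ε)) := by
          refine hsub.trans ?_
          gcongr
          exact hz.trans (by gcongr)
      _ = c0 / 2 * (height q s ^ (ε / 2) * height q s ^ (-ε)) := by field_simp; ring
      _ = _ := by rw [hsplit]
  have h5 := hlow q χ s hs1 hs2
  have h6 := norm_sub_norm_le (normL χ s) (normL χ z)
  rw [norm_sub_rev] at h6
  have h7 : height q s ^ (-ε) ≤ height q s ^ (-(ε / 2)) :=
    Real.rpow_le_rpow_of_exponent_le (by linarith) (by linarith)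
  nlinarith

/-- The Mellin transform of `Σ μ(n) χ(n) (1 - n/x)₊` in the weight `x`, up to `x ^ s`. -/
noncomputable def smoothInv {q : ℕ} [NeZero q] (χ : DirichletCharacter ℂ q) (s : ℂ) : ℂ :=
  poleFactor χ s / (normL χ s * (s * (s + 1)))

lemma norm_poleFactor_le {q : ℕ} [NeZero q] (χ : DirichletCharacter ℂ q) {s : ℂ} (hs : 0 ≤ s.re) :
    ‖poleFactor χ s‖ ≤ 1 := by
  unfold poleFactor
  split_ifs
  · rw [norm_div]
    exact div_le_one_of_le₀ (norm_sub_one_le hs) (norm_nonneg _)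
  · simp

lemma differentiableAt_smoothInv {q : ℕ} [NeZero q] (χ : DirichletCharacter ℂ q) {s : ℂ}
    (hs : 0 < s.re) (h : normL χ s ≠ 0) : DifferentiableAt ℂ (smoothInv χ) s := by
  have h0 : s ≠ 0 := fun h ↦ by simp [h] at hs
  have h1 : s + 1 ≠ 0 := fun h ↦ by
    have := congrArg Complex.re h
    simp at this; linarith
  have hp : DifferentiableAt ℂ (poleFactor χ) s := by
    unfold poleFactor
    split_ifs
    · exact (by fun_prop : DifferentiableAt ℂ (fun s : ℂ ↦ s - 1) s).div (by fun_prop) h1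
    · fun_prop
  exact hp.div ((differentiableAt_normL χ hs).mul (by fun_prop))
    (mul_ne_zero h (mul_ne_zero h0 h1))

lemma sq_norm_ge {s : ℂ} (hs : 1 < s.re) : 1 + s.im ^ 2 ≤ ‖s‖ ^ 2 := by
  rw [Complex.sq_norm, normSq_apply]; nlinarith

lemma iteratedDeriv_smoothInv_le (k : ℕ) {η : ℝ} (hη : 0 < η) (hη2 : η ≤ 1 / 2) :
    ∃ C : ℝ, 0 < C ∧ ∀ (q : ℕ) [NeZero q] (χ : DirichletCharacter ℂ q) (s : ℂ), 1 < s.re →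
    s.re ≤ 2 → ‖iteratedDeriv k (smoothInv χ) s‖ ≤
      C * (q : ℝ) ^ η * ((1 : ℝ) + ‖s.im‖ ^ 2) ^ (-(3 / 2 : ℝ) / 2) := by
  set ε : ℝ := η / (k + 1) with hεdef
  have hε : 0 < ε := by positivity
  obtain ⟨κ, c, hκ, hκ4, hc, hball⟩ := normL_ball_lower hε
  refine ⟨k.factorial * (4 / c) / κ ^ k * 2, by positivity, fun q _ χ s hs1 hs2 ↦ ?_⟩
  have hN := two_le_height (q := q) s
  have hq : (1 : ℝ) ≤ q := by exact_mod_cast NeZero.pos q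
  set N := height q s with hNdef
  have hN0 : 0 < N := by linarith
  have hNle : N ^ (-ε) ≤ 1 :=
    Real.rpow_le_one_of_one_le_of_nonpos (by linarith) (by linarith)
  set r := κ * N ^ (-ε) with hr
  have hr0 : 0 < r := by positivity
  have hr4 : r ≤ 1 / 4 := by nlinarith
  have hs1n : 1 < ‖s‖ := hs1.trans_le ((le_abs_self _).trans (abs_re_le_norm s))
  have hzre : ∀ z : ℂ, ‖z - s‖ ≤ r → 1 / 2 < z.re := fun z hz ↦ by
    have h1 := abs_le.1 ((abs_re_le_norm (z - s)).trans hz)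
    rw [sub_re] at h1; linarith
  have hzpos : ∀ z : ℂ, ‖z - s‖ ≤ r → 0 < ‖normL χ z‖ := fun z hz ↦
    lt_of_lt_of_le (by positivity) (hball q χ s z hs1 hs2 hz)
  have hd : DiffContOnCl ℂ (smoothInv χ) (Metric.ball s r) := by
    refine DifferentiableOn.diffContOnCl fun z hz ↦ ?_
    rw [closure_ball s hr0.ne', mem_closedBall_iff_norm] at hz
    exact (differentiableAt_smoothInv χ (by linarith [hzre z hz])
      (norm_pos_iff.1 (hzpos z hz))).differentiableWithinAt
  have hbd : ∀ z ∈ Metric.sphere s r,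
      ‖smoothInv χ z‖ ≤ 4 / c * (N ^ ε / (1 + s.im ^ 2)) := fun z hz ↦ by
    rw [mem_sphere_iff_norm] at hz
    have h1 := hzre z hz.le
    have h2 := hball q χ s z hs1 hs2 hz.le
    have h3 : ‖s‖ / 2 ≤ ‖z‖ := by
      have := norm_sub_norm_le s z
      rw [norm_sub_rev, hz] at this
      linarith
    have h4 : ‖z‖ ≤ ‖z + 1‖ := by
      rw [← sq_le_sq₀ (norm_nonneg _) (norm_nonneg _), Complex.sq_norm, Complex.sq_norm,
        normSq_apply, normSq_apply]
      simp
      nlinarith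
    have h5 : (1 + s.im ^ 2) / 4 ≤ ‖z‖ * ‖z + 1‖ := by
      have := sq_norm_ge hs1
      have h6 : ‖s‖ / 2 * (‖s‖ / 2) ≤ ‖z‖ * ‖z + 1‖ := by gcongr; exact h3.trans h4
      nlinarith
    rw [smoothInv, norm_div, norm_mul, norm_mul]
    calc _ ≤ 1 / (c * N ^ (-ε) * ((1 + s.im ^ 2) / 4)) := by
          gcongr
          exact norm_poleFactor_le χ (by linarith)
      _ = _ := by rw [Real.rpow_neg hN0.le]; field_simp
  refine (norm_iteratedDeriv_le_of_forall_mem_sphere_norm_le k hr0 hd hbd).trans ?_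
  have hNη : N ^ ε * (N ^ ε) ^ k = N ^ η := by
    rw [← pow_succ', ← Real.rpow_natCast, ← Real.rpow_mul hN0.le]
    congr 1
    rw [hεdef]; push_cast; field_simp
  have h7 : N ^ η ≤ (q : ℝ) ^ η * (2 * (1 + s.im ^ 2) ^ (1 / 4 : ℝ)) := by
    rw [hNdef, height, Real.mul_rpow (by positivity) (by positivity)]
    gcongr
    have h8 : |s.im| + 2 ≤ 4 * (1 + s.im ^ 2) ^ (1 / 2 : ℝ) := by
      rw [← Real.sqrt_eq_rpow]
      have h9 := Real.sqrt_le_sqrt (show |s.im| ^ 2 ≤ 1 + s.im ^ 2 by rw [sq_abs]; linarith)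
      have h10 := Real.sqrt_le_sqrt (show 1 ≤ 1 + s.im ^ 2 by nlinarith)
      rw [Real.sqrt_sq (abs_nonneg _)] at h9
      rw [Real.sqrt_one] at h10
      linarith
    calc (|s.im| + 2) ^ η ≤ (|s.im| + 2) ^ (1 / 2 : ℝ) :=
          Real.rpow_le_rpow_of_exponent_le (by linarith [abs_nonneg s.im]) hη2
      _ ≤ (4 * (1 + s.im ^ 2) ^ (1 / 2 : ℝ)) ^ (1 / 2 : ℝ) := by gcongr
      _ = _ := by
        rw [Real.mul_rpow (by norm_num) (by positivity), ← Real.rpow_mul (by positivity),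
          ← Real.sqrt_eq_rpow, show (4 : ℝ) = 2 ^ 2 by norm_num, Real.sqrt_sq (by norm_num)]
        norm_num
  have h11 : (1 + s.im ^ 2 : ℝ) ^ (1 / 4 : ℝ) / (1 + s.im ^ 2) =
      (1 + ‖s.im‖ ^ 2) ^ (-(3 / 2 : ℝ) / 2) := by
    rw [Real.norm_eq_abs, sq_abs]
    nth_rewrite 2 [← Real.rpow_one (1 + s.im ^ 2)]
    rw [← Real.rpow_sub (by positivity)]
    norm_num
  rw [← h11]
  calc _ = k.factorial * (4 / c) / κ ^ k * (N ^ ε * (N ^ ε) ^ k) / (1 + s.im ^ 2) := by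
        rw [hr, Real.rpow_neg hN0.le]
        field_simp
        rw [div_pow, div_mul_cancel₀ _ (by positivity)]
    _ ≤ k.factorial * (4 / c) / κ ^ k * ((q : ℝ) ^ η * (2 * (1 + s.im ^ 2) ^ (1 / 4 : ℝ)))
        / (1 + s.im ^ 2) := by rw [hNη]; gcongr
    _ = _ := by ring

end SmoothedSum

section Perron

open scoped FourierTransform

noncomputable def tent (u : ℝ) : ℂ := ((max (1 - u) 0 : ℝ) : ℂ)

lemma hasMellin_tent {s : ℂ} (hs : 0 < s.re) : HasMellin tent s (1 / (s * (s + 1))) := by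
  have h1 := hasMellin_one_Ioc hs
  have h2 := hasMellin_cpow_Ioc 1 (s := s) (by simp; linarith)
  have h0 : s ≠ 0 := fun h ↦ by simp [h] at hs
  have h0' : s + 1 ≠ 0 := fun h ↦ by
    have := congrArg Complex.re h
    simp at this; linarith
  obtain ⟨h3, h4⟩ := hasMellin_sub h1.1 h2.1
  have heq : ∀ t ∈ Set.Ioi (0 : ℝ),
      (t : ℂ) ^ (s - 1) • (Set.indicator (Set.Ioc 0 1) (fun _ ↦ 1 : ℝ → ℂ) t -
        Set.indicator (Set.Ioc 0 1) (fun t ↦ (t : ℂ) ^ (1 : ℂ) : ℝ → ℂ) t) =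
      (t : ℂ) ^ (s - 1) • tent t := fun t ht ↦ by
    congr 1
    rw [Set.mem_Ioi] at ht
    by_cases h : t ≤ 1
    · have : t ∈ Set.Ioc (0 : ℝ) 1 := ⟨ht, h⟩
      simp [Set.indicator_of_mem this, tent, max_eq_left (sub_nonneg.2 h)]
    · have : t ∉ Set.Ioc (0 : ℝ) 1 := fun h' ↦ h h'.2
      simp [Set.indicator_of_notMem this, tent, max_eq_right (sub_nonpos.2 (not_le.1 h).le)]
  refine ⟨(integrableOn_congr_fun heq measurableSet_Ioi).1 h3, ?_⟩
  have h5 : mellin tent s = _ := (setIntegral_congr_fun measurableSet_Ioi heq).symm.trans h4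
  rw [h5, h1.2, h2.2]
  field_simp
  ring

lemma line_ne_zero {c : ℝ} (hc : 0 < c) (t : ℝ) : ((c : ℂ) + t * I) * ((c : ℂ) + t * I + 1) ≠ 0 := by
  refine mul_ne_zero (fun h ↦ ?_) (fun h ↦ ?_) <;>
  · have := congrArg Complex.re h
    simp at this; linarith

lemma norm_kernel_le {c : ℝ} (hc : 1 ≤ c) (t : ℝ) :
    ‖1 / (((c : ℂ) + t * I) * ((c : ℂ) + t * I + 1))‖ ≤ (1 + t ^ 2)⁻¹ := by
  rw [norm_div, norm_one, norm_mul, one_div]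
  refine inv_anti₀ (by positivity) ?_
  have h1 : ∀ z : ℂ, 0 ≤ z.re → ‖z‖ ≤ ‖z + 1‖ := fun z hz ↦ by
    rw [← sq_le_sq₀ (norm_nonneg _) (norm_nonneg _), Complex.sq_norm, Complex.sq_norm,
        normSq_apply, normSq_apply]
    simp
    nlinarith
  have h2 : 1 + t ^ 2 ≤ ‖(c : ℂ) + t * I‖ ^ 2 := by
    rw [Complex.sq_norm, normSq_apply]
    simp
    nlinarith
  have h3 := h1 (c + t * I) (by simp; linarith)
  nlinarith [norm_nonneg ((c : ℂ) + t * I)]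

lemma continuous_kernel {c : ℝ} (hc : 0 < c) :
    Continuous fun t : ℝ ↦ 1 / (((c : ℂ) + t * I) * ((c : ℂ) + t * I + 1)) :=
  continuous_const.div (by fun_prop) (line_ne_zero hc)

lemma integrable_kernel {c : ℝ} (hc : 1 ≤ c) :
    Integrable fun t : ℝ ↦ 1 / (((c : ℂ) + t * I) * ((c : ℂ) + t * I + 1)) :=
  integrable_inv_one_add_sq.mono' (continuous_kernel (by linarith)).aestronglyMeasurable
    (Eventually.of_forall (norm_kernel_le hc))

lemma tent_eq_integral {c u : ℝ} (hc : 1 ≤ c) (hu : 0 < u) :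
    tent u = 1 / (2 * Real.pi) * ∫ t : ℝ, (u : ℂ) ^ (-((c : ℂ) + t * I)) *
      (1 / (((c : ℂ) + t * I) * ((c : ℂ) + t * I + 1))) := by
  have hm : ∀ t : ℝ, mellin tent ((c : ℂ) + t * I) = _ :=
    fun t ↦ (hasMellin_tent (s := (c : ℂ) + t * I) (by simp; linarith)).2
  have h := mellinInv_mellin_eq c tent hu
    (hasMellin_tent (s := c) (by simp; linarith)).1
    (by
      unfold Complex.VerticalIntegrable
      simp_rw [hm]
      exact integrable_kernel hc)
    (by unfold tent; fun_prop)
  rw [← h, mellinInv]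
  simp_rw [hm]
  simp

/-- The Cesàro-weighted sum of `μ χ` up to `x`. -/
noncomputable def cesaroSum {q : ℕ} (χ : DirichletCharacter ℂ q) (x : ℝ) : ℂ :=
  ∑ n ∈ Finset.Icc 1 ⌊x⌋₊, χ n * (ArithmeticFunction.moebius n : ℂ) * (1 - n / x)

lemma cesaroSum_eq_tsum {q : ℕ} (χ : DirichletCharacter ℂ q) {x : ℝ} (hx : 0 < x) :
    cesaroSum χ x = ∑' n : ℕ, χ n * (ArithmeticFunction.moebius n : ℂ) * tent (n / x) := by
  rw [tsum_eq_sum (s := Finset.Icc 1 ⌊x⌋₊), cesaroSum]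
  · refine Finset.sum_congr rfl fun n hn ↦ ?_
    have h1 : (n : ℝ) ≤ x := (Nat.le_floor_iff hx.le).1 (Finset.mem_Icc.1 hn).2
    have h2 : (n : ℝ) / x ≤ 1 := (div_le_one hx).2 h1
    rw [tent, max_eq_left (by linarith)]
    push_cast; rfl
  · intro n hn
    rcases Nat.eq_zero_or_pos n with rfl | hn0
    · simp
    · have h1 : x < n := by
        by_contra! h
        exact hn (Finset.mem_Icc.2 ⟨hn0, (Nat.le_floor_iff hx.le).2 h⟩)
      have h2 : 1 ≤ (n : ℝ) / x := (one_le_div hx).2 h1.le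
      rw [tent, max_eq_right (by linarith)]
      simp

lemma smoothInv_eq {q : ℕ} [NeZero q] (χ : DirichletCharacter ℂ q) {s : ℂ} (hs : 1 < s.re) :
    smoothInv χ s = LSeries (fun n ↦ χ n * (ArithmeticFunction.moebius n : ℂ)) s *
      (1 / (s * (s + 1))) := by
  have hs1 : s ≠ 1 := fun h ↦ by simp [h] at hs
  have h1 := DirichletCharacter.LSeries.mul_mu_eq_one χ hs
  rw [← DirichletCharacter.LFunction_eq_LSeries χ hs] at h1
  change DirichletCharacter.LFunction χ s *
    LSeries (fun n ↦ χ n * (ArithmeticFunction.moebius n : ℂ)) s = 1 at h1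
  have hL : DirichletCharacter.LFunction χ s ≠ 0 := left_ne_zero_of_mul_eq_one h1
  have h2 : LSeries (fun n ↦ χ n * (ArithmeticFunction.moebius n : ℂ)) s =
      (DirichletCharacter.LFunction χ s)⁻¹ := (inv_eq_of_mul_eq_one_right h1).symm
  have hp : poleFactor χ s ≠ 0 := by
    unfold poleFactor
    split_ifs
    · refine div_ne_zero (sub_ne_zero.2 hs1) fun h ↦ ?_
      have := congrArg Complex.re h
      simp at this; linarith
    · exact one_ne_zero
  rw [h2, smoothInv, normL_eq χ hs1]
  have h0 : s ≠ 0 := fun h ↦ by simp [h] at hs; linarith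
  have h01 : s + 1 ≠ 0 := fun h ↦ by
    have := congrArg Complex.re h
    simp at this; linarith
  field_simp

lemma cesaroSum_eq_integral {q : ℕ} [NeZero q] (χ : DirichletCharacter ℂ q) {c x : ℝ}
    (hc : 1 < c) (hx : 0 < x) :
    cesaroSum χ x = 1 / (2 * Real.pi) *
      ∫ t : ℝ, (x : ℂ) ^ ((c : ℂ) + t * I) * smoothInv χ (c + t * I) := by
  set a : ℕ → ℂ := fun n ↦ χ n * (ArithmeticFunction.moebius n : ℂ) with ha
  set K : ℝ → ℂ := fun t ↦ 1 / (((c : ℂ) + t * I) * ((c : ℂ) + t * I + 1)) with hK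
  have hKint : Integrable K := integrable_kernel hc.le
  set F : ℕ → ℝ → ℂ := fun n t ↦ a n * ((((n / x : ℝ)) : ℂ) ^ (-((c : ℂ) + t * I)) * K t) with hF
  have ha0 : a 0 = 0 := by simp [ha]
  have hanorm : ∀ n, ‖a n‖ ≤ 1 := fun n ↦ by
    rw [ha]
    simp only [norm_mul]
    refine mul_le_one₀ (χ.norm_le_one _) (norm_nonneg _) ?_
    rw [Complex.norm_intCast]
    exact_mod_cast ArithmeticFunction.abs_moebius_le_one
  have hnorm : ∀ n t, 1 ≤ n → ‖F n t‖ = ‖a n‖ * ((n / x : ℝ) ^ (-c) * ‖K t‖) := fun n t hn ↦ by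
    have hn0 : 0 < (n / x : ℝ) := by positivity
    rw [hF]
    simp only [norm_mul]
    rw [Complex.norm_cpow_eq_rpow_re_of_pos hn0]
    simp
  have hF_int : ∀ n, Integrable (F n) := fun n ↦ by
    rcases Nat.eq_zero_or_pos n with rfl | hn
    · simp [hF, ha0]
    · have hn0 : 0 < (n / x : ℝ) := by positivity
      refine Integrable.const_mul ?_ _
      refine hKint.bdd_mul (c := (n / x : ℝ) ^ (-c)) ?_ (Eventually.of_forall fun t ↦ ?_)
      · have h1 : (((n / x : ℝ)) : ℂ) ≠ 0 := by exact_mod_cast hn0.ne'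
        refine Continuous.aestronglyMeasurable ?_
        exact Continuous.const_cpow (by fun_prop) (Or.inl h1)
      · rw [Complex.norm_cpow_eq_rpow_re_of_pos hn0]
        simp
  have hsum : Summable fun n ↦ ∫ t, ‖F n t‖ := by
    refine Summable.of_nonneg_of_le (fun n ↦ integral_nonneg fun t ↦ norm_nonneg _) (fun n ↦ ?_)
      ((Real.summable_one_div_nat_rpow.2 hc).mul_left (x ^ c * ∫ t, ‖K t‖))
    have hI : 0 ≤ ∫ t, ‖K t‖ := integral_nonneg fun t ↦ norm_nonneg _
    rcases Nat.eq_zero_or_pos n with rfl | hn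
    · simp only [hF, ha0, zero_mul, norm_zero, integral_zero]
      positivity
    · simp_rw [hnorm n _ hn]
      rw [integral_const_mul, integral_const_mul]
      calc _ ≤ 1 * ((n / x : ℝ) ^ (-c) * ∫ t, ‖K t‖) := by gcongr; exact hanorm n
        _ = _ := by
          rw [Real.rpow_neg (by positivity), Real.div_rpow (by positivity) hx.le]
          field_simp
  have hswap := integral_tsum_of_summable_integral_norm hF_int hsum
  rw [cesaroSum_eq_tsum χ hx]
  have h1 : ∀ n : ℕ, χ n * (ArithmeticFunction.moebius n : ℂ) * tent (n / x) =
      1 / (2 * Real.pi) * ∫ t, F n t := fun n ↦ by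
    rcases Nat.eq_zero_or_pos n with rfl | hn
    · simp [hF, ha0]
    · rw [tent_eq_integral hc.le (by positivity), hF]
      simp only
      rw [integral_const_mul]
      ring
  simp_rw [h1]
  rw [tsum_mul_left, hswap]
  congr 2
  ext t
  rw [smoothInv_eq χ (by simpa using hc), LSeries, ← tsum_mul_right, ← tsum_mul_left]
  refine tsum_congr fun n ↦ ?_
  rcases Nat.eq_zero_or_pos n with rfl | hn
  · simp [hF, ha0]
  · rw [LSeries.term_of_ne_zero hn.ne', hF]
    simp only
    rw [div_eq_mul_inv (n : ℝ) x, ofReal_mul, Complex.mul_cpow_ofReal_nonneg (by positivity)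
      (by positivity), ofReal_inv, Complex.inv_cpow_eq_ite, if_neg, ← Complex.cpow_neg, neg_neg,
      ofReal_natCast, Complex.cpow_neg (n : ℂ)]
    · simp only [ha, hK]
      field_simp
    · rw [Complex.arg_ofReal_of_nonneg hx.le]
      exact Real.pi_ne_zero.symm

end Perron

section Cesaro

open scoped FourierTransform

lemma analyticOnNhd_smoothInv {q : ℕ} [NeZero q] (χ : DirichletCharacter ℂ q) :
    AnalyticOnNhd ℂ (smoothInv χ) {s | 1 < s.re} := by
  refine DifferentiableOn.analyticOnNhd (fun s hs ↦ ?_) (isOpen_lt continuous_const continuous_re)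
  rw [Set.mem_ofPred_eq] at hs
  refine (differentiableAt_smoothInv χ (by linarith) fun h ↦ ?_).differentiableWithinAt
  obtain ⟨κ, c, -, -, hc, hb⟩ := normL_ball_lower one_pos
  have hs1 : s ≠ 1 := fun h ↦ by simp [h] at hs
  rw [normL_eq χ hs1] at h
  rcases mul_eq_zero.1 h with h | h
  · exact DirichletCharacter.LFunction_ne_zero_of_one_le_re χ (Or.inr hs1) hs.le h
  · unfold poleFactor at h
    split_ifs at h
    · rcases div_eq_zero_iff.1 h with h | h
      · exact hs1 (sub_eq_zero.1 h)
      · have := congrArg Complex.re h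
        simp at this; linarith
    · exact one_ne_zero h

lemma hasDerivAt_line (c t : ℝ) : HasDerivAt (fun t : ℝ ↦ (c : ℂ) + t * I) I t := by
  simpa using ((Complex.ofRealCLM.hasDerivAt (x := t)).mul_const I).const_add (c : ℂ)

lemma iteratedDeriv_line {G : ℂ → ℂ} {c : ℝ} (hG : AnalyticOnNhd ℂ G {s | 1 < s.re}) (hc : 1 < c)
    (k : ℕ) : iteratedDeriv k (fun t : ℝ ↦ G (c + t * I)) =
      fun t : ℝ ↦ I ^ k * iteratedDeriv k G (c + t * I) := by
  induction k with
  | zero => simp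
  | succ k ih =>
    rw [iteratedDeriv_succ, ih]
    ext t
    have hmem : ((c : ℂ) + t * I) ∈ {s : ℂ | 1 < s.re} := by simpa using hc
    have h1 : AnalyticAt ℂ (iteratedDeriv k G) ((c : ℂ) + t * I) := by
      rw [iteratedDeriv_eq_iterate]
      exact (hG _ hmem).iterated_deriv k
    have h2 := h1.differentiableAt.hasDerivAt.scomp t (hasDerivAt_line c t)
    rw [← iteratedDeriv_succ] at h2
    refine ((h2.const_mul (I ^ k)).deriv).trans ?_
    rw [smul_eq_mul, pow_succ]; ring

lemma contDiff_line {G : ℂ → ℂ} {c : ℝ} (hG : AnalyticOnNhd ℂ G {s | 1 < s.re}) (hc : 1 < c)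
    (N : ℕ) : ContDiff ℝ N (fun t : ℝ ↦ G (c + t * I)) := by
  rw [contDiff_iff_contDiffAt]
  intro t
  have hmem : ((c : ℂ) + t * I) ∈ {s : ℂ | 1 < s.re} := by simpa using hc
  have h1 : ContDiffAt ℝ N G ((c : ℂ) + t * I) := ((hG _ hmem).contDiffAt).restrict_scalars ℝ
  have h2 : ContDiff ℝ N fun t : ℝ ↦ (c : ℂ) + t * I :=
    contDiff_const.add (Complex.ofRealCLM.contDiff.mul contDiff_const)
  exact h1.comp t h2.contDiffAt

lemma norm_fourier_mul_pow_le {g : ℝ → ℂ} {k : ℕ} (hg : ContDiff ℝ k g)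
    (hi : ∀ n ≤ k, Integrable (iteratedDeriv n g)) (w : ℝ) :
    (2 * Real.pi * |w|) ^ k * ‖𝓕 g w‖ ≤ ∫ t, ‖iteratedDeriv k g t‖ := by
  have h := congrFun (Real.fourier_iteratedDeriv (N := k) (n := k) hg
    (fun n hn ↦ hi n (by exact_mod_cast hn)) le_rfl) w
  have h1 := congrArg norm h
  rw [norm_smul, norm_pow] at h1
  have h2 : ‖(2 * Real.pi * I * w : ℂ)‖ = 2 * Real.pi * |w| := by
    simp [abs_of_pos Real.pi_pos]
  rw [h2] at h1
  rw [← h1, Real.fourier_real_eq]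
  refine (norm_integral_le_integral_norm _).trans_eq ?_
  simp

theorem cesaroSum_bound (k : ℕ) {η : ℝ} (hη : 0 < η) (hη2 : η ≤ 1 / 2) :
    ∃ C : ℝ, 0 < C ∧ ∀ (q : ℕ) [NeZero q] (χ : DirichletCharacter ℂ q) (x : ℝ), 3 ≤ x →
    ‖cesaroSum χ x‖ ≤ C * (q : ℝ) ^ η * x / Real.log x ^ k := by
  choose C hC hbound using fun k ↦ iteratedDeriv_smoothInv_le k hη hη2
  set J : ℝ → ℝ := fun t ↦ ((1 : ℝ) + ‖t‖ ^ 2) ^ (-(3 / 2 : ℝ) / 2) with hJ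
  have hJint : Integrable J := integrable_rpow_neg_one_add_norm_sq (by simp; norm_num)
  have hJ0 : 0 ≤ ∫ t, J t := integral_nonneg fun t ↦ by positivity
  have hCk := hC k
  refine ⟨Real.exp 1 * C k * (∫ t, J t) + 1, by positivity, fun q _ χ x hx ↦ ?_⟩
  have hx0 : 0 < x := by linarith
  have hlog : 1 < Real.log x := by
    rw [Real.lt_log_iff_exp_lt hx0]
    exact Real.exp_one_lt_d9.trans (by linarith)
  set c : ℝ := 1 + 1 / Real.log x with hc
  have hc1 : 1 < c := by
    have : 0 < 1 / Real.log x := by positivity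
    linarith
  have hc2 : c ≤ 2 := by
    have : 1 / Real.log x ≤ 1 := (div_le_one (by linarith)).2 hlog.le
    linarith
  have hxc : x ^ c = Real.exp 1 * x := by
    rw [hc, Real.rpow_add hx0, Real.rpow_one, Real.rpow_def_of_pos hx0,
      mul_one_div_cancel (by linarith), mul_comm]
  set g : ℝ → ℂ := fun t ↦ smoothInv χ (c + t * I) with hg
  have hGan := analyticOnNhd_smoothInv χ
  have hbd : ∀ n t, ‖iteratedDeriv n g t‖ ≤ C n * (q : ℝ) ^ η * J t := fun n t ↦ by
    rw [hg, iteratedDeriv_line hGan hc1]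
    simp only [norm_mul, norm_pow, norm_I, one_pow, one_mul]
    have := hbound n q χ (c + t * I) (by simpa using hc1) (by simpa using hc2)
    simpa [hJ] using this
  have hF_int : ∀ n, Integrable (iteratedDeriv n g) := fun n ↦ by
    refine (hJint.const_mul (C n * (q : ℝ) ^ η)).mono' ?_ (Eventually.of_forall (hbd n))
    exact ((contDiff_line hGan hc1 n).continuous_iteratedDeriv n le_rfl).aestronglyMeasurable
  have h1 := norm_fourier_mul_pow_le (contDiff_line hGan hc1 k) (fun n _ ↦ hF_int n)
    (-(Real.log x / (2 * Real.pi)))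
  have h2 : 2 * Real.pi * |-(Real.log x / (2 * Real.pi))| = Real.log x := by
    rw [abs_neg, abs_of_pos (by positivity)]
    field_simp
  rw [h2] at h1
  have h3 : ∫ t, ‖iteratedDeriv k g t‖ ≤ C k * (q : ℝ) ^ η * ∫ t, J t := by
    rw [← integral_const_mul]
    exact integral_mono (hF_int k).norm (hJint.const_mul _) (hbd k)
  have h4 : ∫ t : ℝ, (x : ℂ) ^ ((c : ℂ) + t * I) * smoothInv χ (c + t * I) =
      (x : ℂ) ^ (c : ℂ) * 𝓕 g (-(Real.log x / (2 * Real.pi))) := by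
    rw [Real.fourier_real_eq_integral_exp_smul, ← integral_const_mul]
    congr 1
    ext t
    have hxne : (x : ℂ) ≠ 0 := by exact_mod_cast hx0.ne'
    rw [Complex.cpow_add _ _ hxne, Complex.cpow_def_of_ne_zero hxne (t * I), smul_eq_mul, mul_assoc]
    congr 3
    rw [← Complex.ofReal_log hx0.le]
    have hpi : (Real.pi : ℂ) ≠ 0 := by exact_mod_cast Real.pi_ne_zero
    push_cast
    field_simp
  rw [cesaroSum_eq_integral χ hc1 hx0, h4, norm_mul, norm_mul,
    Complex.norm_cpow_eq_rpow_re_of_pos hx0, ofReal_re, hxc]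
  have h5 : ‖(1 / (2 * Real.pi) : ℂ)‖ ≤ 1 := by
    rw [norm_div, norm_one, norm_mul, Complex.norm_real, Real.norm_eq_abs,
      abs_of_pos Real.pi_pos]
    refine div_le_one_of_le₀ ?_ (by positivity)
    have := Real.pi_gt_three
    norm_num; linarith
  have h6 : ‖𝓕 g (-(Real.log x / (2 * Real.pi)))‖ ≤
      C k * (q : ℝ) ^ η * (∫ t, J t) / Real.log x ^ k := by
    rw [le_div_iff₀ (by positivity), mul_comm]
    exact h1.trans h3
  calc _ ≤ 1 * (Real.exp 1 * x * (C k * (q : ℝ) ^ η * (∫ t, J t) / Real.log x ^ k)) := by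
        gcongr
    _ = (Real.exp 1 * C k * (∫ t, J t)) * (q : ℝ) ^ η * x / Real.log x ^ k := by ring
    _ ≤ _ := by gcongr; linarith

end Cesaro

section SiegelWalfisz

lemma log_pow_le (k : ℕ) {x : ℝ} (hx : 1 ≤ x) : Real.log x ^ k ≤ k.factorial * x := by
  have h := Real.pow_div_factorial_le_exp _ (Real.log_nonneg hx) k
  rw [Real.exp_log (by linarith), div_le_iff₀ (by positivity)] at h
  linarith

lemma one_lt_log {x : ℝ} (hx : 3 ≤ x) : 1 < Real.log x := by
  rw [Real.lt_log_iff_exp_lt (by linarith)]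
  exact Real.exp_one_lt_d9.trans (by linarith)

lemma norm_moebius_le (n : ℕ) : ‖(ArithmeticFunction.moebius n : ℂ)‖ ≤ 1 := by
  rw [Complex.norm_intCast]
  exact_mod_cast ArithmeticFunction.abs_moebius_le_one

/-- Partial sums are controlled by differences of Cesàro sums. -/
lemma norm_sum_le_of_weighted {a : ℕ → ℂ} (ha : ∀ n, ‖a n‖ ≤ 1) (N : ℕ) {H : ℕ} (hH : 0 < H) :
    ‖∑ n ∈ Finset.Icc 1 N, a n‖ ≤ (‖∑ n ∈ Finset.Icc 1 (N + H), a n * ((N + H : ℕ) - n)‖ +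
      ‖∑ n ∈ Finset.Icc 1 N, a n * (N - n)‖) / H + H := by
  have hsplit : ∀ f : ℕ → ℂ, ∑ n ∈ Finset.Icc 1 (N + H), f n =
      ∑ n ∈ Finset.Icc 1 N, f n + ∑ n ∈ Finset.Ioc N (N + H), f n := fun f ↦ by
    have h1 : Finset.Icc 1 (N + H) = Finset.Icc 1 N ∪ Finset.Ioc N (N + H) := by
      ext n; simp only [Finset.mem_union, Finset.mem_Icc, Finset.mem_Ioc]; omega
    rw [h1, Finset.sum_union]
    rw [Finset.disjoint_left]
    intro n; simp only [Finset.mem_Icc, Finset.mem_Ioc]; omega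
  have key : (H : ℂ) * ∑ n ∈ Finset.Icc 1 N, a n =
      ∑ n ∈ Finset.Icc 1 (N + H), a n * ((N + H : ℕ) - n) - ∑ n ∈ Finset.Icc 1 N, a n * (N - n)
        - ∑ n ∈ Finset.Ioc N (N + H), a n * ((N + H : ℕ) - n) := by
    rw [hsplit, add_sub_right_comm, add_sub_cancel_right, ← Finset.sum_sub_distrib,
      Finset.mul_sum]
    refine Finset.sum_congr rfl fun n _ ↦ ?_
    push_cast; ring
  have htail : ‖∑ n ∈ Finset.Ioc N (N + H), a n * (((N + H : ℕ) : ℂ) - n)‖ ≤ H * H := by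
    refine (norm_sum_le _ _).trans ((Finset.sum_le_card_nsmul _ _ (H : ℝ) fun n hn ↦ ?_).trans ?_)
    · rw [Finset.mem_Ioc] at hn
      rw [norm_mul, ← Nat.cast_sub hn.2, Complex.norm_natCast]
      have h1 : ((N + H - n : ℕ) : ℝ) ≤ H := by exact_mod_cast (by omega : N + H - n ≤ H)
      calc _ ≤ 1 * (H : ℝ) := by gcongr; exact ha n
        _ = _ := one_mul _
    · simp
  have hH0 : (0 : ℝ) < H := by exact_mod_cast hH
  have h2 := congrArg norm key
  rw [norm_mul, Complex.norm_natCast] at h2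
  have h3 := norm_sub_le (∑ n ∈ Finset.Icc 1 (N + H), a n * (((N + H : ℕ) : ℂ) - n)
    - ∑ n ∈ Finset.Icc 1 N, a n * (N - n)) (∑ n ∈ Finset.Ioc N (N + H), a n * ((N + H : ℕ) - n))
  have h4 := norm_sub_le (∑ n ∈ Finset.Icc 1 (N + H), a n * (((N + H : ℕ) : ℂ) - n))
    (∑ n ∈ Finset.Icc 1 N, a n * ((N : ℂ) - n))
  rw [div_add' _ _ _ hH0.ne', le_div_iff₀ hH0]
  linarith

lemma character_sum_bound (A : ℕ) : ∃ C : ℝ, 0 < C ∧ ∀ (q : ℕ) [NeZero q]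
    (χ : DirichletCharacter ℂ q) (N : ℕ), 3 ≤ N →
    ‖∑ n ∈ Finset.Icc 1 N, χ n * (ArithmeticFunction.moebius n : ℂ)‖ ≤
      C * q * N / Real.log N ^ A := by
  obtain ⟨C, hC, hces⟩ := cesaroSum_bound (2 * A) (η := 1 / 2) (by norm_num) le_rfl
  refine ⟨5 * C + 1 + A.factorial, by positivity, fun q _ χ N hN ↦ ?_⟩
  have hN' : (3 : ℝ) ≤ N := by exact_mod_cast hN
  have hlog := one_lt_log hN'
  have hq : (1 : ℝ) ≤ q := by exact_mod_cast NeZero.pos q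
  have hqη : (q : ℝ) ^ (1 / 2 : ℝ) ≤ q := by
    nth_rewrite 2 [← Real.rpow_one (q : ℝ)]
    exact Real.rpow_le_rpow_of_exponent_le hq (by norm_num)
  set Lg := Real.log N with hLg
  have hLA : 1 ≤ Lg ^ A := one_le_pow₀ hlog.le
  set H := ⌈(N : ℝ) / Lg ^ A⌉₊ with hH
  have hH1 : (N : ℝ) / Lg ^ A ≤ H := Nat.le_ceil _
  have hH0 : 0 < H := Nat.ceil_pos.2 (by positivity)
  have hH2 : (H : ℝ) ≤ N / Lg ^ A + 1 := (Nat.ceil_lt_add_one (by positivity)).le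
  have hHN : H ≤ N := Nat.ceil_le.2 (div_le_self (by positivity) hLA)
  have hW : ∀ M : ℕ, N ≤ M → ‖∑ n ∈ Finset.Icc 1 M,
      χ n * (ArithmeticFunction.moebius n : ℂ) * ((M : ℂ) - n)‖ ≤
      C * q * M ^ 2 / Lg ^ (2 * A) := fun M hM ↦ by
    have hM' : (3 : ℝ) ≤ M := hN'.trans (by exact_mod_cast hM)
    have hM0 : (M : ℂ) ≠ 0 := by
      have : 0 < M := by omega
      exact_mod_cast this.ne'
    have h1 : ∑ n ∈ Finset.Icc 1 M, χ n * (ArithmeticFunction.moebius n : ℂ) * ((M : ℂ) - n) =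
        M * cesaroSum χ M := by
      rw [cesaroSum, Nat.floor_natCast, Finset.mul_sum]
      refine Finset.sum_congr rfl fun n _ ↦ ?_
      push_cast
      field_simp
    rw [h1, norm_mul, Complex.norm_natCast]
    have h2 : Lg ≤ Real.log M := Real.log_le_log (by linarith) (by exact_mod_cast hM)
    calc _ ≤ M * (C * (q : ℝ) * M / Lg ^ (2 * A)) := by
          gcongr
          refine (hces q χ M hM').trans ?_
          gcongr
      _ = _ := by ring
  have hmain := norm_sum_le_of_weighted (a := fun n ↦ χ n * (ArithmeticFunction.moebius n : ℂ))
    (fun n ↦ by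
      rw [norm_mul]
      exact mul_le_one₀ (χ.norm_le_one _) (norm_nonneg _) (norm_moebius_le n)) N hH0
  refine hmain.trans ?_
  have h1 := hW (N + H) (by omega)
  have h2 := hW N le_rfl
  have h3 : ((N + H : ℕ) : ℝ) ^ 2 ≤ 4 * (N : ℝ) ^ 2 := by
    have : ((N + H : ℕ) : ℝ) ≤ 2 * N := by exact_mod_cast (by omega : N + H ≤ 2 * N)
    calc _ ≤ (2 * (N : ℝ)) ^ 2 := by gcongr
      _ = _ := by ring
  have hNpos : (0 : ℝ) < N := by linarith
  have h4 : (1 : ℝ) ≤ A.factorial * q * N / Lg ^ A := by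
    rw [le_div_iff₀ (by positivity), one_mul]
    have := log_pow_le A (x := N) (by linarith)
    calc _ ≤ A.factorial * (N : ℝ) := this
      _ = A.factorial * 1 * N := by ring
      _ ≤ _ := by gcongr
  calc _ ≤ (C * q * (4 * (N : ℝ) ^ 2) / Lg ^ (2 * A) + C * q * N ^ 2 / Lg ^ (2 * A)) /
        (N / Lg ^ A) + (N / Lg ^ A + 1) := by
        gcongr
        refine h1.trans ?_
        gcongr
    _ = 5 * C * q * N / Lg ^ A + 1 * N / Lg ^ A + 1 := by
        rw [two_mul, pow_add]; field_simp; ring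
    _ ≤ 5 * C * q * N / Lg ^ A + q * N / Lg ^ A + A.factorial * q * N / Lg ^ A := by
        gcongr
    _ = _ := by ring

lemma character_sum_bound_uniform (A : ℕ) : ∃ C : ℝ, 0 < C ∧ ∀ (q : ℕ) [NeZero q]
    (χ : DirichletCharacter ℂ q) (M N : ℕ), 3 ≤ N → M ≤ N →
    ‖∑ n ∈ Finset.Icc 1 M, χ n * (ArithmeticFunction.moebius n : ℂ)‖ ≤
      C * q * N / Real.log N ^ A := by
  obtain ⟨C, hC, hM⟩ := character_sum_bound A
  refine ⟨2 ^ A * C + 3 * 2 ^ A * A.factorial, by positivity, fun q _ χ M N hN hMN ↦ ?_⟩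
  have hN' : (3 : ℝ) ≤ N := by exact_mod_cast hN
  have hlog := one_lt_log hN'
  have hq : (1 : ℝ) ≤ q := by exact_mod_cast NeZero.pos q
  have hlogsq : Real.log N = 2 * Real.log (√(N : ℝ)) := by
    rw [Real.log_sqrt (by linarith)]; ring
  by_cases h : 3 ≤ M ∧ √(N : ℝ) ≤ M
  · refine (hM q χ M h.1).trans ?_
    have h1 : Real.log N / 2 ≤ Real.log M := by
      rw [hlogsq, mul_div_cancel_left₀ _ two_ne_zero]
      exact Real.log_le_log (by positivity) h.2
    have hMN' : (M : ℝ) ≤ N := by exact_mod_cast hMN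
    calc _ ≤ C * q * N / (Real.log N / 2) ^ A := by gcongr
      _ = 2 ^ A * C * q * N / Real.log N ^ A := by rw [div_pow]; field_simp
      _ ≤ _ := by gcongr; linarith [show 0 < 3 * 2 ^ A * (A.factorial : ℝ) by positivity]
  · have hs1 : 1 ≤ √(N : ℝ) := by rw [Real.one_le_sqrt]; linarith
    have h1 : (M : ℝ) ≤ 3 * √(N : ℝ) := by
      rw [not_and_or, not_le, not_le] at h
      rcases h with h | h
      · have : (M : ℝ) ≤ 3 := by exact_mod_cast h.le
        linarith
      · linarith
    have h2 : ‖∑ n ∈ Finset.Icc 1 M, χ n * (ArithmeticFunction.moebius n : ℂ)‖ ≤ M := by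
      refine (norm_sum_le_of_le _ fun n _ ↦ ?_).trans_eq (b := ∑ _n ∈ Finset.Icc 1 M, (1 : ℝ)) ?_
      · rw [norm_mul]
        exact mul_le_one₀ (χ.norm_le_one _) (norm_nonneg _) (norm_moebius_le n)
      · simp
    have h3 := log_pow_le A hs1
    have h4 : Real.log N ^ A ≤ 2 ^ A * A.factorial * √(N : ℝ) := by
      rw [hlogsq, mul_pow, mul_assoc]; gcongr
    refine h2.trans (h1.trans ?_)
    rw [le_div_iff₀ (by positivity)]
    calc _ ≤ 3 * √(N : ℝ) * (2 ^ A * A.factorial * √(N : ℝ)) := by gcongr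
      _ = 3 * 2 ^ A * A.factorial * 1 * (√(N : ℝ) * √(N : ℝ)) := by ring
      _ = 3 * 2 ^ A * A.factorial * 1 * N := by rw [Real.mul_self_sqrt (by linarith)]
      _ ≤ _ := by gcongr; linarith [show 0 < 2 ^ A * C by positivity]

end SiegelWalfisz

section PeriodicTwist

lemma coprime_sum_le {r : ℕ} [NeZero r] {a : ℕ → ℂ} {M : ℕ} {B : ℝ}
    (hB : ∀ χ : DirichletCharacter ℂ r, ‖∑ n ∈ Finset.Icc 1 M, χ n * a n‖ ≤ B)
    {f : ZMod r → ℂ} (hf : ∀ u, ‖f u‖ ≤ 1) :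
    ‖∑ n ∈ (Finset.Icc 1 M).filter (Nat.Coprime · r), a n * f n‖ ≤ r * B := by
  have hB0 : 0 ≤ B := (norm_nonneg _).trans (hB 1)
  have key : (r.totient : ℂ) * ∑ n ∈ (Finset.Icc 1 M).filter (Nat.Coprime · r), a n * f n =
      ∑ u : (ZMod r)ˣ, f u * ∑ χ : DirichletCharacter ℂ r, χ (u : ZMod r)⁻¹ *
        ∑ n ∈ Finset.Icc 1 M, χ n * a n := by
    have h1 : ∀ u : (ZMod r)ˣ, ∑ χ : DirichletCharacter ℂ r, χ (u : ZMod r)⁻¹ *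
        ∑ n ∈ Finset.Icc 1 M, χ n * a n =
        ∑ n ∈ Finset.Icc 1 M, if (u : ZMod r) = n then (r.totient : ℂ) * a n else 0 := fun u ↦ by
      simp_rw [Finset.mul_sum]
      rw [Finset.sum_comm]
      refine Finset.sum_congr rfl fun n _ ↦ ?_
      simp_rw [← mul_assoc]
      rw [← Finset.sum_mul, DirichletCharacter.sum_char_inv_mul_char_eq ℂ u.isUnit]
      split_ifs <;> simp
    simp_rw [h1, Finset.mul_sum]
    rw [Finset.sum_comm, Finset.sum_filter]
    refine Finset.sum_congr rfl fun n _ ↦ ?_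
    split_ifs with h
    · rw [Finset.sum_eq_single (ZMod.unitOfCoprime n h)]
      · simp; ring
      · intro u _ hu
        rw [if_neg, mul_zero]
        intro h'
        exact hu (Units.ext (by simpa using h'))
      · simp
    · symm
      refine Finset.sum_eq_zero fun u _ ↦ ?_
      rw [if_neg, mul_zero]
      intro h'
      exact h ((ZMod.isUnit_iff_coprime n r).1 (h' ▸ u.isUnit))
  have hφ : (0 : ℝ) < r.totient := by exact_mod_cast Nat.totient_pos.2 (NeZero.pos r)
  have h2 : ‖∑ u : (ZMod r)ˣ, f u * ∑ χ : DirichletCharacter ℂ r, χ (u : ZMod r)⁻¹ *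
        ∑ n ∈ Finset.Icc 1 M, χ n * a n‖ ≤ r.totient * (r.totient * B) := by
    refine (norm_sum_le_of_le (f := fun u : (ZMod r)ˣ ↦ f u *
      ∑ χ : DirichletCharacter ℂ r, χ (u : ZMod r)⁻¹ * ∑ n ∈ Finset.Icc 1 M, χ n * a n) _
      (n := fun _ ↦ r.totient * B) fun u _ ↦ ?_).trans_eq ?_
    · rw [norm_mul]
      calc _ ≤ 1 * ∑ _χ : DirichletCharacter ℂ r, B := by
            gcongr
            · exact hf _
            · refine norm_sum_le_of_le _ fun χ _ ↦ ?_
              rw [norm_mul]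
              calc _ ≤ 1 * B := by
                    gcongr
                    · exact χ.norm_le_one _
                    · exact hB χ
                _ = B := one_mul B
        _ = _ := by
          rw [Finset.sum_const, Finset.card_univ, ← Nat.card_eq_fintype_card,
            DirichletCharacter.card_eq_totient_of_hasEnoughRootsOfUnity, nsmul_eq_mul, one_mul]
    · rw [Finset.sum_const, Finset.card_univ, ZMod.card_units_eq_totient, nsmul_eq_mul]
  rw [← key, norm_mul, Complex.norm_natCast] at h2
  refine (le_of_mul_le_mul_left h2 hφ).trans ?_
  gcongr
  exact Nat.totient_le r

lemma sum_moebius_eq_sum_divisors {r : ℕ} [NeZero r] (g : ℕ → ℂ) (M : ℕ) :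
    ∑ n ∈ Finset.Icc 1 M, (ArithmeticFunction.moebius n : ℂ) * g n =
      ∑ d ∈ r.divisors, (ArithmeticFunction.moebius d : ℂ) *
        ∑ m ∈ (Finset.Icc 1 (M / d)).filter (Nat.Coprime · r),
          (ArithmeticFunction.moebius m : ℂ) * g (d * m) := by
  simp_rw [Finset.mul_sum]
  rw [Finset.sum_sigma']
  set S := r.divisors.sigma fun d ↦ (Finset.Icc 1 (M / d)).filter (Nat.Coprime · r) with hS
  have hmem : ∀ p ∈ S, p.1 ∣ r ∧ 0 < p.1 ∧ 1 ≤ p.2 ∧ p.1 * p.2 ≤ M ∧ Nat.Coprime p.2 r :=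
    fun p hp ↦ by
      simp only [hS, Finset.mem_sigma, Nat.mem_divisors, Finset.mem_filter, Finset.mem_Icc] at hp
      obtain ⟨⟨h1, -⟩, ⟨h2, h3⟩, h4⟩ := hp
      have h5 : 0 < p.1 := Nat.pos_of_dvd_of_pos h1 (NeZero.pos r)
      exact ⟨h1, h5, h2, by rw [mul_comm]; exact (Nat.le_div_iff_mul_le h5).1 h3, h4⟩
  have hgcd : ∀ p ∈ S, Nat.gcd (p.1 * p.2) r = p.1 := fun p hp ↦ by
    obtain ⟨h1, h2, h3, h4, h5⟩ := hmem p hp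
    rw [Nat.Coprime.gcd_mul_right_cancel _ h5]
    exact Nat.gcd_eq_left h1
  have hinj : Set.InjOn (fun p : (_ : ℕ) × ℕ ↦ p.1 * p.2) S := by
    intro p hp p' hp' h
    simp only at h
    have h1 := hgcd p hp
    rw [h, hgcd p' hp'] at h1
    obtain ⟨d, m⟩ := p
    obtain ⟨d', m'⟩ := p'
    simp only at h1 h
    subst h1
    have := Nat.eq_of_mul_eq_mul_left (hmem _ hp).2.1 h
    rw [this]
  have h1 : ∑ p ∈ S, (ArithmeticFunction.moebius p.1 : ℂ) *
      ((ArithmeticFunction.moebius p.2 : ℂ) * g (p.1 * p.2)) =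
      ∑ n ∈ S.image (fun p ↦ p.1 * p.2), (ArithmeticFunction.moebius n : ℂ) * g n := by
    rw [Finset.sum_image hinj]
    refine Finset.sum_congr rfl fun p hp ↦ ?_
    obtain ⟨h1, h2, h3, h4, h5⟩ := hmem p hp
    have hc : Nat.Coprime p.1 p.2 := (Nat.Coprime.coprime_dvd_right h1 h5).symm
    rw [ArithmeticFunction.isMultiplicative_moebius.map_mul_of_coprime hc]
    push_cast; ring
  rw [h1]
  symm
  refine Finset.sum_subset ?_ ?_
  · intro n hn
    obtain ⟨p, hp, rfl⟩ := Finset.mem_image.1 hn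
    obtain ⟨h1, h2, h3, h4, h5⟩ := hmem p hp
    exact Finset.mem_Icc.2 ⟨Nat.mul_pos h2 h3, h4⟩
  · intro n hn hn'
    rw [Finset.mem_Icc] at hn
    rw [mul_eq_zero]
    left
    by_contra hne
    have hsq : Squarefree n := ArithmeticFunction.moebius_ne_zero_iff_squarefree.1
      (by exact_mod_cast hne)
    refine hn' (Finset.mem_image.2 ⟨⟨n.gcd r, n / n.gcd r⟩, ?_,
      Nat.mul_div_cancel' (Nat.gcd_dvd_left _ _)⟩)
    have hg : 0 < n.gcd r := Nat.gcd_pos_of_pos_left _ hn.1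
    simp only [hS, Finset.mem_sigma, Nat.mem_divisors, Finset.mem_filter, Finset.mem_Icc]
    refine ⟨⟨Nat.gcd_dvd_right _ _, NeZero.ne r⟩, ⟨?_, Nat.div_le_div_right hn.2⟩, ?_⟩
    · exact Nat.div_pos (Nat.le_of_dvd hn.1 (Nat.gcd_dvd_left _ _)) hg
    · refine Nat.coprime_of_dvd fun p hp hpm hpr ↦ ?_
      have hpn : p ∣ n := hpm.trans (Nat.div_dvd_of_dvd (Nat.gcd_dvd_left _ _))
      have h2 : p * p ∣ n := by
        rw [← Nat.mul_div_cancel' (Nat.gcd_dvd_left n r)]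
        exact mul_dvd_mul (Nat.dvd_gcd hpn hpr) hpm
      exact hp.one_lt.ne' (Nat.isUnit_iff.1 (hsq p h2))

theorem periodic_sum_bound (A : ℕ) : ∃ C : ℝ, 0 < C ∧ ∀ (r : ℕ) [NeZero r] (f : ZMod r → ℂ),
    (∀ u, ‖f u‖ ≤ 1) → ∀ M N : ℕ, 3 ≤ N → M ≤ N →
    ‖∑ n ∈ Finset.Icc 1 M, (ArithmeticFunction.moebius n : ℂ) * f n‖ ≤
      C * r ^ 3 * N / Real.log N ^ A := by
  obtain ⟨C, hC, hM⟩ := character_sum_bound_uniform A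
  refine ⟨C, hC, fun r _ f hf M N hN hMN ↦ ?_⟩
  rw [sum_moebius_eq_sum_divisors (r := r)]
  set B : ℝ := C * r * N / Real.log N ^ A with hBdef
  have hB0 : 0 ≤ B := by
    have := one_lt_log (x := N) (by exact_mod_cast hN)
    positivity
  have h1 : ∀ d ∈ r.divisors, ‖(ArithmeticFunction.moebius d : ℂ) *
        ∑ m ∈ (Finset.Icc 1 (M / d)).filter (Nat.Coprime · r),
          (ArithmeticFunction.moebius m : ℂ) * f (d * m : ℕ)‖ ≤ r * B := fun d _ ↦ by
    rw [norm_mul]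
    calc _ ≤ 1 * (r * B) := by
          gcongr
          · exact norm_moebius_le d
          · simp_rw [Nat.cast_mul]
            exact coprime_sum_le (fun χ ↦ hM r χ (M / d) N hN ((Nat.div_le_self _ _).trans hMN))
              (f := fun u ↦ f (d * u)) (fun u ↦ hf _)
      _ = _ := one_mul _
  refine (norm_sum_le_of_le _ h1).trans ?_
  rw [Finset.sum_const, nsmul_eq_mul]
  have h2 : (r.divisors.card : ℝ) ≤ r := by exact_mod_cast Nat.card_divisors_le_self r
  calc _ ≤ (r : ℝ) * (r * B) := by gcongr
    _ = _ := by rw [hBdef]; ring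

end PeriodicTwist

section ExponentialSums

/-- The additive character `e(α) = exp(2πiα)`. -/
noncomputable def ee (α : ℝ) : ℂ := exp (2 * Real.pi * α * I)

lemma norm_ee (α : ℝ) : ‖ee α‖ = 1 := by
  rw [ee, show (2 * Real.pi * α * I : ℂ) = ((2 * Real.pi * α : ℝ) : ℂ) * I by push_cast; ring,
    norm_exp_ofReal_mul_I]

lemma ee_add (α β : ℝ) : ee (α + β) = ee α * ee β := by
  rw [ee, ee, ee, ← exp_add]; push_cast; ring_nf

lemma ee_int (m : ℤ) : ee m = 1 := by
  rw [ee, Complex.exp_eq_one_iff]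
  exact ⟨m, by push_cast; ring⟩

lemma ee_nat_mul (n : ℕ) (α : ℝ) : ee (n * α) = ee α ^ n := by
  rw [ee, ee, ← exp_nat_mul]; push_cast; ring_nf

lemma conj_ee (α : ℝ) : (starRingEnd ℂ) (ee α) = ee (-α) := by
  rw [ee, ee, show (2 * Real.pi * α * I : ℂ) = ((2 * Real.pi * α : ℝ) : ℂ) * I by push_cast; ring,
    ← exp_conj, map_mul, conj_ofReal, conj_I]
  push_cast; ring_nf

/-- Distance to the nearest integer. -/
noncomputable def nd (θ : ℝ) : ℝ := |θ - round θ|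

lemma nd_nonneg (θ : ℝ) : 0 ≤ nd θ := abs_nonneg _

lemma four_mul_nd_le (θ : ℝ) : 4 * nd θ ≤ ‖ee θ - 1‖ := by
  have h1 : ee θ = ee (θ - round θ) := by
    rw [sub_eq_add_neg, ee_add, ← Int.cast_neg, ee_int, mul_one]
  have h2 := abs_sub_round θ
  rw [h1, nd]
  set x := θ - round θ
  rw [ee, show (2 * Real.pi * x * I : ℂ) = I * ((2 * Real.pi * x : ℝ) : ℂ) by push_cast; ring,
    Complex.norm_exp_I_mul_ofReal_sub_one, norm_mul, Real.norm_two, Real.norm_eq_abs,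
    show 2 * Real.pi * x / 2 = Real.pi * x by ring]
  have hpi := Real.pi_pos
  have h3 := Real.mul_abs_le_abs_sin (x := Real.pi * x) (by
    rw [abs_mul, abs_of_pos hpi]; nlinarith)
  rw [abs_mul, abs_of_pos hpi] at h3
  have h4 : 2 / Real.pi * (Real.pi * |x|) = 2 * |x| := by field_simp
  linarith

lemma norm_ee_sub_one_le (β : ℝ) : ‖ee β - 1‖ ≤ 7 * |β| := by
  rw [ee, show (2 * Real.pi * β * I : ℂ) = I * ((2 * Real.pi * β : ℝ) : ℂ) by push_cast; ring]
  refine (Real.norm_exp_I_mul_ofReal_sub_one_le).trans ?_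
  rw [Real.norm_eq_abs, abs_mul, abs_of_pos (by positivity)]
  have := Real.pi_lt_d2
  gcongr
  linarith

/-- `min(Y, 1/‖θ‖)`, without division by zero. -/
noncomputable def kern (Y θ : ℝ) : ℝ := if nd θ * Y ≤ 1 then Y else 1 / nd θ

lemma le_kern {Y θ u : ℝ} (h1 : u ≤ Y) (h2 : u * nd θ ≤ 1) : u ≤ kern Y θ := by
  unfold kern
  split_ifs with h
  · exact h1
  · have h0 : 0 < nd θ := by
      refine lt_of_le_of_ne (nd_nonneg θ) fun h' ↦ h ?_
      rw [← h', zero_mul]; exact zero_le_one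
    rwa [le_div_iff₀ h0]

lemma kern_nonneg {Y θ : ℝ} (hY : 0 ≤ Y) : 0 ≤ kern Y θ := le_kern hY (by simp)

lemma kern_le {Y θ : ℝ} : kern Y θ ≤ Y := by
  unfold kern
  split_ifs with h
  · rfl
  · have h0 : 0 < nd θ := by
      refine lt_of_le_of_ne (nd_nonneg θ) fun h' ↦ h ?_
      rw [← h', zero_mul]; exact zero_le_one
    rw [div_le_iff₀ h0]; linarith

lemma kern_mul_nd_le {Y θ : ℝ} : kern Y θ * nd θ ≤ 1 := by
  unfold kern
  split_ifs with h
  · linarith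
  · exact (div_mul_cancel_of_imp (by intro h'; exfalso; apply h; rw [h', zero_mul]; norm_num)).le

lemma norm_geom_le (θ : ℝ) {a b : ℕ} (hab : a ≤ b) :
    ‖∑ l ∈ Finset.Ico a b, ee θ ^ l‖ * nd θ ≤ 1 / 2 := by
  have h1 : (∑ l ∈ Finset.Ico a b, ee θ ^ l) * (ee θ - 1) = ee θ ^ b - ee θ ^ a :=
    geom_sum_Ico_mul _ hab
  have h2 := congrArg norm h1
  rw [norm_mul] at h2
  have h3 : ‖ee θ ^ b - ee θ ^ a‖ ≤ 2 := by
    refine (norm_sub_le _ _).trans ?_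
    rw [norm_pow, norm_pow, norm_ee, one_pow, one_pow]; norm_num
  have h4 := four_mul_nd_le θ
  have h5 : ‖∑ l ∈ Finset.Ico a b, ee θ ^ l‖ * (4 * nd θ) ≤ 2 := by
    refine le_trans ?_ (h2.le.trans h3)
    gcongr
  linarith

lemma norm_weighted_geom_le (θ : ℝ) (M : ℕ) :
    ‖∑ l ∈ Finset.Icc 1 M, (l : ℂ) * ee θ ^ l‖ ≤ M * kern M θ := by
  have h1 : ∑ l ∈ Finset.Icc 1 M, (l : ℂ) * ee θ ^ l =
      ∑ j ∈ Finset.range M, ∑ l ∈ Finset.Ico (j + 1) (M + 1), ee θ ^ l := by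
    rw [Finset.sum_sigma']
    have h2 : ∀ l ∈ Finset.Icc 1 M, (l : ℂ) * ee θ ^ l = ∑ _j ∈ Finset.range l, ee θ ^ l :=
      fun l _ ↦ by simp
    rw [Finset.sum_congr rfl h2, Finset.sum_sigma']
    refine Finset.sum_nbij' (fun p ↦ ⟨p.2, p.1⟩) (fun p ↦ ⟨p.2, p.1⟩) ?_ ?_ ?_ ?_ ?_
    · rintro ⟨l, j⟩ h
      simp only [Finset.mem_sigma, Finset.mem_Icc, Finset.mem_range, Finset.mem_Ico] at h ⊢
      omega
    · rintro ⟨l, j⟩ h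
      simp only [Finset.mem_sigma, Finset.mem_Icc, Finset.mem_range, Finset.mem_Ico] at h ⊢
      omega
    · intros; rfl
    · intros; rfl
    · intros; rfl
  rw [h1]
  refine (norm_sum_le_of_le (n := fun _ ↦ kern M θ) _ fun j hj ↦ ?_).trans_eq (by simp)
  rw [Finset.mem_range] at hj
  refine le_kern ?_ ((norm_geom_le θ (by omega)).trans (by norm_num))
  refine (norm_sum_le_of_le (n := fun _ ↦ (1 : ℝ)) _ fun l _ ↦ ?_).trans ?_
  · rw [norm_pow, norm_ee, one_pow]
  · simp

/-- Abel summation against a geometric progression of modulus one. -/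
lemma norm_sum_mul_pow_le {a : ℕ → ℂ} {z : ℂ} (hz : ‖z‖ = 1) {N : ℕ} {B : ℝ}
    (hB : ∀ M ≤ N, ‖∑ n ∈ Finset.Icc 1 M, a n‖ ≤ B) :
    ‖∑ n ∈ Finset.Icc 1 N, a n * z ^ n‖ ≤ B * (1 + N * ‖z - 1‖) := by
  have key : ∀ K : ℕ, ∑ n ∈ Finset.Icc 1 K, a n * z ^ n = (∑ n ∈ Finset.Icc 1 K, a n) * z ^ K -
      ∑ m ∈ Finset.range K, (∑ n ∈ Finset.Icc 1 m, a n) * (z ^ m * (z - 1)) := fun K ↦ by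
    induction K with
    | zero => simp
    | succ K ih =>
      rw [Finset.sum_Icc_succ_top (by omega), Finset.sum_Icc_succ_top (by omega), ih,
        Finset.sum_range_succ]
      ring
  have h1 : ‖∑ m ∈ Finset.range N, (∑ n ∈ Finset.Icc 1 m, a n) * (z ^ m * (z - 1))‖ ≤
      N * (B * ‖z - 1‖) := by
    refine (norm_sum_le_of_le (n := fun _ ↦ B * ‖z - 1‖) _ fun m hm ↦ ?_).trans_eq (by simp)
    rw [norm_mul, norm_mul, norm_pow, hz, one_pow, one_mul]
    gcongr
    exact hB m (Finset.mem_range.1 hm).le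
  rw [key]
  refine (norm_sub_le _ _).trans ?_
  rw [norm_mul, norm_pow, hz, one_pow, mul_one]
  linarith [hB N le_rfl]

theorem major_arc_bound (A : ℕ) : ∃ C : ℝ, 0 < C ∧ ∀ (r : ℕ) [NeZero r] (b : ℤ) (α : ℝ) (N : ℕ),
    3 ≤ N → ‖∑ n ∈ Finset.Icc 1 N, (ArithmeticFunction.moebius n : ℂ) * ee (n * α)‖ ≤
      C * r ^ 3 * N / Real.log N ^ A * (1 + N * (7 * |α - b / r|)) := by
  obtain ⟨C, hC, h⟩ := periodic_sum_bound A
  refine ⟨C, hC, fun r _ b α N hN ↦ ?_⟩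
  have hr : (r : ℝ) ≠ 0 := by exact_mod_cast NeZero.ne r
  have h1 : ∀ n : ℕ, (ArithmeticFunction.moebius n : ℂ) * ee (n * α) =
      (ArithmeticFunction.moebius n : ℂ) * ZMod.stdAddChar (N := r) ((b : ZMod r) * n) *
        ee (α - b / r) ^ n := fun n ↦ by
    rw [mul_assoc]
    congr 1
    have h2 : ((b : ZMod r) * n) = ((b * n : ℤ) : ZMod r) := by push_cast; ring
    rw [h2, ZMod.stdAddChar_coe, ← ee_nat_mul, ee, ee, ← exp_add]
    congr 1
    have : (r : ℂ) ≠ 0 := by exact_mod_cast hr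
    push_cast
    field_simp
    ring
  simp_rw [h1]
  have hlog := one_lt_log (x := N) (by exact_mod_cast hN)
  refine (norm_sum_mul_pow_le (norm_ee _) (fun M hM ↦ h r
    (fun u ↦ ZMod.stdAddChar (N := r) ((b : ZMod r) * u)) (fun u ↦ ?_) M N hN hM)).trans ?_
  · simp
  · gcongr
    exact norm_ee_sub_one_le _

end ExponentialSums

section Spacing

lemma nd_ge {r t m : ℤ} (hr : 0 < r) {x η : ℝ} (h1 : -1 ≤ η) (h2 : η ≤ 2)
    (hx : x = m + (t + η) / r) {u : ℝ} (hu1 : u ≤ (t - 1) / r) (hu2 : u ≤ (r - t - 2) / r) :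
    u ≤ nd x := by
  have hr' : (0 : ℝ) < r := by exact_mod_cast hr
  rw [nd]
  have h3 : x - round x = (t + η) / r - ((round x - m : ℤ) : ℝ) := by
    nth_rewrite 1 [hx]; push_cast; ring
  rw [h3]
  set n := round x - m
  have h4 : (t - 1) / r ≤ (t + η) / r := by gcongr; linarith
  have h5 : (t + η) / r ≤ 1 - (r - t - 2) / r := by
    rw [le_sub_iff_add_le, ← add_div, div_le_one hr']; linarith
  rcases le_or_gt n 0 with hn | hn
  · have : (n : ℝ) ≤ 0 := by exact_mod_cast hn
    exact le_trans (by linarith) (le_abs_self _)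
  · have : (1 : ℝ) ≤ n := by exact_mod_cast hn
    exact le_trans (by linarith) (neg_le_abs _)

/-- The majorant attached to the residue class `t`. -/
noncomputable def slot (r : ℕ) (Y : ℝ) (t : ℕ) : ℝ :=
  if t ≤ 1 ∨ r ≤ t + 2 then Y else r / (t - 1) + r / (r - t - 2)

lemma sum_slot_le {r : ℕ} (hr : 0 < r) {Y : ℝ} (hY : 0 ≤ Y) :
    ∑ t ∈ Finset.range r, slot r Y t ≤ 4 * Y + 2 * (r * (1 + Real.log r)) := by
  have hr1 : (1 : ℝ) ≤ r := by exact_mod_cast hr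
  have hlog := Real.log_nonneg hr1
  have hharm : ∀ s : Finset ℕ, (∀ k ∈ s, 1 ≤ k ∧ k ≤ r) → ∑ k ∈ s, (1 : ℝ) / k ≤ 1 + Real.log r :=
    fun s hs ↦ by
      have h1 : ∑ k ∈ s, (1 : ℝ) / k ≤ ∑ k ∈ Finset.Icc 1 r, (1 : ℝ) / k :=
        Finset.sum_le_sum_of_subset_of_nonneg (fun k hk ↦ Finset.mem_Icc.2 (hs k hk))
          (fun _ _ _ ↦ by positivity)
      refine h1.trans ?_
      have h2 := harmonic_le_one_add_log r
      rw [harmonic_eq_sum_Icc] at h2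
      push_cast at h2
      simpa [one_div] using h2
  unfold slot
  rw [Finset.sum_ite, Finset.sum_const, nsmul_eq_mul, Finset.sum_add_distrib]
  set S := (Finset.range r).filter fun t ↦ ¬(t ≤ 1 ∨ r ≤ t + 2) with hS
  have hmem : ∀ t ∈ S, 2 ≤ t ∧ t + 3 ≤ r := fun t ht ↦ by
    rw [hS, Finset.mem_filter] at ht
    omega
  have hcard : (((Finset.range r).filter fun t ↦ t ≤ 1 ∨ r ≤ t + 2).card : ℝ) ≤ 4 := by
    have h1 : (Finset.range r).filter (fun t ↦ t ≤ 1 ∨ r ≤ t + 2) ⊆ {0, 1, r - 1, r - 2} := by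
      intro t ht
      rw [Finset.mem_filter, Finset.mem_range] at ht
      simp only [Finset.mem_insert, Finset.mem_singleton]
      omega
    exact_mod_cast (Finset.card_le_card h1).trans Finset.card_le_four
  have hA : ∑ t ∈ S, (r : ℝ) / (t - 1) ≤ r * (1 + Real.log r) := by
    have h1 : ∑ t ∈ S, (r : ℝ) / (t - 1) = r * ∑ k ∈ S.image (fun t : ℕ ↦ t - 1), (1 : ℝ) / (k : ℕ) := by
      rw [Finset.sum_image, Finset.mul_sum]
      · refine Finset.sum_congr rfl fun t ht ↦ ?_
        have := hmem t ht
        rw [Nat.cast_sub (by omega)]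
        push_cast; ring
      · intro a ha b hb h
        have := hmem a ha
        have := hmem b hb
        simp only at h; omega
    rw [h1]
    gcongr
    refine hharm _ fun k hk ↦ ?_
    obtain ⟨t, ht, rfl⟩ := Finset.mem_image.1 hk
    have := hmem t ht
    omega
  have hB : ∑ t ∈ S, (r : ℝ) / (r - t - 2) ≤ r * (1 + Real.log r) := by
    have h1 : ∑ t ∈ S, (r : ℝ) / (r - t - 2) = r * ∑ k ∈ S.image (fun t : ℕ ↦ r - t - 2),
        (1 : ℝ) / (k : ℕ) := by
      rw [Finset.sum_image, Finset.mul_sum]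
      · refine Finset.sum_congr rfl fun t ht ↦ ?_
        have := hmem t ht
        rw [Nat.cast_sub (by omega), Nat.cast_sub (by omega)]
        push_cast; ring
      · intro a ha b hb h
        have := hmem a ha
        have := hmem b hb
        simp only at h; omega
    rw [h1]
    gcongr
    refine hharm _ fun k hk ↦ ?_
    obtain ⟨t, ht, rfl⟩ := Finset.mem_image.1 hk
    have := hmem t ht
    omega
  have : (((Finset.range r).filter fun t ↦ t ≤ 1 ∨ r ≤ t + 2).card : ℝ) * Y ≤ 4 * Y := by gcongr
  linarith

lemma block_sum_le {r : ℕ} {b : ℤ} {α Y : ℝ} (hr : 0 < r) (hb : IsCoprime b (r : ℤ))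
    (hα : |α - b / r| ≤ 1 / (r : ℝ) ^ 2) (hY : 0 ≤ Y) {F : ℕ → ℝ} (hF : ∀ j, F j ≤ Y)
    (hF2 : ∀ j, F j * nd (j * α) ≤ 1) (j₀ : ℕ) :
    ∑ i ∈ Finset.range r, F (j₀ + i) ≤ 4 * Y + 2 * (r * (1 + Real.log r)) := by
  have hr' : (0 : ℝ) < r := by exact_mod_cast hr
  have hrz : (0 : ℤ) < r := by exact_mod_cast hr
  set δ := α - b / r with hδ
  set s : ℤ := ⌊(r : ℝ) * (j₀ * α)⌋ with hs
  set ρ : ℝ := r * (j₀ * α) - s with hρ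
  have hρ0 : 0 ≤ ρ := by rw [hρ]; linarith [Int.floor_le ((r : ℝ) * (j₀ * α))]
  have hρ1 : ρ ≤ 1 := by rw [hρ]; linarith [Int.lt_floor_add_one ((r : ℝ) * (j₀ * α))]
  set τ : ℕ → ℕ := fun i ↦ ((s + i * b) % r).toNat with hτ
  have hτz : ∀ i, ((τ i : ℕ) : ℤ) = (s + i * b) % r := fun i ↦
    Int.toNat_of_nonneg (Int.emod_nonneg _ hrz.ne')
  have hτlt : ∀ i, τ i < r := fun i ↦ by
    have := Int.emod_lt_of_pos (s + i * b) hrz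
    rw [← hτz] at this
    exact_mod_cast this
  have hpt : ∀ i ∈ Finset.range r, F (j₀ + i) ≤ slot r Y (τ i) := fun i hi ↦ by
    rw [Finset.mem_range] at hi
    unfold slot
    split_ifs with h
    · exact hF _
    · push Not at h
      set t := τ i with ht
      have ht2 : (2 : ℝ) ≤ t := by exact_mod_cast h.1
      have htr : (t : ℝ) + 3 ≤ r := by exact_mod_cast h.2
      have hdiv := Int.emod_add_mul_ediv (s + i * b) r
      rw [← hτz, ← ht] at hdiv
      have hdivR : (t : ℝ) + r * ((s + i * b) / (r : ℤ) : ℤ) = s + i * b := by exact_mod_cast hdiv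
      set m : ℤ := (s + i * b) / (r : ℤ)
      have hη : |(i : ℝ) * (r * δ)| ≤ 1 := by
        rw [abs_mul, abs_mul, Nat.abs_cast, Nat.abs_cast]
        have hi' : (i : ℝ) ≤ r := by exact_mod_cast hi.le
        calc _ ≤ (r : ℝ) * (r * (1 / (r : ℝ) ^ 2)) := by gcongr
          _ = 1 := by field_simp
      rw [abs_le] at hη
      have hx : ((j₀ + i : ℕ) : ℝ) * α = (m : ℝ) + (((t : ℤ) : ℝ) + (ρ + i * (r * δ))) / ((r : ℤ) : ℝ) := by
        have h1 : α = b / r + δ := by rw [hδ]; ring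
        have h2 : (r : ℝ) * (j₀ * α) = s + ρ := by rw [hρ]; ring
        have h3 : (i : ℝ) * (r * α) = i * b + i * (r * δ) := by
          nth_rewrite 1 [h1]; field_simp
        push_cast
        rw [← sub_eq_iff_eq_add', eq_div_iff hr'.ne']
        linear_combination h2 + h3 - hdivR
      have hG : 0 < (r : ℝ) / (t - 1) + r / (r - t - 2) := by
        have : 0 < (r : ℝ) / (t - 1) := div_pos hr' (by linarith)
        have : 0 < (r : ℝ) / (r - t - 2) := div_pos hr' (by linarith)
        linarith
      have ht1 : 0 < (r : ℝ) / (t - 1) := div_pos hr' (by linarith)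
      have ht2' : 0 < (r : ℝ) / (r - t - 2) := div_pos hr' (by linarith)
      have hu1 : 1 / ((r : ℝ) / (t - 1) + r / (r - t - 2)) ≤ (t - 1) / r := by
        rw [← one_div_div (r : ℝ)]
        exact one_div_le_one_div_of_le ht1 (by linarith)
      have hu2 : 1 / ((r : ℝ) / (t - 1) + r / (r - t - 2)) ≤ (r - t - 2) / r := by
        rw [← one_div_div (r : ℝ) (r - t - 2)]
        exact one_div_le_one_div_of_le ht2' (by linarith)
      have hu := nd_ge hrz (by linarith) (by linarith) hx hu1 hu2
      by_contra! hcon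
      have h4 := hF2 (j₀ + i)
      have h5 : 1 < F (j₀ + i) * nd ((j₀ + i : ℕ) * α) := by
        calc 1 = ((r : ℝ) / (t - 1) + r / (r - t - 2)) *
              (1 / ((r : ℝ) / (t - 1) + r / (r - t - 2))) :=
            (mul_one_div_cancel hG.ne').symm
          _ < F (j₀ + i) * (1 / ((r : ℝ) / (t - 1) + r / (r - t - 2))) := by gcongr
          _ ≤ _ := by gcongr; exact hG.le.trans hcon.le
      linarith
  have hinj : Set.InjOn τ (Finset.range r) := fun i hi i' hi' h ↦ by
    rw [Finset.coe_range, Set.mem_Iio] at hi hi'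
    have h1 : (s + i * b) % (r : ℤ) = (s + i' * b) % r := by
      rw [← hτz, ← hτz, h]
    have h2 : (r : ℤ) ∣ ((i : ℤ) - i') * b := by
      have h3 := Int.dvd_of_emod_eq_zero (Int.emod_eq_emod_iff_emod_sub_eq_zero.1 h1)
      rwa [show s + (i : ℤ) * b - (s + i' * b) = ((i : ℤ) - i') * b by ring] at h3
    have h4 : (r : ℤ) ∣ (i : ℤ) - i' := hb.symm.dvd_of_dvd_mul_right h2
    have h5 := Int.eq_zero_of_abs_lt_dvd h4 (by rw [abs_lt]; omega)
    omega
  refine (Finset.sum_le_sum hpt).trans ?_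
  rw [← Finset.sum_image (f := slot r Y) hinj]
  refine le_trans (Finset.sum_le_sum_of_subset_of_nonneg (t := Finset.range r) ?_ ?_)
    (sum_slot_le hr hY)
  · intro t ht
    obtain ⟨i, -, rfl⟩ := Finset.mem_image.1 ht
    exact Finset.mem_range.2 (hτlt i)
  · intro t ht _
    unfold slot
    split_ifs with h
    · exact hY
    · push Not at h
      have ht2 : (2 : ℝ) ≤ t := by exact_mod_cast h.1
      have htr : (t : ℝ) + 3 ≤ r := by exact_mod_cast h.2
      exact add_nonneg (div_nonneg hr'.le (by linarith)) (div_nonneg hr'.le (by linarith))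

lemma sum_range_le_blocks {r : ℕ} {b : ℤ} {α Y : ℝ} (hr : 0 < r) (hb : IsCoprime b (r : ℤ))
    (hα : |α - b / r| ≤ 1 / (r : ℝ) ^ 2) (hY : 0 ≤ Y) {F : ℕ → ℝ} (hF0 : ∀ j, 0 ≤ F j)
    (hF : ∀ j, F j ≤ Y) (hF2 : ∀ j, F j * nd (j * α) ≤ 1) (J : ℕ) :
    ∑ j ∈ Finset.range J, F j ≤ (J / r + 1) * (4 * Y + 2 * (r * (1 + Real.log r))) := by
  have hr' : (0 : ℝ) < r := by exact_mod_cast hr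
  have hr1 : (1 : ℝ) ≤ r := by exact_mod_cast hr
  have hlog := Real.log_nonneg hr1
  have h1 : ∀ k : ℕ, ∑ j ∈ Finset.range (k * r), F j ≤
      k * (4 * Y + 2 * (r * (1 + Real.log r))) := fun k ↦ by
    induction k with
    | zero => simp
    | succ k ih =>
      rw [Nat.succ_mul, Finset.sum_range_add]
      have := block_sum_le hr hb hα hY hF hF2 (k * r)
      push_cast; linarith
  have h2 : ∑ j ∈ Finset.range J, F j ≤ ∑ j ∈ Finset.range ((J / r + 1) * r), F j := by
    refine Finset.sum_le_sum_of_subset_of_nonneg ?_ fun _ _ _ ↦ hF0 _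
    refine Finset.range_subset_range.2 ?_
    have := Nat.div_add_mod J r
    have := Nat.mod_lt J hr
    nlinarith
  refine h2.trans ((h1 _).trans ?_)
  have h3 : ((J / r + 1 : ℕ) : ℝ) ≤ J / r + 1 := by
    push_cast
    gcongr
    exact Nat.cast_div_le
  gcongr

end Spacing

section Vaughan

lemma sum_mul_twist (f g : ArithmeticFunction ℂ) (e : ℕ → ℂ) (N : ℕ) :
    ∑ n ∈ Finset.Icc 1 N, (f * g) n * e n =
      ∑ k ∈ Finset.Icc 1 N, f k * ∑ l ∈ Finset.Icc 1 (N / k), g l * e (k * l) := by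
  have h1 : ∀ n ∈ Finset.Icc 1 N, (f * g) n * e n =
      ∑ p ∈ (Finset.Ioc 0 N ×ˢ Finset.Ioc 0 N).filter (fun p ↦ p.1 * p.2 = n),
        f p.1 * (g p.2 * e (p.1 * p.2)) := fun n hn ↦ by
    rw [Finset.mem_Icc] at hn
    rw [ArithmeticFunction.mul_apply, Nat.divisorsAntidiagonal_eq_prod_filter_of_le (by omega) hn.2,
      Finset.sum_mul]
    refine Finset.sum_congr rfl fun p hp ↦ ?_
    rw [(Finset.mem_filter.1 hp).2, mul_assoc]
  rw [Finset.sum_congr rfl h1]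
  simp_rw [Finset.sum_filter]
  rw [Finset.sum_comm, Finset.sum_product]
  refine Finset.sum_congr (by ext; simp [Nat.lt_iff_add_one_le]) fun k hk ↦ ?_
  rw [Finset.mem_Icc] at hk
  rw [Finset.mul_sum]
  have h2 : ∀ l ∈ Finset.Ioc 0 N, (∑ n ∈ Finset.Icc 1 N,
      if k * l = n then f k * (g l * e (k * l)) else 0) =
      if k * l ≤ N then f k * (g l * e (k * l)) else 0 := fun l hl ↦ by
    rw [Finset.sum_ite_eq]
    rw [Finset.mem_Ioc] at hl
    have : 1 ≤ k * l := Nat.mul_pos hk.1 hl.1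
    simp [this]
  rw [Finset.sum_congr rfl h2, ← Finset.sum_filter]
  refine Finset.sum_congr ?_ fun _ _ ↦ rfl
  ext l
  rw [Finset.mem_filter, Finset.mem_Ioc, Finset.mem_Icc, Nat.le_div_iff_mul_le hk.1, mul_comm k l]
  constructor
  · rintro ⟨h, hle⟩; exact ⟨h.1, hle⟩
  · rintro ⟨h, hle⟩; exact ⟨⟨h, le_trans (Nat.le_mul_of_pos_right _ hk.1) hle⟩, hle⟩

/-- The Möbius function restricted to `[1, U]`. -/
noncomputable def muLow (U : ℕ) : ArithmeticFunction ℂ :=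
  ⟨fun n ↦ if n ≤ U then (ArithmeticFunction.moebius n : ℂ) else 0, by simp⟩

/-- The Möbius function restricted to `(U, ∞)`. -/
noncomputable def muHigh (U : ℕ) : ArithmeticFunction ℂ :=
  ⟨fun n ↦ if n ≤ U then 0 else (ArithmeticFunction.moebius n : ℂ), by simp⟩

lemma muLow_apply (U n : ℕ) :
    muLow U n = if n ≤ U then (ArithmeticFunction.moebius n : ℂ) else 0 := rfl

lemma muHigh_apply (U n : ℕ) :
    muHigh U n = if n ≤ U then 0 else (ArithmeticFunction.moebius n : ℂ) := rfl

lemma norm_muLow_le (U n : ℕ) : ‖muLow U n‖ ≤ 1 := by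
  rw [muLow_apply]; split_ifs
  · exact norm_moebius_le n
  · simp

lemma norm_muHigh_le (U n : ℕ) : ‖muHigh U n‖ ≤ 1 := by
  rw [muHigh_apply]; split_ifs
  · simp
  · exact norm_moebius_le n

lemma vaughan (U : ℕ) : ((ArithmeticFunction.moebius : ArithmeticFunction ℤ) :
    ArithmeticFunction ℂ) = 2 * muLow U -
      muLow U * muLow U * ((ArithmeticFunction.zeta : ArithmeticFunction ℕ) : ArithmeticFunction ℂ) +
      (muHigh U * ((ArithmeticFunction.zeta : ArithmeticFunction ℕ) : ArithmeticFunction ℂ)) *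
        muHigh U := by
  have h1 : muHigh U = ((ArithmeticFunction.moebius : ArithmeticFunction ℤ) :
      ArithmeticFunction ℂ) - muLow U := by
    ext n
    rw [sub_eq_add_neg, ArithmeticFunction.add_apply, ArithmeticFunction.neg_apply, muHigh_apply,
      muLow_apply, ArithmeticFunction.intCoe_apply]
    split_ifs <;> simp
  have h2 := ArithmeticFunction.coe_moebius_mul_coe_zeta (R := ℂ)
  rw [h1]
  linear_combination (2 * muLow U - ((ArithmeticFunction.moebius : ArithmeticFunction ℤ) :
      ArithmeticFunction ℂ)) * h2

/-- The coefficients `∑_{d ∣ n, d > U} μ(d)`. -/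
noncomputable def cHigh (U : ℕ) : ArithmeticFunction ℂ :=
  muHigh U * ((ArithmeticFunction.zeta : ArithmeticFunction ℕ) : ArithmeticFunction ℂ)

lemma cHigh_apply (U n : ℕ) : cHigh U n = ∑ d ∈ n.divisors, muHigh U d := by
  rw [cHigh, ArithmeticFunction.coe_mul_zeta_apply]

lemma cHigh_eq_zero {U n : ℕ} (h : n ≤ U) : cHigh U n = 0 := by
  rw [cHigh_apply]
  refine Finset.sum_eq_zero fun d hd ↦ ?_
  rw [muHigh_apply, if_pos ((Nat.divisor_le hd).trans h)]

lemma norm_cHigh_le (U n : ℕ) : ‖cHigh U n‖ ≤ n.divisors.card := by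
  rw [cHigh_apply]
  refine (norm_sum_le_of_le (n := fun _ ↦ (1 : ℝ)) _ fun d _ ↦ norm_muHigh_le U d).trans_eq ?_
  simp

/-- The coefficients of the type I sum. -/
noncomputable def cLow (U : ℕ) : ArithmeticFunction ℂ := muLow U * muLow U

lemma cLow_eq_zero {U n : ℕ} (h : U ^ 2 < n) : cLow U n = 0 := by
  rw [cLow, ArithmeticFunction.mul_apply]
  refine Finset.sum_eq_zero fun p hp ↦ ?_
  rw [Nat.mem_divisorsAntidiagonal] at hp
  rw [muLow_apply, muLow_apply]
  split_ifs with h1 h2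
  · exfalso
    have := Nat.mul_le_mul h1 h2
    nlinarith [hp.1]
  all_goals simp

lemma norm_cLow_le (U n : ℕ) : ‖cLow U n‖ ≤ n := by
  rw [cLow, ArithmeticFunction.mul_apply]
  refine (norm_sum_le_of_le (n := fun _ ↦ (1 : ℝ)) _ fun p _ ↦ ?_).trans ?_
  · rw [norm_mul]
    exact mul_le_one₀ (norm_muLow_le _ _) (norm_nonneg _) (norm_muLow_le _ _)
  · rw [Finset.sum_const, nsmul_one, Nat.cast_le, ← Nat.map_div_right_divisors, Finset.card_map]
    exact Nat.card_divisors_le_self n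

lemma sum_moebius_vaughan (U : ℕ) (e : ℕ → ℂ) (N : ℕ) :
    ∑ n ∈ Finset.Icc 1 N, (ArithmeticFunction.moebius n : ℂ) * e n =
      2 * ∑ n ∈ Finset.Icc 1 N, muLow U n * e n -
      ∑ k ∈ Finset.Icc 1 N, cLow U k * ∑ l ∈ Finset.Icc 1 (N / k), e (k * l) +
      ∑ k ∈ Finset.Icc 1 N, cHigh U k * ∑ l ∈ Finset.Icc 1 (N / k), muHigh U l * e (k * l) := by
  have h1 : ∀ n ∈ Finset.Icc 1 N, (ArithmeticFunction.moebius n : ℂ) * e n =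
      2 * (muLow U n * e n) - (cLow U * ((ArithmeticFunction.zeta : ArithmeticFunction ℕ) :
        ArithmeticFunction ℂ)) n * e n + (cHigh U * muHigh U) n * e n := fun n _ ↦ by
    have h2 := DFunLike.congr_fun (vaughan U) n
    rw [ArithmeticFunction.intCoe_apply] at h2
    rw [h2, cLow, cHigh, sub_eq_add_neg, ArithmeticFunction.add_apply, ArithmeticFunction.add_apply,
      ArithmeticFunction.neg_apply, two_mul, ArithmeticFunction.add_apply]
    ring
  rw [Finset.sum_congr rfl h1, Finset.sum_add_distrib, Finset.sum_sub_distrib, ← Finset.mul_sum,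
    sum_mul_twist, sum_mul_twist]
  congr 2
  refine Finset.sum_congr rfl fun k _ ↦ ?_
  congr 1
  refine Finset.sum_congr rfl fun l hl ↦ ?_
  rw [Finset.mem_Icc] at hl
  rw [ArithmeticFunction.natCoe_apply, ArithmeticFunction.zeta_apply, if_neg (by omega)]
  simp

lemma sum_one_div_le (N : ℕ) : ∑ k ∈ Finset.Icc 1 N, (1 : ℝ) / k ≤ 1 + Real.log N := by
  have h2 := harmonic_le_one_add_log N
  rw [harmonic_eq_sum_Icc] at h2
  push_cast at h2
  simpa [one_div] using h2

lemma sum_divisors_sq_div_le (N : ℕ) :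
    ∑ l ∈ Finset.Icc 1 N, (l.divisors.card : ℝ) ^ 2 / l ≤ (1 + Real.log N) ^ 4 := by
  set I := Finset.Icc 1 N with hI
  set S : Finset (ℕ × ℕ × ℕ) := (I ×ˢ I ×ˢ I).filter (fun p ↦ p.2.1 ∣ p.1 ∧ p.2.2 ∣ p.1) with hS
  have h1 : ∑ l ∈ I, (l.divisors.card : ℝ) ^ 2 / l = ∑ p ∈ S, (1 : ℝ) / p.1 := by
    rw [hS, Finset.sum_filter, Finset.sum_product]
    refine Finset.sum_congr rfl fun l hl ↦ ?_
    rw [hI, Finset.mem_Icc] at hl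
    have h2 : l.divisors = I.filter (· ∣ l) := by
      ext d
      rw [Nat.mem_divisors, Finset.mem_filter, hI, Finset.mem_Icc]
      constructor
      · rintro ⟨h, -⟩
        have := Nat.le_of_dvd (by omega) h
        exact ⟨⟨Nat.pos_of_dvd_of_pos h (by omega), by omega⟩, h⟩
      · rintro ⟨-, h⟩; exact ⟨h, by omega⟩
    have h3 : (I ×ˢ I).filter (fun p ↦ p.1 ∣ l ∧ p.2 ∣ l) = l.divisors ×ˢ l.divisors := by
      rw [h2, ← Finset.filter_product]
    rw [← Finset.sum_filter]
    simp only
    rw [h3, Finset.sum_const, nsmul_eq_mul, Finset.card_product]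
    push_cast; ring
  rw [h1]
  set T : Finset (ℕ × ℕ × ℕ × ℕ) := I ×ˢ I ×ˢ I ×ˢ I with hT
  set φ : ℕ × ℕ × ℕ → ℕ × ℕ × ℕ × ℕ := fun p ↦ (Nat.gcd p.2.1 p.2.2, p.2.1 / Nat.gcd p.2.1 p.2.2,
    p.2.2 / Nat.gcd p.2.1 p.2.2, p.1 / Nat.lcm p.2.1 p.2.2) with hφ
  have hfac : ∀ p ∈ S, p.2.1 = (φ p).1 * (φ p).2.1 ∧ p.2.2 = (φ p).1 * (φ p).2.2.1 ∧
      p.1 = (φ p).1 * (φ p).2.1 * (φ p).2.2.1 * (φ p).2.2.2 ∧ 1 ≤ p.1 ∧ p.1 ≤ N := fun p hp ↦ by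
    obtain ⟨l, a, b⟩ := p
    simp only [hS, hI, Finset.mem_filter, Finset.mem_product, Finset.mem_Icc] at hp
    obtain ⟨⟨hl, ha, hb⟩, hal, hbl⟩ := hp
    have hga := Nat.gcd_dvd_left a b
    have hgb := Nat.gcd_dvd_right a b
    have h3 : a = Nat.gcd a b * (a / Nat.gcd a b) := (Nat.mul_div_cancel' hga).symm
    have h4 : b = Nat.gcd a b * (b / Nat.gcd a b) := (Nat.mul_div_cancel' hgb).symm
    refine ⟨h3, h4, ?_, hl⟩
    have h5 : Nat.lcm a b = Nat.gcd a b * (a / Nat.gcd a b) * (b / Nat.gcd a b) := by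
      rw [← h3, Nat.lcm, Nat.mul_div_assoc _ hgb]
    have h6 := Nat.mul_div_cancel' (Nat.lcm_dvd hal hbl)
    simp only [hφ]
    rw [← h5, h6]
  have hinj : Set.InjOn φ S := fun p hp q hq h ↦ by
    obtain ⟨h1, h2, h3, -⟩ := hfac p hp
    obtain ⟨h1', h2', h3', -⟩ := hfac q hq
    refine Prod.ext ?_ (Prod.ext ?_ ?_)
    · rw [h3, h3', h]
    · rw [h1, h1', h]
    · rw [h2, h2', h]
  have h2 : ∑ p ∈ S, (1 : ℝ) / p.1 = ∑ q ∈ S.image φ, 1 / (q.1 * q.2.1 * q.2.2.1 * q.2.2.2 : ℝ) := by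
    rw [Finset.sum_image hinj]
    refine Finset.sum_congr rfl fun p hp ↦ ?_
    obtain ⟨-, -, h3, -⟩ := hfac p hp
    nth_rewrite 1 [h3]
    push_cast; rfl
  have h3 : S.image φ ⊆ T := fun q hq ↦ by
    obtain ⟨p, hp, rfl⟩ := Finset.mem_image.1 hq
    obtain ⟨-, -, h3, h4, h5⟩ := hfac p hp
    rw [h3] at h4 h5
    set q := φ p
    have hdvd : ∀ d, d ∣ q.1 * q.2.1 * q.2.2.1 * q.2.2.2 → d ∈ I := fun d hd ↦ by
      have := Nat.le_of_dvd (by omega) hd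
      have := Nat.pos_of_dvd_of_pos hd (by omega)
      rw [hI, Finset.mem_Icc]; omega
    simp only [hT, Finset.mem_product]
    refine ⟨hdvd _ ⟨q.2.1 * q.2.2.1 * q.2.2.2, by ring⟩, hdvd _ ⟨q.1 * q.2.2.1 * q.2.2.2, by ring⟩,
      hdvd _ ⟨q.1 * q.2.1 * q.2.2.2, by ring⟩, hdvd _ ⟨q.1 * q.2.1 * q.2.2.1, by ring⟩⟩
  rw [h2]
  refine (Finset.sum_le_sum_of_subset_of_nonneg h3 fun _ _ _ ↦ by positivity).trans ?_
  have h4 : ∑ q ∈ T, 1 / (q.1 * q.2.1 * q.2.2.1 * q.2.2.2 : ℝ) = (∑ k ∈ I, (1 : ℝ) / k) ^ 4 := by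
    rw [hT]
    simp_rw [Finset.sum_product]
    rw [show ∀ x : ℝ, x ^ 4 = x * (x * (x * x)) by intro x; ring]
    simp_rw [Finset.sum_mul, Finset.mul_sum]
    refine Finset.sum_congr rfl fun a _ ↦ Finset.sum_congr rfl fun b _ ↦ ?_
    refine Finset.sum_congr rfl fun c _ ↦ Finset.sum_congr rfl fun d _ ↦ ?_
    simp only [one_div, mul_inv, mul_assoc]
  rw [h4]
  have := sum_one_div_le N
  have : 0 ≤ ∑ k ∈ I, (1 : ℝ) / k := Finset.sum_nonneg fun _ _ ↦ by positivity
  gcongr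

end Vaughan

section MinorArcs

lemma sum_ee_mul_eq (k M : ℕ) (α : ℝ) :
    ∑ l ∈ Finset.Icc 1 M, ee ((k * l : ℕ) * α) = ∑ l ∈ Finset.Ico 1 (M + 1), ee (k * α) ^ l := by
  refine Finset.sum_congr (by ext; simp) fun l _ ↦ ?_
  rw [← ee_nat_mul]
  push_cast; ring_nf

lemma nd_mul_ge {r j : ℕ} {b : ℤ} {α : ℝ} (hb : IsCoprime b (r : ℤ))
    (hα : |α - b / r| ≤ 1 / (r : ℝ) ^ 2) (hj : 1 ≤ j) (hjr : 2 * j ≤ r) :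
    1 / (2 * r) ≤ nd (j * α) := by
  have hr : 0 < r := by omega
  have hr' : (0 : ℝ) < r := by exact_mod_cast hr
  rw [nd]
  set m := round (j * α)
  have h1 : (1 : ℝ) ≤ |((j * b - m * r : ℤ) : ℝ)| := by
    have h2 : (j * b - m * r : ℤ) ≠ 0 := by
      intro h
      have h3 : (r : ℤ) ∣ j * b := ⟨m, by linarith⟩
      have h4 := hb.symm.dvd_of_dvd_mul_right h3
      have h5 := Nat.le_of_dvd (by omega) (Int.natCast_dvd_natCast.1 h4)
      omega
    exact_mod_cast Int.one_le_abs h2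
  have h2 : ((j * b - m * r : ℤ) : ℝ) = r * (j * α - m) - r * (j * (α - b / r)) := by
    push_cast; field_simp; ring
  have h3 : |(r : ℝ) * (j * (α - b / r))| ≤ 1 / 2 := by
    rw [abs_mul, abs_mul, Nat.abs_cast, Nat.abs_cast]
    have hj' : 2 * (j : ℝ) ≤ r := by exact_mod_cast hjr
    calc (r : ℝ) * (j * |α - b / r|) ≤ r * ((r / 2) * (1 / (r : ℝ) ^ 2)) := by
          gcongr; linarith
      _ = 1 / 2 := by field_simp
  rw [h2] at h1
  have h4 := h1.trans (abs_sub _ _)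
  rw [abs_mul (r : ℝ), Nat.abs_cast] at h4
  rw [div_le_iff₀ (by positivity)]
  linarith

lemma type_one_bound {U r : ℕ} {b : ℤ} {α : ℝ} (hb : IsCoprime b (r : ℤ)) (hr : 0 < r)
    (hα : |α - b / r| ≤ 1 / (r : ℝ) ^ 2) (hU : 2 * U ^ 2 ≤ r) (N : ℕ) :
    ‖∑ k ∈ Finset.Icc 1 N, cLow U k * ∑ l ∈ Finset.Icc 1 (N / k), ee ((k * l : ℕ) * α)‖ ≤
      U ^ 4 * r := by
  have hr' : (0 : ℝ) < r := by exact_mod_cast hr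
  have h1 : ∀ k ∈ Finset.Icc 1 N, ‖cLow U k * ∑ l ∈ Finset.Icc 1 (N / k), ee ((k * l : ℕ) * α)‖ ≤
      if k ∈ Finset.Icc 1 (U ^ 2) then (U : ℝ) ^ 2 * r else 0 := fun k hk ↦ by
    rw [Finset.mem_Icc] at hk
    split_ifs with h
    · rw [Finset.mem_Icc] at h
      rw [norm_mul]
      have h2 : ‖cLow U k‖ ≤ (U : ℝ) ^ 2 := (norm_cLow_le U k).trans (by exact_mod_cast h.2)
      have h3 := norm_geom_le (k * α) (a := 1) (b := N / k + 1) (Nat.le_add_left _ _)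
      have h4 := nd_mul_ge hb hα hk.1 (by omega)
      rw [sum_ee_mul_eq]
      gcongr
      set x := ‖∑ l ∈ Finset.Ico 1 (N / k + 1), ee (k * α) ^ l‖
      have h5 : x * (1 / (2 * r)) ≤ 1 / 2 := by
        refine le_trans ?_ h3
        gcongr
      have h6 : x * (1 / (2 * r)) = x / r / 2 := by field_simp
      rw [h6] at h5
      exact (div_le_one hr').1 (by linarith)
    · rw [cLow_eq_zero, zero_mul, norm_zero]
      rw [Finset.mem_Icc] at h
      omega
  refine (norm_sum_le_of_le _ h1).trans ?_
  rw [Finset.sum_ite_mem]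
  refine (Finset.sum_le_sum_of_subset_of_nonneg Finset.inter_subset_right
    fun _ _ _ ↦ by positivity).trans_eq ?_
  simp; ring

lemma nd_neg (θ : ℝ) : nd (-θ) = nd θ := by
  unfold nd
  refine le_antisymm ?_ ?_
  · refine (round_le (-θ) (-round θ)).trans_eq ?_
    rw [← abs_neg]; push_cast; ring_nf
  · refine (round_le θ (-round (-θ))).trans_eq ?_
    rw [← abs_neg]; push_cast; ring_nf

lemma kern_neg (Y θ : ℝ) : kern Y (-θ) = kern Y θ := by
  unfold kern; rw [nd_neg]

/-- Opening the square in the bilinear sum. -/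
lemma sum_mul_norm_sq_le (β : ℕ → ℂ) (hβ : ∀ k, ‖β k‖ ≤ 1) (α : ℝ) (N : ℕ) (s : Finset ℕ)
    (hs : ∀ k ∈ s, 1 ≤ k) :
    ∑ l ∈ Finset.Icc 1 N, (l : ℝ) *
      ‖∑ k ∈ s.filter (fun k ↦ k * l ≤ N), β k * ee (k * l * α)‖ ^ 2 ≤
      ∑ k ∈ s, ∑ k' ∈ s, (min (N / k) (N / k') : ℕ) *
        kern (min (N / k) (N / k') : ℕ) (((k : ℝ) - k') * α) := by
  have h1 : ∀ l ∈ Finset.Icc 1 N, (((l : ℝ) *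
      ‖∑ k ∈ s.filter (fun k ↦ k * l ≤ N), β k * ee (k * l * α)‖ ^ 2 : ℝ) : ℂ) =
      ∑ k ∈ s, ∑ k' ∈ s, β k * (starRingEnd ℂ) (β k') *
        if l ∈ Finset.Icc 1 (min (N / k) (N / k')) then
          (l : ℂ) * ee (((k : ℝ) - k') * α) ^ l else 0 := fun l hl ↦ by
    rw [Finset.mem_Icc] at hl
    push_cast
    rw [← Complex.mul_conj', map_sum, Finset.sum_filter, Finset.sum_filter, Finset.sum_mul_sum,
      Finset.mul_sum]
    refine Finset.sum_congr rfl fun k hk ↦ ?_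
    rw [Finset.mul_sum]
    refine Finset.sum_congr rfl fun k' hk' ↦ ?_
    have e1 : k * l ≤ N ↔ l ≤ N / k := by rw [Nat.le_div_iff_mul_le (hs k hk), mul_comm]
    have e2 : k' * l ≤ N ↔ l ≤ N / k' := by rw [Nat.le_div_iff_mul_le (hs k' hk'), mul_comm]
    have e3 : l ∈ Finset.Icc 1 (min (N / k) (N / k')) ↔ k * l ≤ N ∧ k' * l ≤ N := by
      rw [Finset.mem_Icc, e1, e2]; omega
    by_cases c1 : k * l ≤ N
    · by_cases c2 : k' * l ≤ N
      · rw [if_pos c1, if_pos c2, if_pos (e3.2 ⟨c1, c2⟩), map_mul, conj_ee, ← ee_nat_mul]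
        have : ee (l * (((k : ℝ) - k') * α)) = ee (k * l * α) * ee (-(k' * l * α)) := by
          rw [← ee_add]; ring_nf
        rw [this]; ring
      · rw [if_neg c2, if_neg (fun h ↦ c2 (e3.1 h).2)]; simp
    · rw [if_neg c1, if_neg (fun h ↦ c1 (e3.1 h).1)]; simp
  have h2 : ((∑ l ∈ Finset.Icc 1 N, (l : ℝ) *
      ‖∑ k ∈ s.filter (fun k ↦ k * l ≤ N), β k * ee (k * l * α)‖ ^ 2 : ℝ) : ℂ) =
      ∑ k ∈ s, ∑ k' ∈ s, β k * (starRingEnd ℂ) (β k') *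
        ∑ l ∈ Finset.Icc 1 (min (N / k) (N / k')), (l : ℂ) * ee (((k : ℝ) - k') * α) ^ l := by
    rw [ofReal_sum, Finset.sum_congr rfl h1, Finset.sum_comm]
    refine Finset.sum_congr rfl fun k hk ↦ ?_
    rw [Finset.sum_comm]
    refine Finset.sum_congr rfl fun k' hk' ↦ ?_
    rw [← Finset.mul_sum, Finset.sum_ite_mem]
    congr 2
    rw [Finset.inter_eq_right]
    intro l hl
    rw [Finset.mem_Icc] at hl ⊢
    have := Nat.div_le_self N k
    omega
  refine (le_abs_self _).trans ?_
  rw [← Real.norm_eq_abs, ← Complex.norm_real, h2]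
  refine norm_sum_le_of_le _ fun k _ ↦ norm_sum_le_of_le _ fun k' _ ↦ ?_
  rw [norm_mul, norm_mul, RCLike.norm_conj]
  have h3 := norm_weighted_geom_le (((k : ℝ) - k') * α) (min (N / k) (N / k'))
  have h4 : ‖β k‖ * ‖β k'‖ ≤ 1 := mul_le_one₀ (hβ k) (norm_nonneg _) (hβ k')
  exact (mul_le_mul h4 h3 (norm_nonneg _) zero_le_one).trans_eq (one_mul _)

lemma sum_sum_symm_le {s : Finset ℕ} {G : ℕ → ℕ → ℝ} (hG : ∀ k k', G k k' = G k' k)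
    (hG0 : ∀ k k', 0 ≤ G k k') :
    ∑ k ∈ s, ∑ k' ∈ s, G k k' ≤ 2 * ∑ k ∈ s, ∑ k' ∈ s.filter (· ≤ k), G k k' := by
  have h1 : ∑ k ∈ s, ∑ k' ∈ s, G k k' ≤
      ∑ k ∈ s, (∑ k' ∈ s.filter (· ≤ k), G k k' + ∑ k' ∈ s.filter (k ≤ ·), G k k') := by
    gcongr with k hk
    rw [Finset.sum_filter, Finset.sum_filter, ← Finset.sum_add_distrib]
    gcongr with k' hk'
    have := hG0 k k'
    split_ifs <;> first | omega | linarith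
  have h2 : ∑ k ∈ s, ∑ k' ∈ s.filter (k ≤ ·), G k k' = ∑ k ∈ s, ∑ k' ∈ s.filter (· ≤ k), G k k' := by
    simp_rw [Finset.sum_filter]
    rw [Finset.sum_comm]
    refine Finset.sum_congr rfl fun k _ ↦ Finset.sum_congr rfl fun k' _ ↦ ?_
    rw [hG]
  rw [Finset.sum_add_distrib, h2] at h1
  linarith

lemma bilinear_sum_le {U r N : ℕ} {b : ℤ} {α : ℝ} (hb : IsCoprime b (r : ℤ)) (hU : 1 ≤ U)
    (hα : |α - b / r| ≤ 1 / (r : ℝ) ^ 2) (hUr : U ≤ r) (hrN : r * U ≤ N) :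
    ∑ k ∈ Finset.Ioc U (N / U), ∑ k' ∈ Finset.Ioc U (N / U), (min (N / k) (N / k') : ℕ) *
        kern (min (N / k) (N / k') : ℕ) (((k : ℝ) - k') * α) ≤
      24 * (1 + Real.log N) ^ 2 * N ^ 2 / U := by
  have hr : 0 < r := by omega
  have hr' : (0 : ℝ) < r := by exact_mod_cast hr
  have hU' : (0 : ℝ) < U := by exact_mod_cast hU
  have hUr' : (U : ℝ) ≤ r := by exact_mod_cast hUr
  have hrN' : (r : ℝ) * U ≤ N := by exact_mod_cast hrN
  have hN1 : 1 ≤ N := le_trans (Nat.mul_pos hr hU) hrN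
  have hN1' : (1 : ℝ) ≤ N := by exact_mod_cast hN1
  have hL := Real.log_nonneg hN1'
  set L := Real.log N
  have hlr : Real.log r ≤ L := by
    refine Real.log_le_log hr' ?_
    have : r ≤ N := le_trans (Nat.le_mul_of_pos_right _ hU) hrN
    exact_mod_cast this
  refine (sum_sum_symm_le (G := fun k k' ↦ (min (N / k) (N / k') : ℕ) *
        kern (min (N / k) (N / k') : ℕ) (((k : ℝ) - k') * α)) (fun k k' ↦ ?_) fun k k' ↦ ?_).trans ?_
  · rw [min_comm, ← kern_neg]; ring_nf
  · exact mul_nonneg (Nat.cast_nonneg _) (kern_nonneg (Nat.cast_nonneg _))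
  have h1 : ∀ k ∈ Finset.Ioc U (N / U), ∑ k' ∈ (Finset.Ioc U (N / U)).filter (· ≤ k),
      ((min (N / k) (N / k') : ℕ) : ℝ) * kern (min (N / k) (N / k') : ℕ) (((k : ℝ) - k') * α) ≤
      (4 * N ^ 2 / r + 4 * N ^ 2 / U + 2 * N * r * (1 + L)) * (1 / k) + 2 * N * (1 + L) :=
      fun k hk ↦ by
    rw [Finset.mem_Ioc] at hk
    have hk0 : 0 < k := by omega
    have hk' : (0 : ℝ) < k := by exact_mod_cast hk0
    have hkU : (U : ℝ) ≤ k := by exact_mod_cast hk.1.le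
    set Y : ℝ := ((N / k : ℕ) : ℝ) with hY
    have hY0 : 0 ≤ Y := Nat.cast_nonneg _
    have hYle : Y ≤ N / k := Nat.cast_div_le
    have h2 : ∑ k' ∈ (Finset.Ioc U (N / U)).filter (· ≤ k),
        ((min (N / k) (N / k') : ℕ) : ℝ) * kern (min (N / k) (N / k') : ℕ) (((k : ℝ) - k') * α) ≤
        ∑ j ∈ Finset.range k, Y * kern Y (j * α) := by
      have h3 : ∀ k' ∈ (Finset.Ioc U (N / U)).filter (· ≤ k),
          ((min (N / k) (N / k') : ℕ) : ℝ) * kern (min (N / k) (N / k') : ℕ) (((k : ℝ) - k') * α) =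
          Y * kern Y ((k - k' : ℕ) * α) := fun k' hk' ↦ by
        rw [Finset.mem_filter, Finset.mem_Ioc] at hk'
        have : N / k ≤ N / k' := Nat.div_le_div_left hk'.2 (by omega)
        rw [min_eq_left this, Nat.cast_sub hk'.2]
      rw [Finset.sum_congr rfl h3]
      rw [← Finset.sum_image (s := (Finset.Ioc U (N / U)).filter (· ≤ k)) (g := fun k' ↦ k - k')
        (f := fun j : ℕ ↦ Y * kern Y (j * α))]
      · refine Finset.sum_le_sum_of_subset_of_nonneg ?_
          fun _ _ _ ↦ mul_nonneg hY0 (kern_nonneg hY0)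
        intro j hj
        obtain ⟨k', hk', rfl⟩ := Finset.mem_image.1 hj
        rw [Finset.mem_filter, Finset.mem_Ioc] at hk'
        rw [Finset.mem_range]; omega
      · intro x hx y hy h
        have hx' := (Finset.mem_filter.1 hx).2
        have hy' := (Finset.mem_filter.1 hy).2
        simp only at h hx' hy'
        omega
    refine h2.trans ?_
    rw [← Finset.mul_sum]
    have h4 := sum_range_le_blocks hr hb hα hY0 (F := fun j ↦ kern Y (j * α))
      (fun _ ↦ kern_nonneg hY0) (fun _ ↦ kern_le) (fun _ ↦ kern_mul_nd_le) k
    have h5 : ∑ j ∈ Finset.range k, kern Y (j * α) ≤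
        (k / r + 1) * (4 * (N / k) + 2 * (r * (1 + L))) := by
      refine h4.trans ?_
      gcongr
    calc Y * ∑ j ∈ Finset.range k, kern Y (j * α) ≤
          (N / k) * ((k / r + 1) * (4 * (N / k) + 2 * (r * (1 + L)))) :=
          mul_le_mul hYle h5 (Finset.sum_nonneg fun _ _ ↦ kern_nonneg hY0) (by positivity)
      _ = (4 * N ^ 2 / r + 4 * N ^ 2 / k + 2 * N * r * (1 + L)) * (1 / k) + 2 * N * (1 + L) := by
          field_simp; ring
      _ ≤ _ := by gcongr
  have h6 : ∑ k ∈ Finset.Ioc U (N / U), (1 : ℝ) / k ≤ 1 + L := by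
    refine le_trans ?_ (sum_one_div_le N)
    refine Finset.sum_le_sum_of_subset_of_nonneg (fun k hk ↦ ?_) fun _ _ _ ↦ by positivity
    rw [Finset.mem_Ioc] at hk
    rw [Finset.mem_Icc]
    have := Nat.div_le_self N U
    omega
  have h7 : (((Finset.Ioc U (N / U)).card : ℕ) : ℝ) ≤ N / U := by
    rw [Nat.card_Ioc]
    refine le_trans ?_ (Nat.cast_div_le (m := N) (n := U))
    exact_mod_cast Nat.sub_le _ _
  have h8 : ∑ k ∈ Finset.Ioc U (N / U), ∑ k' ∈ (Finset.Ioc U (N / U)).filter (· ≤ k),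
      ((min (N / k) (N / k') : ℕ) : ℝ) * kern (min (N / k) (N / k') : ℕ) (((k : ℝ) - k') * α) ≤
      (4 * N ^ 2 / r + 4 * N ^ 2 / U + 2 * N * r * (1 + L)) * (1 + L) + N / U * (2 * N * (1 + L)) := by
    refine (Finset.sum_le_sum h1).trans ?_
    rw [Finset.sum_add_distrib, ← Finset.mul_sum, Finset.sum_const, nsmul_eq_mul]
    gcongr
  have h9 : (4 * N ^ 2 / r + 4 * N ^ 2 / U + 2 * N * r * (1 + L)) * (1 + L) +
      N / U * (2 * N * (1 + L)) ≤ 12 * (1 + L) ^ 2 * N ^ 2 / U := by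
    have e1 : (4 * N ^ 2 / r : ℝ) ≤ 4 * N ^ 2 / U * (1 + L) := by
      calc (4 * N ^ 2 / r : ℝ) ≤ 4 * N ^ 2 / U := by gcongr
        _ ≤ _ := le_mul_of_one_le_right (by positivity) (by linarith)
    have e2 : (4 * N ^ 2 / U : ℝ) ≤ 4 * N ^ 2 / U * (1 + L) :=
      le_mul_of_one_le_right (by positivity) (by linarith)
    have e3 : (2 * N * r * (1 + L) : ℝ) ≤ 2 * N ^ 2 / U * (1 + L) := by
      gcongr
      rw [le_div_iff₀ hU']
      nlinarith
    have e4 : (N / U * (2 * N * (1 + L)) : ℝ) ≤ 2 * N ^ 2 / U * (1 + L) * (1 + L) := by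
      calc (N / U * (2 * N * (1 + L)) : ℝ) = 2 * N ^ 2 / U * (1 + L) := by field_simp
        _ ≤ _ := le_mul_of_one_le_right (by positivity) (by linarith)
    calc _ ≤ (4 * N ^ 2 / U * (1 + L) + 4 * N ^ 2 / U * (1 + L) + 2 * N ^ 2 / U * (1 + L)) * (1 + L) +
          2 * N ^ 2 / U * (1 + L) * (1 + L) := by gcongr
      _ = _ := by ring
  calc _ ≤ 2 * (12 * (1 + L) ^ 2 * N ^ 2 / U : ℝ) := by gcongr; exact h8.trans h9
    _ = _ := by ring

end MinorArcs

section Davenport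

lemma type_two_bound {U r N : ℕ} {b : ℤ} {α : ℝ} (hb : IsCoprime b (r : ℤ)) (hU : 1 ≤ U)
    (hα : |α - b / r| ≤ 1 / (r : ℝ) ^ 2) (hUr : U ≤ r) (hrN : r * U ≤ N) :
    ‖∑ k ∈ Finset.Icc 1 N, cHigh U k * ∑ l ∈ Finset.Icc 1 (N / k),
      muHigh U l * ee ((k * l : ℕ) * α)‖ ≤ 5 * (1 + Real.log N) ^ 3 * N / √U := by
  have hU' : (0 : ℝ) < U := by exact_mod_cast hU
  have hN1 : 1 ≤ N := le_trans (Nat.mul_pos (by omega) hU) hrN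
  have hL := Real.log_nonneg (x := N) (by exact_mod_cast hN1)
  set L := Real.log N
  set s := Finset.Ioc U (N / U) with hs
  set W : ℕ → ℂ := fun k ↦ ∑ l ∈ s.filter (fun l ↦ l * k ≤ N), muHigh U l * ee (l * k * α) with hW
  have h1 : ∀ k ∈ Finset.Icc 1 N, ‖cHigh U k * ∑ l ∈ Finset.Icc 1 (N / k),
      muHigh U l * ee ((k * l : ℕ) * α)‖ ≤ (k.divisors.card / √k) * (√k * ‖W k‖) := fun k hk ↦ by
    rw [Finset.mem_Icc] at hk
    have hk' : (0 : ℝ) < k := by exact_mod_cast hk.1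
    have hsk : 0 < √(k : ℝ) := Real.sqrt_pos.2 hk'
    rcases le_or_gt k U with h | h
    · rw [cHigh_eq_zero h, zero_mul, norm_zero]; positivity
    · have h2 : ∑ l ∈ Finset.Icc 1 (N / k), muHigh U l * ee ((k * l : ℕ) * α) = W k := by
        rw [hW]
        simp only
        refine (Finset.sum_subset_zero_on_sdiff (fun l hl ↦ ?_) (fun l hl ↦ ?_)
          (fun l hl ↦ ?_)).symm
        · rw [Finset.mem_filter, hs, Finset.mem_Ioc] at hl
          rw [Finset.mem_Icc, Nat.le_div_iff_mul_le hk.1]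
          exact ⟨by omega, hl.2⟩
        · rw [Finset.mem_sdiff, Finset.mem_Icc, Nat.le_div_iff_mul_le hk.1, Finset.mem_filter, hs,
            Finset.mem_Ioc, Nat.le_div_iff_mul_le hU] at hl
          rw [muHigh_apply, if_pos, zero_mul]
          by_contra! hl'
          have : l * U ≤ l * k := Nat.mul_le_mul_left _ h.le
          exact hl.2 ⟨⟨hl', by omega⟩, hl.1.2⟩
        · push_cast; ring_nf
      rw [h2, norm_mul]
      have h3 : (k.divisors.card / √k : ℝ) * (√k * ‖W k‖) = k.divisors.card * ‖W k‖ := by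
        field_simp
      rw [h3]
      gcongr
      exact norm_cHigh_le U k
  have h2 := sum_mul_norm_sq_le (muHigh U) (norm_muHigh_le U) α N s
    (fun k hk ↦ by rw [hs, Finset.mem_Ioc] at hk; omega)
  have h3 := h2.trans (bilinear_sum_le hb hU hα hUr hrN)
  have h4 := sum_divisors_sq_div_le N
  have h5 := Finset.sum_mul_sq_le_sq_mul_sq (Finset.Icc 1 N)
    (fun k : ℕ ↦ (k.divisors.card / √k : ℝ)) (fun k ↦ √k * ‖W k‖)
  have h6 : ∑ k ∈ Finset.Icc 1 N, (k.divisors.card / √k : ℝ) ^ 2 ≤ (1 + L) ^ 4 := by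
    refine le_of_eq_of_le (Finset.sum_congr rfl fun k _ ↦ ?_) h4
    rw [div_pow, Real.sq_sqrt (Nat.cast_nonneg _)]
  have h7 : ∑ k ∈ Finset.Icc 1 N, (√k * ‖W k‖) ^ 2 ≤ 24 * (1 + L) ^ 2 * N ^ 2 / U := by
    refine le_of_eq_of_le (Finset.sum_congr rfl fun k _ ↦ ?_) h3
    rw [mul_pow, Real.sq_sqrt (Nat.cast_nonneg _)]
  refine (norm_sum_le_of_le _ h1).trans ?_
  refine abs_le_of_sq_le_sq' ?_ (by positivity) |>.2
  calc _ ≤ (1 + L) ^ 4 * (24 * (1 + L) ^ 2 * N ^ 2 / U) :=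
        h5.trans (mul_le_mul h6 h7 (Finset.sum_nonneg fun _ _ ↦ sq_nonneg _) (by positivity))
    _ = 24 * ((1 + L) ^ 6 * N ^ 2 / U) := by ring
    _ ≤ 25 * ((1 + L) ^ 6 * N ^ 2 / U) := by gcongr; norm_num
    _ = _ := by rw [div_pow, Real.sq_sqrt hU'.le]; ring

lemma minor_arc_bound {U r N : ℕ} {b : ℤ} {α : ℝ} (hb : IsCoprime b (r : ℤ)) (hU : 2 ≤ U)
    (hα : |α - b / r| ≤ 1 / (r : ℝ) ^ 2) (hUr : U ^ 5 ≤ r) (hrN : r * U ^ 5 ≤ N) :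
    ‖∑ n ∈ Finset.Icc 1 N, (ArithmeticFunction.moebius n : ℂ) * ee (n * α)‖ ≤
      8 * (1 + Real.log N) ^ 3 * N / √U := by
  have hU' : (1 : ℝ) ≤ U := by exact_mod_cast (by omega : 1 ≤ U)
  have hU5 : U ≤ U ^ 5 := Nat.le_self_pow (by norm_num) U
  have hr : 0 < r := by omega
  have hr' : (0 : ℝ) < r := by exact_mod_cast hr
  have hrU : r * U ≤ N := le_trans (Nat.mul_le_mul_left _ hU5) hrN
  have hN1 : 1 ≤ N := le_trans (Nat.mul_pos hr (by omega)) hrU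
  have hN1' : (1 : ℝ) ≤ N := by exact_mod_cast hN1
  have hL := Real.log_nonneg hN1'
  have h2 : 2 * U ^ 2 ≤ r := by
    refine le_trans ?_ hUr
    calc 2 * U ^ 2 ≤ U * U ^ 2 * (U * U) := by
          nlinarith [Nat.mul_le_mul hU (le_refl (U ^ 2)), Nat.mul_pos (by omega : 0 < U) (by omega : 0 < U),
            Nat.mul_le_mul_left (U * U ^ 2) (Nat.mul_pos (by omega : 0 < U) (by omega : 0 < U))]
      _ = U ^ 5 := by ring
  have t1 := type_one_bound hb hr hα h2 N
  have t2 := type_two_bound hb (by omega) hα (hU5.trans hUr) hrU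
  have t0 : ‖∑ n ∈ Finset.Icc 1 N, muLow U n * ee (n * α)‖ ≤ U := by
    have h3 : ∀ n ∈ Finset.Icc 1 N, ‖muLow U n * ee (n * α)‖ ≤
        if n ∈ Finset.Icc 1 U then 1 else 0 := fun n hn ↦ by
      rw [Finset.mem_Icc] at hn
      rw [norm_mul, norm_ee, mul_one]
      split_ifs with h
      · exact norm_muLow_le U n
      · rw [muLow_apply, if_neg, norm_zero]
        rw [Finset.mem_Icc] at h; omega
    refine (norm_sum_le_of_le _ h3).trans ?_
    rw [Finset.sum_ite_mem]
    refine (Finset.sum_le_sum_of_subset_of_nonneg Finset.inter_subset_right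
      fun _ _ _ ↦ zero_le_one).trans_eq ?_
    simp
  rw [sum_moebius_vaughan U]
  set L := Real.log N
  have hsU : √(U : ℝ) ≤ U := by
    rw [Real.sqrt_le_left (by linarith)]; nlinarith
  have hsU0 : 0 < √(U : ℝ) := Real.sqrt_pos.2 (by linarith)
  have hb1 : (N : ℝ) / U ≤ (1 + L) ^ 3 * N / √U := by
    gcongr
    exact le_mul_of_one_le_left (by linarith) (one_le_pow₀ (by linarith))
  have e1 : (U : ℝ) ^ 4 * r ≤ N / U := by
    rw [le_div_iff₀ (by linarith)]
    have : ((r * U ^ 5 : ℕ) : ℝ) ≤ N := by exact_mod_cast hrN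
    push_cast at this
    linarith
  have e0 : (U : ℝ) ≤ N / U := by
    rw [le_div_iff₀ (by linarith)]
    have : U * U ≤ N := le_trans (Nat.mul_le_mul_right _ (hU5.trans hUr)) hrU
    exact_mod_cast this
  refine (norm_add_le_of_le ((norm_sub_le_of_le ((norm_mul _ _).trans_le
    (mul_le_mul (Complex.norm_two.le) t0 (norm_nonneg _) zero_le_two)) t1)) t2).trans ?_
  have : 5 * (1 + L) ^ 3 * N / √U = 5 * ((1 + L) ^ 3 * N / √U) := by ring
  have : 8 * (1 + L) ^ 3 * N / √U = 8 * ((1 + L) ^ 3 * N / √U) := by ring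
  linarith

lemma exists_log_pow_le (c : ℝ) (k : ℕ) : ∃ N₀ : ℕ, 3 ≤ N₀ ∧ ∀ x : ℝ, N₀ ≤ x →
    c * Real.log x ^ k ≤ x := by
  have h := (Real.isLittleO_pow_log_id_atTop (n := k)).const_mul_left c |>.bound one_pos
  rw [eventually_atTop] at h
  obtain ⟨y, hy⟩ := h
  refine ⟨max 3 ⌈y⌉₊, le_max_left _ _, fun x hx ↦ ?_⟩
  have h1 : ((3 : ℕ) : ℝ) ≤ x := le_trans (by exact_mod_cast le_max_left _ _) hx
  have h2 : y ≤ x := (Nat.le_ceil y).trans (le_trans (by exact_mod_cast le_max_right _ _) hx)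
  have h3 := hy x h2
  rw [one_mul, id, Real.norm_eq_abs, Real.norm_eq_abs, abs_of_nonneg (a := x) (by norm_num at h1; linarith)]
    at h3
  exact (le_abs_self _).trans h3

theorem davenport (B : ℕ) : ∃ C : ℝ, 0 < C ∧ ∃ N₀ : ℕ, 3 ≤ N₀ ∧ ∀ N : ℕ, N₀ ≤ N → ∀ α : ℝ,
    ‖∑ n ∈ Finset.Icc 1 N, (ArithmeticFunction.moebius n : ℂ) * ee (n * α)‖ ≤
      C * N / Real.log N ^ B := by
  set D := 2 * (B + 3) with hD
  obtain ⟨C, hC, hmaj⟩ := major_arc_bound (20 * D + B)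
  obtain ⟨N₀, hN₀, hN₀'⟩ := exists_log_pow_le 243 (5 * D)
  refine ⟨max 64 (8 * C * 243 ^ 4), by positivity, N₀, hN₀, fun N hN α ↦ ?_⟩
  have hN3 : 3 ≤ N := hN₀.trans hN
  have hN0 : (0 : ℝ) < N := by exact_mod_cast (by omega : 0 < N)
  have hlog := one_lt_log (x := N) (by exact_mod_cast hN3)
  have hlarge := hN₀' N (by exact_mod_cast hN)
  set L := Real.log N
  have hL0 : 0 < L := by linarith
  have hLD : 1 ≤ L ^ D := one_le_pow₀ hlog.le
  set U := ⌈L ^ D⌉₊ + 1 with hU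
  have hU1 : L ^ D ≤ U := by
    rw [hU]; push_cast; linarith [Nat.le_ceil (L ^ D)]
  have hU2 : (U : ℝ) ≤ 3 * L ^ D := by
    rw [hU]; push_cast; linarith [Nat.ceil_lt_add_one (a := L ^ D) (by positivity)]
  have hU3 : 2 ≤ U := by
    have : 0 < ⌈L ^ D⌉₊ := Nat.ceil_pos.2 (by linarith)
    omega
  set R := U ^ 5 with hR
  have hRle : (R : ℝ) ≤ 243 * L ^ (5 * D) := by
    rw [hR]; push_cast
    calc (U : ℝ) ^ 5 ≤ (3 * L ^ D) ^ 5 := by gcongr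
      _ = _ := by rw [mul_pow, ← pow_mul, mul_comm D]; norm_num
  have hRN : R ≤ N := by exact_mod_cast hRle.trans hlarge
  have hR0 : 0 < R := by positivity
  have hR0' : (0 : ℝ) < R := by exact_mod_cast hR0
  obtain ⟨q, hq1, hq2⟩ := Real.exists_rat_abs_sub_le_and_den_le α (Nat.div_pos hRN hR0)
  have hqd : 0 < q.den := q.pos
  have hqd' : (0 : ℝ) < q.den := by exact_mod_cast hqd
  have hcast : (q : ℝ) = q.num / q.den := by exact_mod_cast (Rat.num_div_den q).symm
  rw [hcast] at hq1
  have hmax1 : (64 : ℝ) ≤ max 64 (8 * C * 243 ^ 4) := le_max_left _ _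
  have hmax2 : 8 * C * 243 ^ 4 ≤ max 64 (8 * C * 243 ^ 4) := le_max_right _ _
  have hdenN : (q.den : ℝ) ≤ (N / R : ℕ) := by exact_mod_cast hq2
  rcases le_or_gt R q.den with hcase | hcase
  · have h1 : |α - q.num / q.den| ≤ 1 / (q.den : ℝ) ^ 2 := by
      refine hq1.trans ?_
      rw [pow_two]
      gcongr
      linarith
    have h2 := minor_arc_bound (Rat.isCoprime_num_den q) hU3 h1 hcase
      ((Nat.le_div_iff_mul_le hR0).1 hq2)
    refine h2.trans ?_
    have h3 : L ^ (B + 3) ≤ √U := by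
      refine Real.le_sqrt_of_sq_le ?_
      rw [← pow_mul, mul_comm]; exact hU1
    calc 8 * (1 + L) ^ 3 * N / √U ≤ 8 * (2 * L) ^ 3 * N / L ^ (B + 3) := by gcongr; linarith
      _ = 64 * N / L ^ B := by rw [pow_add]; field_simp; ring
      _ ≤ _ := by gcongr
  · have : NeZero q.den := ⟨hqd.ne'⟩
    refine (hmaj q.den q.num α N hN3).trans ?_
    have hden : (q.den : ℝ) ≤ R := by exact_mod_cast hcase.le
    have h1 : |α - q.num / q.den| ≤ R / N := by
      refine hq1.trans ?_
      have h4 : (N : ℝ) / R ≤ (N / R : ℕ) + 1 := by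
        rw [div_le_iff₀ hR0']
        have := Nat.div_add_mod N R
        have := Nat.mod_lt N hR0
        have h5 : N ≤ (N / R + 1) * R := by nlinarith
        exact_mod_cast h5
      have h6 : (1 : ℝ) ≤ q.den := by exact_mod_cast hqd
      rw [← one_div_div (N : ℝ)]
      refine one_div_le_one_div_of_le (by positivity) (h4.trans ?_)
      exact le_mul_of_one_le_right (by positivity) h6
    have h2 : 1 + N * (7 * |α - q.num / q.den|) ≤ 8 * R := by
      have h3 : (1 : ℝ) ≤ R := by exact_mod_cast hR0
      calc 1 + N * (7 * |α - q.num / q.den|) ≤ 1 + N * (7 * (R / N)) := by gcongr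
        _ = 1 + 7 * R := by field_simp
        _ ≤ _ := by linarith
    calc C * q.den ^ 3 * N / L ^ (20 * D + B) * (1 + N * (7 * |α - q.num / q.den|)) ≤
          C * R ^ 3 * N / L ^ (20 * D + B) * (8 * R) := by gcongr
      _ = 8 * C * R ^ 4 * N / L ^ (20 * D + B) := by ring
      _ ≤ 8 * C * (243 * L ^ (5 * D)) ^ 4 * N / L ^ (20 * D + B) := by gcongr
      _ = 8 * C * 243 ^ 4 * N / L ^ B := by
        rw [mul_pow, ← pow_mul, show 5 * D * 4 = 20 * D by ring, pow_add]; field_simp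
      _ ≤ _ := by gcongr

end Davenport

section Variance

lemma sum_ee_range {K : ℕ} (hK : 0 < K) (t : ℤ) :
    ∑ j ∈ Finset.range K, ee (t * (j / K)) = if (K : ℤ) ∣ t then (K : ℂ) else 0 := by
  have hK' : (K : ℝ) ≠ 0 := by exact_mod_cast hK.ne'
  have h1 : ∀ j ∈ Finset.range K, ee (t * (j / K)) = ee (t / K) ^ j := fun j _ ↦ by
    rw [← ee_nat_mul]; ring_nf
  rw [Finset.sum_congr rfl h1]
  split_ifs with h
  · obtain ⟨m, rfl⟩ := h
    have : ee (((K * m : ℤ) : ℝ) / K) = 1 := by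
      rw [← ee_int m]; congr 1; push_cast; field_simp
    rw [this]; simp
  · have h2 : ee (t / K) ≠ 1 := fun h3 ↦ h <| by
      rw [ee, Complex.exp_eq_one_iff] at h3
      obtain ⟨m, hm⟩ := h3
      refine ⟨m, ?_⟩
      have h4 : ((t / K : ℝ) : ℂ) = m := by
        have hpi : (2 * Real.pi * I : ℂ) ≠ 0 := Complex.two_pi_I_ne_zero
        have : (2 * Real.pi * I : ℂ) * ((t / K : ℝ) : ℂ) = 2 * Real.pi * I * m := by
          linear_combination hm
        exact mul_left_cancel₀ hpi this
      have h5 : (t / K : ℝ) = m := by exact_mod_cast h4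
      rw [div_eq_iff hK'] at h5
      have h6 : (t : ℝ) = ((K * m : ℤ) : ℝ) := by rw [h5]; push_cast; ring
      exact_mod_cast h6
    rw [geom_sum_eq h2, ← ee_nat_mul]
    have : (K : ℝ) * (t / K) = t := by field_simp
    rw [this, ee_int, sub_self, zero_div]

lemma parseval {K N : ℕ} (hNK : N < K) (f : ℕ → ℂ) :
    ∑ j ∈ Finset.range K, ‖∑ n ∈ Finset.Icc 1 N, f n * ee (n * (j / K))‖ ^ 2 =
      K * ∑ n ∈ Finset.Icc 1 N, ‖f n‖ ^ 2 := by
  have h : ((∑ j ∈ Finset.range K, ‖∑ n ∈ Finset.Icc 1 N, f n * ee (n * (j / K))‖ ^ 2 : ℝ) : ℂ) =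
      ((K * ∑ n ∈ Finset.Icc 1 N, ‖f n‖ ^ 2 : ℝ) : ℂ) := by
    push_cast
    simp_rw [← Complex.mul_conj', map_sum, Finset.sum_mul_sum]
    rw [Finset.sum_comm, Finset.mul_sum]
    refine Finset.sum_congr rfl fun n hn ↦ ?_
    rw [Finset.sum_comm, Finset.sum_eq_single_of_mem n hn]
    · have h1 : ∀ j ∈ Finset.range K, f n * ee (n * (j / K)) *
          (starRingEnd ℂ) (f n * ee (n * (j / K))) = f n * (starRingEnd ℂ) (f n) := fun j _ ↦ by
        rw [Complex.mul_conj', Complex.mul_conj', norm_mul, norm_ee, mul_one]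
      rw [Finset.sum_congr rfl h1]; simp
    · intro m hm hmn
      rw [Finset.mem_Icc] at hn hm
      have h1 : ∀ j ∈ Finset.range K, f n * ee (n * (j / K)) *
          (starRingEnd ℂ) (f m * ee (m * (j / K))) =
          f n * (starRingEnd ℂ) (f m) * ee (((n - m : ℤ) : ℝ) * (j / K)) := fun j _ ↦ by
        have h2 : ee (((n - m : ℤ) : ℝ) * (j / K)) = ee (n * (j / K)) * ee (-(m * (j / K))) := by
          rw [← ee_add]; push_cast; ring_nf
        rw [map_mul, conj_ee, h2]; ring
      rw [Finset.sum_congr rfl h1, ← Finset.mul_sum, sum_ee_range (by omega), if_neg, mul_zero]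
      intro hdvd
      have := Int.eq_zero_of_abs_lt_dvd hdvd (by rw [abs_lt]; omega)
      omega
  exact_mod_cast h

/-- A correlation sum, bounded through the circle method. -/
lemma norm_correlation_le {N : ℕ} {a D : ℕ → ℂ} {B : ℝ}
    (hB : ∀ α : ℝ, ‖∑ n ∈ Finset.Icc 1 N, a n * ee (n * α)‖ ≤ B) :
    ‖∑ n ∈ Finset.Icc 1 N, ∑ m ∈ Finset.Icc 1 N, ∑ h ∈ Finset.Icc 1 N,
      if m + h = n then (starRingEnd ℂ) (a n) * a m * D h else 0‖ ≤
      B * (√(∑ n ∈ Finset.Icc 1 N, ‖a n‖ ^ 2) * √(∑ h ∈ Finset.Icc 1 N, ‖D h‖ ^ 2)) := by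
  set K := 2 * N + 1 with hK
  have hK0 : 0 < K := by omega
  have hK0' : (0 : ℝ) < K := by exact_mod_cast hK0
  set S : ℕ → ℂ := fun j ↦ ∑ n ∈ Finset.Icc 1 N, a n * ee (n * (j / K)) with hS
  set T : ℕ → ℂ := fun j ↦ ∑ n ∈ Finset.Icc 1 N, D n * ee (n * (j / K)) with hT
  have hSB : ∀ j, ‖S j‖ ≤ B := fun j ↦ hB _
  have hB0 : 0 ≤ B := (norm_nonneg _).trans (hSB 0)
  have key : ∑ j ∈ Finset.range K, (starRingEnd ℂ) (S j) * S j * T j =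
      K * ∑ n ∈ Finset.Icc 1 N, ∑ m ∈ Finset.Icc 1 N, ∑ h ∈ Finset.Icc 1 N,
      if m + h = n then (starRingEnd ℂ) (a n) * a m * D h else 0 := by
    simp only [hS, hT, map_sum, Finset.sum_mul_sum]
    simp_rw [Finset.sum_mul, Finset.mul_sum]
    rw [Finset.sum_comm]
    refine Finset.sum_congr rfl fun n hn ↦ ?_
    refine (Finset.sum_comm.trans (Finset.sum_congr rfl fun h hh ↦ Finset.sum_comm)).trans
      (Finset.sum_comm.trans ?_)
    refine Finset.sum_congr rfl fun m hm ↦ Finset.sum_congr rfl fun h hh ↦ ?_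
    have h1 : ∀ j ∈ Finset.range K, (starRingEnd ℂ) (a n * ee (n * (j / K))) *
        (a m * ee (m * (j / K))) * (D h * ee (h * (j / K))) =
        (starRingEnd ℂ) (a n) * a m * D h * ee (((m + h - n : ℤ) : ℝ) * (j / K)) := fun j _ ↦ by
      have h2 : ee (((m + h - n : ℤ) : ℝ) * (j / K)) =
          ee (m * (j / K)) * ee (h * (j / K)) * ee (-(n * (j / K))) := by
        rw [← ee_add, ← ee_add]; push_cast; ring_nf
      rw [map_mul, conj_ee, h2]; ring
    rw [Finset.sum_congr rfl h1, ← Finset.mul_sum, sum_ee_range hK0]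
    rw [Finset.mem_Icc] at hn hm hh
    by_cases hc : m + h = n
    · rw [if_pos hc, if_pos]
      · ring
      · rw [show (m + h - n : ℤ) = 0 by omega]; exact dvd_zero _
    · rw [if_neg hc, if_neg]
      · simp
      · intro hdvd
        have := Int.eq_zero_of_abs_lt_dvd hdvd (by rw [abs_lt]; omega)
        omega
  have h1 : ‖∑ j ∈ Finset.range K, (starRingEnd ℂ) (S j) * S j * T j‖ ≤
      B * ∑ j ∈ Finset.range K, ‖S j‖ * ‖T j‖ := by
    rw [Finset.mul_sum]
    refine norm_sum_le_of_le _ fun j _ ↦ ?_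
    rw [norm_mul, norm_mul, RCLike.norm_conj, mul_assoc]
    gcongr
    exact hSB j
  have h2 := Real.sum_mul_le_sqrt_mul_sqrt (Finset.range K) (fun j ↦ ‖S j‖) (fun j ↦ ‖T j‖)
  have h3 := parseval (K := K) (N := N) (by omega) a
  have h4 := parseval (K := K) (N := N) (by omega) D
  rw [h3, h4, Real.sqrt_mul hK0'.le, Real.sqrt_mul hK0'.le] at h2
  rw [key, norm_mul, Complex.norm_natCast] at h1
  have h5 := h1.trans (mul_le_mul_of_nonneg_left h2 hB0)
  have h6 : √(K : ℝ) * √K = K := Real.mul_self_sqrt hK0'.le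
  refine le_of_mul_le_mul_left (h5.trans_eq ?_) hK0'
  linear_combination (B * (√(∑ n ∈ Finset.Icc 1 N, ‖a n‖ ^ 2) *
    √(∑ h ∈ Finset.Icc 1 N, ‖D h‖ ^ 2))) * h6

lemma sum_residue_sq {q : ℕ} (hq : 0 < q) (s : Finset ℕ) (a : ℕ → ℝ) :
    ∑ c ∈ Finset.Icc 1 q, (∑ n ∈ s.filter (fun n ↦ n % q = c % q), a n) ^ 2 =
      ∑ n ∈ s, ∑ m ∈ s, if n % q = m % q then a n * a m else 0 := by
  simp_rw [Finset.sum_filter, sq, Finset.sum_mul_sum]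
  rw [Finset.sum_comm]
  refine Finset.sum_congr rfl fun n _ ↦ ?_
  rw [Finset.sum_comm]
  refine Finset.sum_congr rfl fun m _ ↦ ?_
  have hnq := Nat.mod_lt n hq
  have hmod : ∀ c ∈ Finset.Icc 1 q, c % q = if c = q then 0 else c := fun c hc ↦ by
    rw [Finset.mem_Icc] at hc
    split_ifs with h
    · rw [h, Nat.mod_self]
    · exact Nat.mod_eq_of_lt (by omega)
  have hmem : (if n % q = 0 then q else n % q) ∈ Finset.Icc 1 q := by
    rw [Finset.mem_Icc]; split_ifs <;> omega
  rw [Finset.sum_eq_single_of_mem _ hmem]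
  · have h1 : (if n % q = 0 then q else n % q) % q = n % q := by
      split_ifs with h
      · rw [Nat.mod_self, h]
      · exact Nat.mod_mod _ _
    rw [h1, if_pos rfl]
    by_cases h : n % q = m % q
    · rw [if_pos h, if_pos h.symm]
    · rw [if_neg h, if_neg (Ne.symm h), mul_zero]
  · intro c hc hne
    rw [if_neg, zero_mul]
    rw [hmod c hc]
    intro h
    apply hne
    rw [Finset.mem_Icc] at hc
    split_ifs at h ⊢ <;> omega

lemma sum_sum_eq_diag_add {s : Finset ℕ} {G : ℕ → ℕ → ℝ} (hG : ∀ k k', G k k' = G k' k) :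
    ∑ n ∈ s, ∑ m ∈ s, G n m =
      ∑ n ∈ s, G n n + 2 * ∑ n ∈ s, ∑ m ∈ s, if m < n then G n m else 0 := by
  have h1 : ∀ n ∈ s, ∑ m ∈ s, G n m = G n n + ∑ m ∈ s, (if m < n then G n m else 0) +
      ∑ m ∈ s, (if n < m then G n m else 0) := fun n hn ↦ by
    have h2 : G n n = ∑ m ∈ s, if n = m then G n m else 0 := by
      rw [Finset.sum_ite_eq, if_pos hn]
    rw [h2, ← Finset.sum_add_distrib, ← Finset.sum_add_distrib]
    refine Finset.sum_congr rfl fun m _ ↦ ?_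
    rcases lt_trichotomy m n with h | h | h
    · simp [h, h.ne', h.not_gt]
    · simp [h]
    · simp [h, h.ne, h.not_gt]
  rw [Finset.sum_congr rfl h1, Finset.sum_add_distrib, Finset.sum_add_distrib]
  have h3 : ∑ n ∈ s, ∑ m ∈ s, (if n < m then G n m else 0) =
      ∑ n ∈ s, ∑ m ∈ s, if m < n then G n m else 0 := by
    rw [Finset.sum_comm]
    refine Finset.sum_congr rfl fun n _ ↦ Finset.sum_congr rfl fun m _ ↦ ?_
    rw [hG]
  rw [h3]; ring

/-- The number of divisors of `h` not exceeding `M`. -/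
def divCount (M h : ℕ) : ℕ := ((Finset.Icc 1 M).filter (· ∣ h)).card

lemma divCount_le {M h : ℕ} (hh : 1 ≤ h) : divCount M h ≤ h.divisors.card := by
  refine Finset.card_le_card fun d hd ↦ ?_
  rw [Finset.mem_filter] at hd
  exact Nat.mem_divisors.2 ⟨hd.2, by omega⟩

lemma variance_eq (M N : ℕ) (a : ℕ → ℝ) :
    ∑ q ∈ Finset.Icc 1 M, ∑ c ∈ Finset.Icc 1 q,
      (∑ n ∈ (Finset.Icc 1 N).filter (fun n ↦ n % q = c % q), a n) ^ 2 =
      M * ∑ n ∈ Finset.Icc 1 N, a n ^ 2 +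
      2 * ∑ n ∈ Finset.Icc 1 N, ∑ m ∈ Finset.Icc 1 N, ∑ h ∈ Finset.Icc 1 N,
        if m + h = n then a n * a m * divCount M h else 0 := by
  have h1 : ∀ q ∈ Finset.Icc 1 M, ∑ c ∈ Finset.Icc 1 q,
      (∑ n ∈ (Finset.Icc 1 N).filter (fun n ↦ n % q = c % q), a n) ^ 2 =
      ∑ n ∈ Finset.Icc 1 N, a n ^ 2 + 2 * ∑ n ∈ Finset.Icc 1 N, ∑ m ∈ Finset.Icc 1 N,
        ∑ h ∈ Finset.Icc 1 N, if m + h = n then a n * a m * (if q ∣ h then 1 else 0) else 0 :=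
      fun q hq ↦ by
    rw [sum_residue_sq (Finset.mem_Icc.1 hq).1, sum_sum_eq_diag_add
      (G := fun n m ↦ if n % q = m % q then a n * a m else 0) (fun k k' ↦ by
        by_cases h : k % q = k' % q
        · rw [if_pos h, if_pos h.symm, mul_comm]
        · rw [if_neg h, if_neg (Ne.symm h)])]
    refine congrArg₂ (· + ·) (Finset.sum_congr rfl fun n _ ↦ ?_) (congrArg (2 * ·)
      (Finset.sum_congr rfl fun n hn ↦ Finset.sum_congr rfl fun m hm ↦ ?_))
    · rw [if_pos rfl, sq]
    · rw [Finset.mem_Icc] at hn hm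
      by_cases hmn : m < n
      · rw [if_pos hmn, Finset.sum_eq_single_of_mem (n - m) (Finset.mem_Icc.2 (by omega)),
          if_pos (show m + (n - m) = n by omega)]
        · have : q ∣ n - m ↔ n % q = m % q := by
            rw [← Nat.modEq_iff_dvd' hmn.le]
            exact ⟨fun h ↦ h.symm, fun h ↦ h.symm⟩
          simp [this]
        · intro h _ hne
          rw [if_neg (by omega)]
      · rw [if_neg hmn, Finset.sum_eq_zero]
        intro h hh
        rw [Finset.mem_Icc] at hh
        rw [if_neg (by omega)]
  rw [Finset.sum_congr rfl h1, Finset.sum_add_distrib, ← Finset.mul_sum, Finset.sum_const,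
    Nat.card_Icc, nsmul_eq_mul, Nat.add_sub_cancel, Finset.sum_comm]
  congr 2
  refine Finset.sum_congr rfl fun n _ ↦ ?_
  rw [Finset.sum_comm]
  refine Finset.sum_congr rfl fun m _ ↦ ?_
  rw [Finset.sum_comm]
  refine Finset.sum_congr rfl fun h _ ↦ ?_
  split_ifs with hc
  · rw [← Finset.mul_sum, divCount, Finset.card_filter]
    push_cast; rfl
  · simp

lemma sum_one_div_sq_le {N : ℕ} (hN : 2 ≤ N) :
    ∑ d ∈ Finset.Icc 2 N, (1 : ℝ) / (d * d) ≤ 3 / 4 - 1 / N := by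
  induction N, hN using Nat.le_induction with
  | base => norm_num
  | succ n hn ih =>
    rw [Finset.sum_Icc_succ_top (by omega)]
    have hn' : (2 : ℝ) ≤ n := by exact_mod_cast hn
    have : (1 : ℝ) / ((n + 1 : ℕ) * (n + 1 : ℕ)) ≤ 1 / n - 1 / (n + 1 : ℕ) := by
      push_cast
      rw [div_sub_div _ _ (by linarith) (by linarith), div_le_div_iff₀ (by positivity) (by positivity)]
      nlinarith
    linarith

lemma sum_moebius_sq_ge (N : ℕ) :
    (N : ℝ) / 4 ≤ ∑ n ∈ Finset.Icc 1 N, (ArithmeticFunction.moebius n : ℝ) ^ 2 := by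
  rcases lt_or_ge N 2 with h | hN
  · interval_cases N
    · simp
    · norm_num
  have h1 : (1 : ℝ) * N ≤ ∑ n ∈ Finset.Icc 1 N, ((ArithmeticFunction.moebius n : ℝ) ^ 2 +
      ∑ d ∈ Finset.Icc 2 N, if d * d ∣ n then (1 : ℝ) else 0) := by
    have : (1 : ℝ) * N = ∑ n ∈ Finset.Icc 1 N, (1 : ℝ) := by simp
    rw [this]
    refine Finset.sum_le_sum fun n hn ↦ ?_
    rw [Finset.mem_Icc] at hn
    have h0 : 0 ≤ ∑ d ∈ Finset.Icc 2 N, if d * d ∣ n then (1 : ℝ) else 0 :=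
      Finset.sum_nonneg fun _ _ ↦ by split_ifs <;> norm_num
    by_cases hs : Squarefree n
    · have := ArithmeticFunction.moebius_sq_eq_one_of_squarefree hs
      have h2 : (ArithmeticFunction.moebius n : ℝ) ^ 2 = 1 := by exact_mod_cast this
      linarith
    · rw [Squarefree] at hs
      push Not at hs
      obtain ⟨d, hd, hd'⟩ := hs
      rw [Nat.isUnit_iff] at hd'
      have hd0 : d ≠ 0 := by rintro rfl; simp at hd; omega
      have hdn := Nat.le_of_dvd (by omega) hd
      have hdd : d ≤ d * d := Nat.le_mul_self d
      have h2 := Finset.single_le_sum (f := fun d ↦ if d * d ∣ n then (1 : ℝ) else 0)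
        (s := Finset.Icc 2 N) (fun _ _ ↦ by split_ifs <;> norm_num)
        (Finset.mem_Icc.2 (by omega : 2 ≤ d ∧ d ≤ N))
      simp only [if_pos hd] at h2
      have := sq_nonneg (ArithmeticFunction.moebius n : ℝ)
      linarith
  have h2 : ∑ n ∈ Finset.Icc 1 N, ∑ d ∈ Finset.Icc 2 N, (if d * d ∣ n then (1 : ℝ) else 0) ≤
      N * (3 / 4) := by
    rw [Finset.sum_comm]
    have h3 : ∀ d ∈ Finset.Icc 2 N, ∑ n ∈ Finset.Icc 1 N, (if d * d ∣ n then (1 : ℝ) else 0) ≤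
        N * (1 / (d * d)) := fun d hd ↦ by
      rw [← Finset.sum_filter, Finset.sum_const, nsmul_one]
      have h4 : (Finset.Icc 1 N).filter (d * d ∣ ·) = (Finset.Ioc 0 N).filter (d * d ∣ ·) := by
        ext; simp [Nat.lt_iff_add_one_le]
      rw [h4, Nat.Ioc_filter_dvd_card_eq_div]
      refine Nat.cast_div_le.trans_eq ?_
      push_cast; ring
    refine (Finset.sum_le_sum h3).trans ?_
    rw [← Finset.mul_sum]
    gcongr
    have := sum_one_div_sq_le hN
    have : (0 : ℝ) ≤ 1 / N := by positivity
    linarith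
  rw [Finset.sum_add_distrib] at h1
  linarith

lemma off_diagonal_le {M N : ℕ} {B : ℝ} (hN : 1 ≤ N)
    (hB : ∀ α : ℝ, ‖∑ n ∈ Finset.Icc 1 N, (ArithmeticFunction.moebius n : ℂ) * ee (n * α)‖ ≤ B) :
    |∑ n ∈ Finset.Icc 1 N, ∑ m ∈ Finset.Icc 1 N, ∑ h ∈ Finset.Icc 1 N,
      if m + h = n then (ArithmeticFunction.moebius n : ℝ) * ArithmeticFunction.moebius m *
        divCount M h else 0| ≤ B * (N * (1 + Real.log N) ^ 2) := by
  have hB0 : 0 ≤ B := (norm_nonneg _).trans (hB 0)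
  have hL := Real.log_nonneg (x := N) (by exact_mod_cast hN)
  set L := Real.log N
  have h1 := norm_correlation_le (D := fun h ↦ (divCount M h : ℂ)) hB
  rw [← Real.norm_eq_abs, ← Complex.norm_real]
  have h2 : ∑ n ∈ Finset.Icc 1 N, ‖(ArithmeticFunction.moebius n : ℂ)‖ ^ 2 ≤ N := by
    refine (Finset.sum_le_sum (g := fun _ ↦ (1 : ℝ)) fun n _ ↦
      pow_le_one₀ (norm_nonneg _) (norm_moebius_le n)).trans_eq ?_
    simp
  have h3 : ∑ h ∈ Finset.Icc 1 N, ‖(divCount M h : ℂ)‖ ^ 2 ≤ N * (1 + L) ^ 4 := by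
    refine le_trans ?_ (mul_le_mul_of_nonneg_left (sum_divisors_sq_div_le N) (Nat.cast_nonneg N))
    rw [Finset.mul_sum]
    refine Finset.sum_le_sum fun h hh ↦ ?_
    rw [Finset.mem_Icc] at hh
    have hh0 : (0 : ℝ) < h := by exact_mod_cast hh.1
    have hhN : (h : ℝ) ≤ N := by exact_mod_cast hh.2
    rw [Complex.norm_natCast, mul_div_assoc', le_div_iff₀ hh0, mul_comm]
    have := divCount_le (M := M) hh.1
    gcongr
  refine le_trans (le_of_eq ?_) (h1.trans ?_)
  · congr 1
    push_cast
    refine Finset.sum_congr rfl fun n _ ↦ Finset.sum_congr rfl fun m _ ↦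
      Finset.sum_congr rfl fun h _ ↦ ?_
    split_ifs <;> simp
  · refine mul_le_mul_of_nonneg_left ?_ hB0
    calc _ ≤ √(N : ℝ) * √(N * (1 + L) ^ 4) := by gcongr
      _ = N * (1 + L) ^ 2 := by
        rw [← Real.sqrt_mul (Nat.cast_nonneg _)]
        have : (N : ℝ) * (N * (1 + L) ^ 4) = (N * (1 + L) ^ 2) ^ 2 := by ring
        rw [this, Real.sqrt_sq (by positivity)]

theorem variance_asymptotic {A ε : ℝ} (hε : 0 < ε) : ∃ x₀ : ℝ, ∀ x Q : ℝ, x₀ < x →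
    x * Real.log x ^ (-A) ≤ Q →
    |∑ q ∈ Finset.Icc 1 ⌊Q⌋₊, ∑ c ∈ Finset.Icc 1 q,
      (∑ n ∈ (Finset.Icc 1 ⌊x⌋₊).filter (fun n ↦ n % q = c % q),
        (ArithmeticFunction.moebius n : ℝ)) ^ 2 -
      Q * ∑ n ∈ Finset.Icc 1 ⌊x⌋₊, (ArithmeticFunction.moebius n : ℝ) ^ 2| ≤
      ε * Q * ∑ n ∈ Finset.Icc 1 ⌊x⌋₊, (ArithmeticFunction.moebius n : ℝ) ^ 2 := by
  set k := ⌈A⌉₊ with hk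
  have hAk : A ≤ k := Nat.le_ceil A
  obtain ⟨C, hC, N₁, hN₁, hdav⟩ := davenport (k + 3)
  obtain ⟨N₂, hN₂, hN₂'⟩ := exists_log_pow_le (2 / ε * 2 ^ k) k
  set c := 64 * C * 2 ^ k / ε with hc
  refine ⟨(N₁ + N₂ + 1 : ℕ) + Real.exp c, fun x Q hx hQ ↦ ?_⟩
  have hexp := Real.exp_pos c
  have hxlarge : ((N₁ + N₂ + 1 : ℕ) : ℝ) < x := by linarith
  have hx0 : 0 ≤ x := le_trans (Nat.cast_nonneg _) hxlarge.le
  set N := ⌊x⌋₊ with hN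
  have hNbig : N₁ + N₂ + 1 ≤ N := Nat.le_floor hxlarge.le
  have hN3 : (3 : ℝ) ≤ N := by exact_mod_cast (by omega : 3 ≤ N)
  have hNx : (N : ℝ) ≤ x := Nat.floor_le hx0
  have hxN : x < N + 1 := Nat.lt_floor_add_one x
  have hL1 := one_lt_log hN3
  have hcN : Real.exp c ≤ N := by
    have : ((N₁ + N₂ + 1 : ℕ) : ℝ) ≥ 1 := by exact_mod_cast (by omega : 1 ≤ N₁ + N₂ + 1)
    linarith
  have hcL : c ≤ Real.log N := (Real.le_log_iff_exp_le (by linarith)).2 hcN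
  have hlogx : Real.log x ≤ 2 * Real.log N := by
    have h1 : x ≤ (N : ℝ) ^ 2 := by nlinarith
    have h2 := Real.log_le_log (by linarith) h1
    rwa [Real.log_pow, Nat.cast_ofNat] at h2
  have hlogx1 : Real.log N ≤ Real.log x := Real.log_le_log (by linarith) hNx
  have hD := hdav N (by omega)
  have hlarge := hN₂' N (by exact_mod_cast (by omega : N₂ ≤ N))
  set L := Real.log N with hL
  have hL0 : 0 < L := by linarith
  have hQ1 : N / (2 * L) ^ k ≤ Q := by
    refine le_trans ?_ hQ
    have h1 : (1 : ℝ) / (2 * L) ^ k ≤ Real.log x ^ (-A) := by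
      rw [Real.rpow_neg (by linarith), ← one_div]
      refine one_div_le_one_div_of_le (Real.rpow_pos_of_pos (by linarith) _) ?_
      calc Real.log x ^ A ≤ Real.log x ^ (k : ℝ) :=
            Real.rpow_le_rpow_of_exponent_le (by linarith) hAk
        _ = Real.log x ^ k := Real.rpow_natCast _ _
        _ ≤ _ := by gcongr; linarith
    calc (N : ℝ) / (2 * L) ^ k = N * (1 / (2 * L) ^ k) := by ring
      _ ≤ _ := by gcongr
  have hQ0 : 0 ≤ Q := le_trans (by positivity) hQ1
  have hQ2 : 1 ≤ ε / 2 * Q := by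
    have h1 : 2 / ε ≤ N / (2 * L) ^ k := by
      rw [le_div_iff₀ (by positivity), mul_pow]
      linarith
    have h2 := mul_le_mul_of_nonneg_left (h1.trans hQ1) (by positivity : 0 ≤ ε / 2)
    have h3 : ε / 2 * (2 / ε) = 1 := by field_simp
    linarith
  rw [variance_eq]
  have hoff := off_diagonal_le (M := ⌊Q⌋₊) (by omega) hD
  have hsq := sum_moebius_sq_ge N
  set Z := ∑ n ∈ Finset.Icc 1 N, (ArithmeticFunction.moebius n : ℝ) ^ 2
  set E := ∑ n ∈ Finset.Icc 1 N, ∑ m ∈ Finset.Icc 1 N, ∑ h ∈ Finset.Icc 1 N,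
      if m + h = n then (ArithmeticFunction.moebius n : ℝ) * ArithmeticFunction.moebius m *
        divCount ⌊Q⌋₊ h else 0
  have hfl : |(⌊Q⌋₊ : ℝ) - Q| ≤ 1 := by
    rw [abs_le]
    constructor
    · linarith [Nat.lt_floor_add_one Q]
    · linarith [Nat.floor_le hQ0]
  have hZ0 : 0 ≤ Z := le_trans (by positivity) hsq
  have hE : 2 * |E| ≤ ε / 2 * Q * Z := by
    have h1 : ε / 2 * (N / (2 * L) ^ k) * (N / 4) ≤ ε / 2 * Q * Z := by gcongr
    refine le_trans ?_ h1
    calc 2 * |E| ≤ 2 * (C * N / L ^ (k + 3) * (N * (2 * L) ^ 2)) := by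
          have : 1 + L ≤ 2 * L := by linarith
          refine mul_le_mul_of_nonneg_left (hoff.trans ?_) zero_le_two
          gcongr
      _ = 8 * C * N ^ 2 / L ^ (k + 1) := by
          rw [pow_add, pow_add]; field_simp; ring
      _ = c * (ε / 8 * (N ^ 2 / ((2 * L) ^ k * L))) := by
          rw [hc, mul_pow, pow_succ]; field_simp; ring
      _ ≤ L * (ε / 8 * (N ^ 2 / ((2 * L) ^ k * L))) := by gcongr
      _ = _ := by field_simp; norm_num
  calc |⌊Q⌋₊ * Z + 2 * E - Q * Z| = |(⌊Q⌋₊ - Q) * Z + 2 * E| := by ring_nf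
    _ ≤ |(⌊Q⌋₊ - Q) * Z| + |2 * E| := abs_add_le _ _
    _ = |(⌊Q⌋₊ : ℝ) - Q| * Z + 2 * |E| := by
        rw [abs_mul, abs_mul, abs_of_nonneg hZ0, abs_two]
    _ ≤ 1 * Z + ε / 2 * Q * Z := by gcongr
    _ ≤ ε / 2 * Q * Z + ε / 2 * Q * Z := by gcongr
    _ = ε * Q * Z := by ring

end Variance

end MoebiusVariance

open Classical Finset

/-- The variance of the Möbius function in arithmetic progressions is
asymptotically `Q Σ_{n ≤ x} μ(n)²` when `x(log x)^{-A} ≤ Q = o(x)`. -/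
theorem moebius_variance (A : ℝ) (hA : 0 < A) (ε : ℝ) (hε : 0 < ε) :
    ∃ δ x₀ : ℝ, 0 < δ ∧ ∀ x Q : ℝ, x₀ < x →
      x * Real.log x ^ (-A) ≤ Q → Q ≤ δ * x →
      |(∑ q ∈ Finset.Icc 1 ⌊Q⌋₊, ∑ a ∈ Finset.Icc 1 q,
          (∑ n ∈ (Finset.Icc 1 ⌊x⌋₊).filter (fun n => n % q = a % q),
            ((ArithmeticFunction.moebius n : ℤ) : ℝ)) ^ 2) -
        Q * ∑ n ∈ Finset.Icc 1 ⌊x⌋₊, ((ArithmeticFunction.moebius n : ℤ) : ℝ) ^ 2| ≤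
      ε * Q * ∑ n ∈ Finset.Icc 1 ⌊x⌋₊, ((ArithmeticFunction.moebius n : ℤ) : ℝ) ^ 2 := by
  obtain ⟨x₀, h⟩ := MoebiusVariance.variance_asymptotic (A := A) hε
  exact ⟨1, x₀, one_pos, fun x Q hx hQ _ ↦ by convert h x Q hx hQ⟩
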